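/- Let (ρ, u, ω, P) be a smooth solution of the nonhomogeneous incompressible asymmetric fluid system on [0,T] × 𝕋² with 0 ≤ ρ ≤ ρ* and no vacuum. Then for every p ∈ [2,∞] and every sufficiently small ε > 0, setting p* = 2p/(p−2), there is a constant C_{0,T} depending only on ρ*, ‖√ρ₀ u₀‖_{L²}, ‖√ρ₀ ω₀‖_{L²}, K₀, p, ε such that ‖∇²(√t·u)‖_{L^p(0,T;L^{p*−ε})} + ‖∇²(√t·ω)‖_{L^p(0,T;L^{p*−ε})} + ‖√t·ω‖_{L^p(0,T;L^{p*−ε})} + ‖∇(√t·P)‖_{L^p(0,T;L^{p*−ε})} ≤ C_{0,T}. Furthermore, for every s ∈ [1,2) there exists θ > 0 such that ∫₀^T ( ‖∇u(t)‖_{L^∞}^s + ‖∇ω(t)‖_{L^∞}^s ) dt ≤ C_{0,T} T^θ. -/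

import Mathlib

noncomputable section

open MeasureTheory Real Filter Set

/-- Points of `d`-dimensional space. -/
abbrev Vec (d : ℕ) := Fin d → ℝ

/-- Values of three-dimensional vector fields. -/
abbrev V3 := Fin 3 → ℝ

/-- Fundamental domain `(0,1)^d` of the torus `𝕋^d`. -/
def box (d : ℕ) : Set (Vec d) := Set.univ.pi fun _ => Set.Ioo (0:ℝ) 1

/-- `ℤ^d`-periodicity: a function on `ℝ^d` represents a function on the torus `𝕋^d`. -/
def Per {d : ℕ} {E : Type*} (f : Vec d → E) : Prop :=
  ∀ (x : Vec d) (k : Fin d → ℤ), f (x + fun i => (k i : ℝ)) = f x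

/-- Euclidean magnitude of a vector. -/
def vmag {n : ℕ} (v : Fin n → ℝ) : ℝ := Real.sqrt (∑ i, v i ^ 2)

/-- Partial derivative `∂_j f`. -/
def pdir {d : ℕ} (j : Fin d) (f : Vec d → ℝ) (x : Vec d) : ℝ :=
  fderiv ℝ f x (Pi.single j 1)

/-- Partial derivative indexed by `Fin 3`; it vanishes in the directions beyond `d`
(planar flows when `d = 2`). -/
def pd3 {d : ℕ} (j : Fin 3) (f : Vec d → ℝ) (x : Vec d) : ℝ :=
  if h : (j : ℕ) < d then pdir ⟨j, h⟩ f x else 0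

/-- Laplacian of a scalar function. -/
def lap {d : ℕ} (f : Vec d → ℝ) (x : Vec d) : ℝ := ∑ j, pdir j (pdir j f) x

/-- Divergence of a `V3`-valued field. -/
def div3 {d : ℕ} (f : Vec d → V3) (x : Vec d) : ℝ := ∑ j : Fin 3, pd3 j (fun y => f y j) x

/-- Divergence of a `Vec d`-valued field. -/
def divV {d : ℕ} (f : Vec d → Vec d) (x : Vec d) : ℝ := ∑ j, pdir j (fun y => f y j) x

/-- Curl of a `V3`-valued field. -/
def curl3 {d : ℕ} (f : Vec d → V3) (x : Vec d) : V3 :=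
  ![pd3 1 (fun y => f y 2) x - pd3 2 (fun y => f y 1) x,
    pd3 2 (fun y => f y 0) x - pd3 0 (fun y => f y 2) x,
    pd3 0 (fun y => f y 1) x - pd3 1 (fun y => f y 0) x]

/-- Pointwise magnitude of the gradient of a scalar function. -/
def magGradS {d : ℕ} (f : Vec d → ℝ) (x : Vec d) : ℝ := Real.sqrt (∑ j, pdir j f x ^ 2)

/-- Pointwise (Frobenius) magnitude of the gradient of a vector field. -/
def magGradV {d n : ℕ} (f : Vec d → Fin n → ℝ) (x : Vec d) : ℝ :=
  Real.sqrt (∑ i : Fin n, ∑ j : Fin d, (pdir j (fun y => f y i) x) ^ 2)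

/-- Pointwise magnitude of the second gradient of a vector field. -/
def magGrad2V {d n : ℕ} (f : Vec d → Fin n → ℝ) (x : Vec d) : ℝ :=
  Real.sqrt (∑ i : Fin n, ∑ j : Fin d, ∑ k : Fin d, (pdir k (pdir j (fun y => f y i)) x) ^ 2)

/-- Transport term `(u · ∇) f` for a scalar `f` (only the first `d` components of `u` act). -/
def adv3 {d : ℕ} (u : Vec d → V3) (f : Vec d → ℝ) (x : Vec d) : ℝ :=
  ∑ j : Fin 3, u x j * pd3 j f x

/-- `L^p` norm (over one fundamental domain) of a scalar function, `1 ≤ p < ∞`. -/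
def iLp {d : ℕ} (p : ℝ) (g : Vec d → ℝ) : ℝ := (∫ x in box d, |g x| ^ p) ^ (1 / p)

/-- Square of the `L²` norm of a scalar function. -/
def iL2sq {d : ℕ} (g : Vec d → ℝ) : ℝ := ∫ x in box d, g x ^ 2

/-- `L²` norm of a scalar function. -/
def iL2 {d : ℕ} (g : Vec d → ℝ) : ℝ := Real.sqrt (iL2sq g)

/-- Sup norm of a scalar function. -/
def iLinf {d : ℕ} (g : Vec d → ℝ) : ℝ := ⨆ x, |g x|

/-- Time derivative of a time-dependent field. -/
def tderiv {d : ℕ} {E : Type*} [NormedAddCommGroup E] [NormedSpace ℝ E]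
    (f : ℝ → Vec d → E) (t : ℝ) (x : Vec d) : E := deriv (fun s => f s x) t

/-- Smooth periodic solutions of the nonhomogeneous incompressible asymmetric
(micropolar) fluid system on the time set `S`, with viscosities `μ, γ, κ, χ` and
`ν = μ + χ`.  The velocity `u` and the microrotation `ω` are `ℝ³`-valued; for `d = 2`
this is the planar form of the system (no dependence on the third variable). -/
structure Sol (d : ℕ) (S : Set ℝ) (μ γ κ χ : ℝ) (ρ : ℝ → Vec d → ℝ)
    (u ω : ℝ → Vec d → V3) (P : ℝ → Vec d → ℝ) : Prop where
  hμ : 0 < μ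
  hγ : 0 < γ
  hκ : 0 < κ
  hχ : 0 < χ
  smooth_ρ : ContDiff ℝ (⊤ : ℕ∞) fun q : ℝ × Vec d => ρ q.1 q.2
  smooth_u : ContDiff ℝ (⊤ : ℕ∞) fun q : ℝ × Vec d => u q.1 q.2
  smooth_w : ContDiff ℝ (⊤ : ℕ∞) fun q : ℝ × Vec d => ω q.1 q.2
  smooth_P : ContDiff ℝ (⊤ : ℕ∞) fun q : ℝ × Vec d => P q.1 q.2
  per_ρ : ∀ t, Per (ρ t)
  per_u : ∀ t, Per (u t)
  per_w : ∀ t, Per (ω t)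
  per_P : ∀ t, Per (P t)
  mom : ∀ t ∈ S, ∀ x, ∀ i : Fin 3,
    ρ t x * (tderiv u t x i + adv3 (u t) (fun y => u t y i) x)
      - (μ + χ) * lap (fun y => u t y i) x + pd3 i (P t) x = 2 * χ * curl3 (ω t) x i
  incomp : ∀ t ∈ S, ∀ x, div3 (u t) x = 0
  angmom : ∀ t ∈ S, ∀ x, ∀ i : Fin 3,
    ρ t x * (tderiv ω t x i + adv3 (u t) (fun y => ω t y i) x)
      - γ * lap (fun y => ω t y i) x - κ * pd3 i (div3 (ω t)) x + 4 * χ * ω t x i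
      = 2 * χ * curl3 (u t) x i
  mass : ∀ t ∈ S, ∀ x, tderiv ρ t x + adv3 (u t) (ρ t) x = 0

/-- The quantity `C₀ = ‖√ρ₀ u₀‖₂² + ‖√ρ₀ ω₀‖₂²`. -/
def C0q {d : ℕ} (ρ₀ : Vec d → ℝ) (u₀ ω₀ : Vec d → V3) : ℝ :=
  (∫ x in box d, ρ₀ x * vmag (u₀ x) ^ 2) + ∫ x in box d, ρ₀ x * vmag (ω₀ x) ^ 2

/-- The quantity `K₀ = μ‖∇u₀‖₂² + γ‖∇ω₀‖₂² + κ‖div ω₀‖₂² + χ‖curl u₀ − 2ω₀‖₂²`. -/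
def K0q {d : ℕ} (μ γ κ χ : ℝ) (u₀ ω₀ : Vec d → V3) : ℝ :=
  μ * iL2sq (magGradV u₀) + γ * iL2sq (magGradV ω₀) + κ * iL2sq (div3 ω₀)
    + χ * ∫ x in box d, vmag (curl3 u₀ x - 2 • ω₀ x) ^ 2

/-- The quantity `J₀ = ν‖∇u₀‖₂² + γ‖∇ω₀‖₂² + κ‖div ω₀‖₂² + 4χ‖ω₀‖₂²`. -/
def J0q {d : ℕ} (ν γ κ χ : ℝ) (u₀ ω₀ : Vec d → V3) : ℝ :=
  ν * iL2sq (magGradV u₀) + γ * iL2sq (magGradV ω₀) + κ * iL2sq (div3 ω₀)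
    + 4 * χ * ∫ x in box d, vmag (ω₀ x) ^ 2

/-- Total mass `M = ∫ ρ₀`. -/
def Mq {d : ℕ} (ρ₀ : Vec d → ℝ) : ℝ := ∫ x in box d, ρ₀ x

/-- Time-Lebesgue norm `‖g‖_{L^p(0,T)}`, `p ∈ [1,∞]`. -/
def tLpE (T : ℝ) (p : ENNReal) (g : ℝ → ℝ) : ℝ :=
  if p = ⊤ then ⨆ t : Set.Ioo (0:ℝ) T, |g t.1|
  else (∫ t in Set.Ioo (0:ℝ) T, |g t| ^ p.toReal) ^ (1 / p.toReal)

/-- `p* = 2p/(p−2)` (`= ∞` for `p = 2`, `= 2` for `p = ∞`). -/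
def pstar (p : ENNReal) : ENNReal := if p = ⊤ then 2 else 2 * p / (p - 2)

namespace AsymFluid

section

/-- Smooth periodic functions of two real variables. -/
structure SmP {E : Type*} [NormedAddCommGroup E] [NormedSpace ℝ E] (f : Vec 2 → E) : Prop where
  smooth : ContDiff ℝ (⊤ : ℕ∞) f
  per : Per f

lemma box_eq : box 2 =ᵐ[volume] {x : Vec 2 | ∀ i, x i ∈ Ioc (0:ℝ) (0 + 1)} := by
  have h : {x : Vec 2 | ∀ i, x i ∈ Ioc (0:ℝ) (0 + 1)}
      = Set.univ.pi fun _ : Fin 2 => Ioc (0:ℝ) 1 := by ext; simp [Set.mem_pi]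
  rw [h]
  exact Measure.ae_eq_set_pi fun _ _ => Ioo_ae_eq_Ioc

lemma box_subset : box 2 ⊆ Icc (0 : Vec 2) 1 := fun _ hx =>
  ⟨fun i => (hx i (Set.mem_univ i)).1.le, fun i => (hx i (Set.mem_univ i)).2.le⟩

lemma measurableSet_box : MeasurableSet (box 2) :=
  MeasurableSet.univ_pi fun _ => measurableSet_Ioo

lemma volume_box : volume (box 2) = 1 := by
  simp [box, volume_pi_pi]

instance instProbBox : IsProbabilityMeasure (volume.restrict (box 2)) :=
  ⟨by simp [volume_box]⟩

set_option linter.unusedSectionVars false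

variable {E : Type*} [NormedAddCommGroup E] [NormedSpace ℝ E]

lemma integrable_box {f : Vec 2 → E} (hf : Continuous f) :
    IntegrableOn f (box 2) :=
  (hf.continuousOn.integrableOn_compact isCompact_Icc).mono_set box_subset

/-- The projection of the plane to the torus is an open quotient map. -/
lemma isOpenQuotientMap_torus :
    IsOpenQuotientMap (fun (x : Vec 2) (i : Fin 2) => (x i : UnitAddCircle)) :=
  IsOpenQuotientMap.piMap (f := fun (_ : Fin 2) (x : ℝ) => (x : UnitAddCircle))
    fun _ => QuotientAddGroup.isOpenQuotientMap_mk

/-- A periodic function descends to the torus. -/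
def desc (f : Vec 2 → E) (q : UnitAddTorus (Fin 2)) : E :=
  f fun i => Function.surjInv QuotientAddGroup.mk_surjective (q i)

lemma desc_mk {f : Vec 2 → E} (hf : Per f) (x : Vec 2) :
    desc f (fun i => (x i : UnitAddCircle)) = f x := by
  have h : ∀ i, ∃ k : ℤ, Function.surjInv QuotientAddGroup.mk_surjective
      ((x i : UnitAddCircle)) = x i + k := by
    intro i
    have := Function.surjInv_eq QuotientAddGroup.mk_surjective ((x i : UnitAddCircle))
    obtain ⟨k, hk⟩ := (AddCircle.coe_eq_zero_iff 1 (x := Function.surjInv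
      QuotientAddGroup.mk_surjective ((x i : UnitAddCircle)) - x i)).1
      (by rw [AddCircle.coe_sub]; exact sub_eq_zero.2 this)
    exact ⟨k, by simp at hk; linarith⟩
  choose k hk using h
  unfold desc
  simp_rw [hk]
  exact hf x k

lemma desc_continuous {f : Vec 2 → E} (hf : Per f) (hc : Continuous f) : Continuous (desc f) := by
  rw [← isOpenQuotientMap_torus.continuous_comp_iff]
  exact hc.congr fun x => (desc_mk hf x).symm

lemma integral_box_add {f : Vec 2 → ℂ} (hf : Per f) (y : Vec 2) :
    ∫ x in box 2, f (x + y) = ∫ x in box 2, f x := by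
  have h1 := UnitAddTorus.mFourierCoeff_eq_integral (desc f) 0 0
  rw [UnitAddTorus.mFourierCoeff_eq_integral (desc f) 0 y] at h1
  simp only [neg_zero, UnitAddTorus.mFourier_zero, ContinuousMap.one_apply, one_smul, desc_mk hf,
    Pi.zero_apply] at h1
  rw [setIntegral_congr_set box_eq, setIntegral_congr_set box_eq, ← h1]
  have h2 := (measurePreserving_add_right volume y).setIntegral_preimage_emb
    (measurableEmbedding_addRight y) f {x : Vec 2 | ∀ i, x i ∈ Ioc (y i) (y i + 1)}
  rw [← h2]
  congr 2
  ext x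
  simp only [mem_ofPred_eq, mem_preimage, mem_Ioc, Pi.add_apply]
  refine forall_congr' fun i => ?_
  constructor <;> rintro ⟨_, _⟩ <;> constructor <;> linarith

/-- Differentiation under the integral sign. -/
lemma hasDerivAt_integral_box {G : ℝ × Vec 2 → E} (hG : ContDiff ℝ 1 G) (t : ℝ) :
    HasDerivAt (fun s => ∫ x in box 2, G (s, x))
      (∫ x in box 2, fderiv ℝ G (t, x) (1, 0)) t := by
  have hc : Continuous fun q : ℝ × Vec 2 => fderiv ℝ G q (1, 0) :=
    (hG.continuous_fderiv one_ne_zero).clm_apply continuous_const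
  obtain ⟨C, hC⟩ := ((isCompact_Icc (a := t - 1) (b := t + 1)).prod
    (isCompact_Icc (a := (0 : Vec 2)) (b := 1))).exists_bound_of_continuousOn hc.continuousOn
  have := hasDerivAt_integral_of_dominated_loc_of_deriv_le (μ := volume.restrict (box 2))
    (F := fun s x => G (s, x)) (F' := fun s x => fderiv ℝ G (s, x) (1, 0)) (x₀ := t)
    (s := Ioo (t - 1) (t + 1)) (bound := fun _ => C)
    (Ioo_mem_nhds (by linarith) (by linarith))
    (Eventually.of_forall fun s => (integrable_box (hG.continuous.comp
      (continuous_const.prodMk continuous_id))).aestronglyMeasurable)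
    (integrable_box (hG.continuous.comp (continuous_const.prodMk continuous_id)))
    (integrable_box (hc.comp (continuous_const.prodMk continuous_id))).aestronglyMeasurable
    ?_ (integrable_const C) ?_
  · exact this.2
  · refine (ae_restrict_iff' measurableSet_box).2 (Eventually.of_forall fun x hx s hs => ?_)
    exact hC _ ⟨Ioo_subset_Icc_self hs, box_subset hx⟩
  · refine Eventually.of_forall fun x s _ => ?_
    have h1 : HasDerivAt (fun s : ℝ => (s, x)) ((1 : ℝ), (0 : Vec 2)) s :=
      (hasDerivAt_id s).prodMk (hasDerivAt_const s x)
    exact ((hG.differentiable one_ne_zero (s, x)).hasFDerivAt).comp_hasDerivAt s h1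

lemma integral_fderiv_box {f : Vec 2 → ℂ} (hf : SmP f) (v : Vec 2) :
    ∫ x in box 2, fderiv ℝ f x v = 0 := by
  have hs : ContDiff ℝ 1 f := hf.smooth.of_le (by exact_mod_cast le_top)
  have hG : ContDiff ℝ 1 fun q : ℝ × Vec 2 => f (q.2 + q.1 • v) :=
    hs.comp (contDiff_snd.add (contDiff_fst.smul contDiff_const))
  have h1 := hasDerivAt_integral_box hG 0
  have h2 : (fun s : ℝ => ∫ x in box 2, f (x + s • v)) = fun _ => ∫ x in box 2, f x :=
    funext fun s => integral_box_add hf.per _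
  simp only [h2] at h1
  rw [(hasDerivAt_const (0:ℝ) _).unique h1]
  congr 1
  ext x
  have e : HasFDerivAt (fun q : ℝ × Vec 2 => q.2 + q.1 • v)
      (ContinuousLinearMap.snd ℝ ℝ (Vec 2) +
        (ContinuousLinearMap.fst ℝ ℝ (Vec 2)).smulRight v) (0, x) :=
    hasFDerivAt_snd.add (hasFDerivAt_fst.smul_const v)
  have e2 : HasFDerivAt f (fderiv ℝ f x) (x + (0:ℝ) • v) := by
    simpa using (hs.differentiable one_ne_zero x).hasFDerivAt
  have e3 := e2.comp ((0:ℝ), x) e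
  have e4 := e3.fderiv
  simp only [Function.comp_def] at e4
  rw [e4]
  simp

lemma integral_box_add_real {f : Vec 2 → ℝ} (hf : Per f) (y : Vec 2) :
    ∫ x in box 2, f (x + y) = ∫ x in box 2, f x := by
  have h := integral_box_add (f := fun x => (f x : ℂ)) (fun x k => by simp [hf x k]) y
  rw [integral_complex_ofReal, integral_complex_ofReal] at h
  exact_mod_cast h

namespace SmP

variable {f g : Vec 2 → ℝ}

lemma cont {f : Vec 2 → E} (hf : SmP f) : Continuous f := hf.smooth.continuous

lemma diff {f : Vec 2 → E} (hf : SmP f) : Differentiable ℝ f :=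
  hf.smooth.differentiable (by simp)

lemma mul (hf : SmP f) (hg : SmP g) : SmP fun x => f x * g x :=
  ⟨hf.smooth.mul hg.smooth, fun x k => by simp only [hf.per x k, hg.per x k]⟩

lemma pow (hf : SmP f) (n : ℕ) : SmP fun x => f x ^ n :=
  ⟨hf.smooth.pow n, fun x k => by simp only [hf.per x k]⟩

lemma fderiv_apply {f : Vec 2 → E} (hf : SmP f) (v : Vec 2) : SmP fun x => fderiv ℝ f x v := by
  refine ⟨(hf.smooth.fderiv_right (m := (⊤ : ℕ∞)) (by simp)).clm_apply contDiff_const,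
    fun x k => ?_⟩
  have h : (fun y => f (y + fun i => (k i : ℝ))) = f := funext fun y => hf.per y k
  have h2 := fderiv_comp_add_right (𝕜 := ℝ) (f := f) (x := x) (fun i => (k i : ℝ))
  rw [h] at h2
  simp only [h2]

lemma pdir (hf : SmP f) (j : Fin 2) : SmP (pdir j f) := hf.fderiv_apply _

lemma ofReal (hf : SmP f) : SmP fun x => (f x : ℂ) :=
  ⟨Complex.ofRealCLM.contDiff.comp hf.smooth, fun x k => by simp only [hf.per x k]⟩

lemma integrable (hf : SmP f) : IntegrableOn f (box 2) := integrable_box hf.cont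

lemma integral_pdir (hf : SmP f) (j : Fin 2) : ∫ x in box 2, _root_.pdir j f x = 0 := by
  have h := integral_fderiv_box hf.ofReal (Pi.single j 1)
  have h2 : ∀ x, fderiv ℝ (fun x => (f x : ℂ)) x (Pi.single j 1) = (_root_.pdir j f x : ℂ) := by
    intro x
    have := (Complex.ofRealCLM.hasFDerivAt (x := f x)).comp x (hf.diff x).hasFDerivAt
    have h3 := this.fderiv
    simp only [Function.comp_def, Complex.ofRealCLM_apply] at h3
    rw [h3]
    rfl
  simp_rw [h2] at h
  rw [integral_complex_ofReal] at h
  exact_mod_cast h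

end SmP

/-- Cauchy–Schwarz on the unit box. -/
lemma cauchy_schwarz_box {f g : Vec 2 → ℝ} (hf : Continuous f) (hg : Continuous g) :
    (∫ x in box 2, |f x * g x|) ^ 2 ≤ (∫ x in box 2, f x ^ 2) * ∫ x in box 2, g x ^ 2 := by
  have key : ∀ t : ℝ, 0 ≤ (∫ x in box 2, f x ^ 2) * (t * t)
      + (-2 * ∫ x in box 2, |f x * g x|) * t + ∫ x in box 2, g x ^ 2 := by
    intro t
    have i1 : IntegrableOn (fun x => f x ^ 2) (box 2) := integrable_box (hf.pow 2)
    have i2 : IntegrableOn (fun x => |f x * g x|) (box 2) := integrable_box (hf.mul hg).abs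
    have i3 : IntegrableOn (fun x => g x ^ 2) (box 2) := integrable_box (hg.pow 2)
    have : 0 ≤ ∫ x in box 2, (t * |f x| - |g x|) ^ 2 :=
      integral_nonneg fun x => sq_nonneg _
    have h2 : ∀ x, (t * |f x| - |g x|) ^ 2
        = (t * t) * f x ^ 2 + (-2 * t) * |f x * g x| + g x ^ 2 := by
      intro x
      rw [abs_mul, ← sq_abs (f x), ← sq_abs (g x)]; ring
    simp_rw [h2] at this
    have e : ∫ x in box 2, ((t * t) * f x ^ 2 + (-2 * t) * |f x * g x| + g x ^ 2)
        = (t * t) * (∫ x in box 2, f x ^ 2) + (-2 * t) * (∫ x in box 2, |f x * g x|)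
          + ∫ x in box 2, g x ^ 2 := by
      rw [integral_add _ i3, integral_add (i1.const_mul _) (i2.const_mul _), integral_const_mul,
        integral_const_mul]
      exact (i1.const_mul _).add (i2.const_mul _)
    rw [e] at this
    linarith
  have := discrim_le_zero key
  rw [discrim] at this
  nlinarith

/-- The integral over the box as an iterated integral. -/
lemma integral_box_prod (f : Vec 2 → ℝ) :
    ∫ x in box 2, f x = ∫ p : ℝ × ℝ, f ![p.1, p.2]
      ∂((volume.restrict (Ioo (0:ℝ) 1)).prod (volume.restrict (Ioo (0:ℝ) 1))) := by
  have h := (volume_preserving_finTwoArrow ℝ).symm.setIntegral_preimage_emb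
    (MeasurableEquiv.measurableEmbedding _) f (box 2)
  rw [← h, Measure.prod_restrict]
  have e : (MeasurableEquiv.finTwoArrow (α := ℝ)).symm ⁻¹' box 2 = Ioo (0:ℝ) 1 ×ˢ Ioo (0:ℝ) 1 := by
    ext p
    simp [box, Set.mem_pi, Fin.forall_fin_two, MeasurableEquiv.finTwoArrow]
  rw [e]
  rfl

end

lemma abs_le_integral_add_deriv {φ : ℝ → ℝ} (hφ : ContDiff ℝ 1 φ) {x : ℝ} (hx : x ∈ Ioo (0:ℝ) 1) :
    |φ x| ≤ ∫ y in Ioo (0:ℝ) 1, (|φ y| + |deriv φ y|) := by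
  have hc : Continuous (deriv φ) := hφ.continuous_deriv le_rfl
  have i1 : IntegrableOn (fun y => |φ y|) (Ioo (0:ℝ) 1) :=
    (hφ.continuous.abs.integrableOn_Icc).mono_set Ioo_subset_Icc_self
  have i2 : IntegrableOn (fun y => |deriv φ y|) (Ioo (0:ℝ) 1) :=
    (hc.abs.integrableOn_Icc).mono_set Ioo_subset_Icc_self
  have key : ∀ y ∈ Ioo (0:ℝ) 1, |φ x| ≤ |φ y| + ∫ z in Ioo (0:ℝ) 1, |deriv φ z| := by
    intro y hy
    have h1 : ∫ z in y..x, deriv φ z = φ x - φ y :=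
      intervalIntegral.integral_deriv_eq_sub (fun z _ => hφ.differentiable one_ne_zero z)
        (hc.intervalIntegrable _ _)
    have h2 : |∫ z in y..x, deriv φ z| ≤ ∫ z in Ioo (0:ℝ) 1, |deriv φ z| := by
      refine (intervalIntegral.norm_integral_le_integral_norm_uIoc (f := deriv φ)).trans ?_
      refine setIntegral_mono_set i2 (Eventually.of_forall fun _ => abs_nonneg _) ?_
      refine LE.le.eventuallyLE fun z hz => ?_
      rcases uIoc_eq_union (a := y) (b := x) ▸ hz with h | h
      · exact ⟨hy.1.trans h.1, h.2.trans_lt hx.2⟩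
      · exact ⟨hx.1.trans h.1, h.2.trans_lt hy.2⟩
    have h3 : φ x = φ y + ∫ z in y..x, deriv φ z := by rw [h1]; ring
    rw [h3]
    exact (abs_add_le _ _).trans (by linarith)
  have h := setIntegral_mono_on (integrableOn_const (C := |φ x|) (by simp))
    (i1.add (integrableOn_const (C := ∫ z in Ioo (0:ℝ) 1, |deriv φ z|) (by simp)))
    measurableSet_Ioo key
  simp only [Pi.add_apply] at h
  rw [integral_add i1 (integrableOn_const (by simp))] at h
  rw [integral_add i1 i2]
  simpa using h

lemma hasDerivAt_slice {g : Vec 2 → ℝ} (hg : Differentiable ℝ g) (a b : ℝ) :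
    HasDerivAt (fun s => g ![s, b]) (pdir 0 g ![a, b]) a ∧
    HasDerivAt (fun s => g ![a, s]) (pdir 1 g ![a, b]) b := by
  constructor
  · have h1 : HasDerivAt (fun s : ℝ => (![s, b] : Vec 2)) (Pi.single 0 1) a := by
      rw [hasDerivAt_pi]
      intro i
      fin_cases i
      · simpa using hasDerivAt_id' a
      · simpa using hasDerivAt_const a b
    exact (hg ![a, b]).hasFDerivAt.comp_hasDerivAt a h1
  · have h1 : HasDerivAt (fun s : ℝ => (![a, s] : Vec 2)) (Pi.single 1 1) b := by
      rw [hasDerivAt_pi]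
      intro i
      fin_cases i
      · simpa using hasDerivAt_const b a
      · simpa using hasDerivAt_id' b
    exact (hg ![a, b]).hasFDerivAt.comp_hasDerivAt b h1

/-- The `L¹`-gradient form of the planar Sobolev inequality. -/
lemma integral_sq_le_of_grad {g : Vec 2 → ℝ} (hg : SmP g) :
    ∫ x in box 2, g x ^ 2 ≤ ((∫ x in box 2, |g x|) + ∫ x in box 2, |pdir 0 g x|)
      * ((∫ x in box 2, |g x|) + ∫ x in box 2, |pdir 1 g x|) := by
  set J := volume.restrict (Ioo (0:ℝ) 1) with hJ
  have hJp : IsProbabilityMeasure J := ⟨by simp [hJ]⟩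
  have hpair : Continuous fun p : ℝ × ℝ => (![p.1, p.2] : Vec 2) := by fun_prop
  have int : ∀ {F : Vec 2 → ℝ}, Continuous F →
      Integrable (fun p : ℝ × ℝ => F ![p.1, p.2]) (J.prod J) := by
    intro F hF
    rw [hJ, Measure.prod_restrict]
    exact ((hF.comp hpair).continuousOn.integrableOn_compact
      ((isCompact_Icc (a := (0:ℝ)) (b := 1)).prod (isCompact_Icc (a := (0:ℝ)) (b := 1)))).mono_set
      (Set.prod_mono Ioo_subset_Icc_self Ioo_subset_Icc_self)
  have cg := hg.cont
  have c0 := (hg.pdir 0).cont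
  have c1 := (hg.pdir 1).cont
  have hA : Continuous fun x => |g x| + |pdir 0 g x| := by fun_prop
  have hB : Continuous fun x => |g x| + |pdir 1 g x| := by fun_prop
  have iA := int hA
  have iB := int hB
  have eA : (∫ x in box 2, |g x|) + ∫ x in box 2, |pdir 0 g x|
      = ∫ b, (∫ a, (|g ![a, b]| + |pdir 0 g ![a, b]|) ∂J) ∂J := by
    rw [← integral_add (integrable_box cg.abs) (integrable_box c0.abs), integral_box_prod]
    exact integral_prod_symm _ iA
  have eB : (∫ x in box 2, |g x|) + ∫ x in box 2, |pdir 1 g x|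
      = ∫ a, (∫ b, (|g ![a, b]| + |pdir 1 g ![a, b]|) ∂J) ∂J := by
    rw [← integral_add (integrable_box cg.abs) (integrable_box c1.abs), integral_box_prod]
    exact integral_prod _ iB
  rw [eA, eB, integral_box_prod, mul_comm, ← integral_prod_mul]
  have hcd : ContDiff ℝ 1 g := hg.smooth.of_le (by exact_mod_cast le_top)
  have d0 : ∀ a b, deriv (fun s => g ![s, b]) a = pdir 0 g ![a, b] :=
    fun a b => (hasDerivAt_slice hg.diff a b).1.deriv
  have d1 : ∀ a b, deriv (fun s => g ![a, s]) b = pdir 1 g ![a, b] :=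
    fun a b => (hasDerivAt_slice hg.diff a b).2.deriv
  have s0 : ∀ b, ContDiff ℝ 1 fun s => g ![s, b] := fun b => hcd.comp (by
    rw [contDiff_pi]; intro i; fin_cases i
    · exact contDiff_id
    · exact contDiff_const)
  have s1 : ∀ a, ContDiff ℝ 1 fun s => g ![a, s] := fun a => hcd.comp (by
    rw [contDiff_pi]; intro i; fin_cases i
    · exact contDiff_const
    · exact contDiff_id)
  refine integral_mono_ae (int (cg.pow 2)) (Integrable.mul_prod iB.integral_prod_left
    iA.integral_prod_right) ?_
  rw [hJ, Measure.prod_restrict]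
  refine (ae_restrict_iff' (measurableSet_Ioo.prod measurableSet_Ioo)).2
    (Eventually.of_forall fun p hp => ?_)
  have h0 := abs_le_integral_add_deriv (s0 p.2) hp.1
  have h1 := abs_le_integral_add_deriv (s1 p.1) hp.2
  simp only [d0, d1] at h0 h1
  have := mul_le_mul h1 h0 (abs_nonneg _) ((abs_nonneg _).trans h1)
  simpa [← sq] using this

/-- `∫ |∇f|²`. -/
def gradSq (f : Vec 2 → ℝ) : ℝ := (∫ x in box 2, pdir 0 f x ^ 2) + ∫ x in box 2, pdir 1 f x ^ 2

lemma gradSq_nonneg (f : Vec 2 → ℝ) : 0 ≤ gradSq f :=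
  add_nonneg (integral_nonneg fun _ => sq_nonneg _) (integral_nonneg fun _ => sq_nonneg _)

lemma integral_even_pow_nonneg (f : Vec 2 → ℝ) (m : ℕ) : 0 ≤ ∫ x in box 2, f x ^ (2 * m) :=
  integral_nonneg fun _ => by rw [pow_mul]; positivity

lemma pdir_pow {f : Vec 2 → ℝ} (hf : Differentiable ℝ f) (m : ℕ) (j : Fin 2) (x : Vec 2) :
    pdir j (fun x => f x ^ (m + 1)) x = (m + 1) * (f x ^ m * pdir j f x) := by
  have h : HasFDerivAt (fun x => f x ^ (m + 1)) _ x := (hf x).hasFDerivAt.pow (m + 1)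
  unfold pdir
  rw [h.fderiv]
  simp
  ring

lemma integral_pow_succ_le {f : Vec 2 → ℝ} (hf : SmP f) (m : ℕ) :
    ∫ x in box 2, f x ^ (2 * (m + 1)) ≤ (∫ x in box 2, f x ^ (2 * m))
      * (2 * (∫ x in box 2, f x ^ 2) + (m + 1) ^ 2 * gradSq f) := by
  have h := integral_sq_le_of_grad (hf.pow (m + 1))
  simp only [pdir_pow hf.diff, abs_mul, ← pow_mul] at h
  rw [mul_comm (m + 1) 2] at h
  refine h.trans ?_
  set N := ∫ x in box 2, f x ^ (2 * m)
  have hN : 0 ≤ N := integral_even_pow_nonneg f m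
  have cs : ∀ g : Vec 2 → ℝ, Continuous g →
      (∫ x in box 2, |f x ^ m * g x|) ≤ √(N * ∫ x in box 2, g x ^ 2) := by
    intro g hg
    refine Real.le_sqrt_of_sq_le ((cauchy_schwarz_box (hf.cont.pow m) hg).trans (le_of_eq ?_))
    simp only [Pi.pow_apply, ← pow_mul, mul_comm m 2, N]
  have e0 := cs f hf.cont
  have e1 := cs _ (hf.pdir 0).cont
  have e2 := cs _ (hf.pdir 1).cont
  simp only [← pow_succ, abs_mul] at e0 e1 e2
  have hm : |(m + 1 : ℝ)| = m + 1 := abs_of_nonneg (by positivity)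
  simp only [hm, integral_const_mul]
  set S := ∫ x in box 2, f x ^ 2
  have hS : 0 ≤ S := integral_nonneg fun _ => sq_nonneg _
  unfold gradSq
  set D0 := ∫ x in box 2, pdir 0 f x ^ 2
  set D1 := ∫ x in box 2, pdir 1 f x ^ 2
  have hD0 : 0 ≤ D0 := integral_nonneg fun _ => sq_nonneg _
  have hD1 : 0 ≤ D1 := integral_nonneg fun _ => sq_nonneg _
  have q0 := Real.sq_sqrt (mul_nonneg hN hS)
  have q1 := Real.sq_sqrt (mul_nonneg hN hD0)
  have q2 := Real.sq_sqrt (mul_nonneg hN hD1)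
  have hm0 : (0:ℝ) ≤ m + 1 := by positivity
  have p1 := mul_le_mul_of_nonneg_left e1 hm0
  have p2 := mul_le_mul_of_nonneg_left e2 hm0
  refine (mul_le_mul (add_le_add e0 p1) (add_le_add e0 p2) (by positivity) (by positivity)).trans ?_
  set a := √(N * S)
  set b := √(N * D0)
  set c := √(N * D1)
  nlinarith [sq_nonneg (a - (m + 1) * b), sq_nonneg (a - (m + 1) * c),
    sq_nonneg ((m + 1) * b - (m + 1) * c)]

lemma ladyzhenskaya {f : Vec 2 → ℝ} (hf : SmP f) :
    ∫ x in box 2, f x ^ 4 ≤ (∫ x in box 2, f x ^ 2)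
      * (2 * (∫ x in box 2, f x ^ 2) + 4 * gradSq f) := by
  have := integral_pow_succ_le hf 1
  norm_num at this
  exact this

/-- The planar embedding of `H¹` in every `L^{2m}`. -/
lemma sobolev_pow (m : ℕ) : ∃ C : ℝ, 0 ≤ C ∧ ∀ f : Vec 2 → ℝ, SmP f →
    ∫ x in box 2, f x ^ (2 * m) ≤ C * ((∫ x in box 2, f x ^ 2) + gradSq f) ^ m := by
  induction m with
  | zero => exact ⟨1, by norm_num, fun f _ => by simp⟩
  | succ m ih =>
    obtain ⟨C, hC, h⟩ := ih
    refine ⟨C * (2 + (m + 1) ^ 2), by positivity, fun f hf => ?_⟩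
    refine (integral_pow_succ_le hf m).trans ?_
    have hS : 0 ≤ ∫ x in box 2, f x ^ 2 := integral_nonneg fun _ => sq_nonneg _
    have hG := gradSq_nonneg f
    have e : ∀ a b c : ℝ, a * b * c ^ (m + 1) = (a * c ^ m) * (b * c) := by intros; ring
    rw [e]
    refine mul_le_mul (h f hf) ?_ (by positivity) (by positivity)
    nlinarith [mul_nonneg (sq_nonneg (m + 1 : ℝ)) hS]

lemma integral_box_comp_smul_le {φ : Vec 2 → ℝ} (hφ : Continuous φ) (h0 : ∀ x, 0 ≤ φ x) {a : ℝ}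
    (ha : 0 < a) (ha1 : a ≤ 1) :
    ∫ z in box 2, φ (a • z) ≤ (a ^ 2)⁻¹ * ∫ z in box 2, φ z := by
  rw [Measure.setIntegral_comp_smul_of_pos volume φ (box 2) ha]
  simp only [Module.finrank_fin_fun, smul_eq_mul]
  refine mul_le_mul_of_nonneg_left (setIntegral_mono_set (integrable_box hφ)
    (Eventually.of_forall h0) (LE.le.eventuallyLE ?_)) (by positivity)
  rintro _ ⟨z, hz, rfl⟩ i hi
  have := hz i hi
  simp only [Pi.smul_apply, smul_eq_mul, mem_Ioo] at this ⊢
  exact ⟨by nlinarith, by nlinarith⟩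

lemma integral_abs_le_sqrt {f : Vec 2 → ℝ} (hf : Continuous f) :
    ∫ x in box 2, |f x| ≤ √(∫ x in box 2, f x ^ 2) := by
  refine Real.le_sqrt_of_sq_le ?_
  have := cauchy_schwarz_box hf (continuous_const (y := (1:ℝ)))
  simpa using this

/-- Frequencies on the two-dimensional torus. -/
abbrev Freq := Fin 2 → ℤ

/-- The character `x ↦ exp (2πi k·x)`. -/
def expo (k : Freq) (x : Vec 2) : ℂ :=
  Complex.exp (2 * π * Complex.I * (k 0 * x 0 + k 1 * x 1))

lemma expo_zero (x : Vec 2) : expo 0 x = 1 := by simp [expo]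

lemma expo_add (k l : Freq) (x : Vec 2) : expo (k + l) x = expo k x * expo l x := by
  simp only [expo, ← Complex.exp_add, Pi.add_apply]
  congr 1
  push_cast
  ring

lemma expo_neg (k : Freq) (x : Vec 2) : expo (-k) x = (starRingEnd ℂ) (expo k x) := by
  simp only [expo, ← Complex.exp_conj, Pi.neg_apply]
  congr 1
  simp only [Int.cast_neg, map_mul, map_add, Complex.conj_ofReal, Complex.conj_I, map_ofNat,
    map_intCast]
  ring

lemma norm_expo (k : Freq) (x : Vec 2) : ‖expo k x‖ = 1 := by
  have : 2 * π * Complex.I * (k 0 * x 0 + k 1 * x 1)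
      = ((2 * π * (k 0 * x 0 + k 1 * x 1) : ℝ) : ℂ) * Complex.I := by push_cast; ring
  rw [expo, this, Complex.norm_exp_ofReal_mul_I]

lemma mFourier_coe (k : Freq) (x : Vec 2) :
    UnitAddTorus.mFourier k (fun i => (x i : UnitAddCircle)) = expo k x := by
  simp only [UnitAddTorus.mFourier, ContinuousMap.coe_mk, Fin.prod_univ_two, fourier_coe_apply,
    expo, ← Complex.exp_add]
  congr 1
  push_cast
  ring

lemma hasFDerivAt_expo (k : Freq) (x : Vec 2) : ∃ L : Vec 2 →L[ℝ] ℂ,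
    HasFDerivAt (expo k) L x ∧ ∀ j, L (Pi.single j 1) = 2 * π * Complex.I * k j * expo k x := by
  have h : ∀ i, HasFDerivAt (fun x : Vec 2 => ((x i : ℝ) : ℂ))
      (Complex.ofRealCLM.comp (ContinuousLinearMap.proj (R := ℝ) i)) x :=
    fun i => Complex.ofRealCLM.hasFDerivAt.comp x (hasFDerivAt_apply i x)
  have h1 := ((((h 0).const_mul (k 0 : ℂ)).add ((h 1).const_mul (k 1 : ℂ))).const_mul
    (2 * π * Complex.I)).cexp
  refine ⟨_, h1, fun j => ?_⟩
  fin_cases j <;> simp [expo] <;> ring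

lemma fderiv_expo (k : Freq) (x : Vec 2) (j : Fin 2) :
    fderiv ℝ (expo k) x (Pi.single j 1) = 2 * π * Complex.I * k j * expo k x := by
  obtain ⟨L, h, hL⟩ := hasFDerivAt_expo k x
  rw [h.fderiv, hL]

lemma smP_expo (k : Freq) : SmP (expo k) := by
  refine ⟨?_, fun x l => ?_⟩
  · have h : ∀ i, ContDiff ℝ (⊤ : ℕ∞) fun x : Vec 2 => ((x i : ℝ) : ℂ) :=
      fun i => Complex.ofRealCLM.contDiff.comp (contDiff_apply ℝ ℝ i)
    exact (contDiff_const.mul ((contDiff_const.mul (h 0)).add (contDiff_const.mul (h 1)))).cexp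
  · have : (2 * π * Complex.I * (k 0 * (x + fun i => (l i : ℝ)) 0
        + k 1 * (x + fun i => (l i : ℝ)) 1) : ℂ)
        = 2 * π * Complex.I * (k 0 * x 0 + k 1 * x 1)
          + (k 0 * l 0 + k 1 * l 1 : ℤ) * (2 * π * Complex.I) := by
      simp only [Pi.add_apply]; push_cast; ring
    rw [expo, this, Complex.exp_add, Complex.exp_int_mul_two_pi_mul_I, mul_one, expo]

lemma SmP.mulC {f g : Vec 2 → ℂ} (hf : SmP f) (hg : SmP g) : SmP fun x => f x * g x :=
  ⟨hf.smooth.mul hg.smooth, fun x k => by simp only [hf.per x k, hg.per x k]⟩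

/-- Fourier coefficients. -/
def fc (f : Vec 2 → ℂ) (k : Freq) : ℂ := ∫ x in box 2, f x * expo (-k) x

lemma mFourierCoeff_desc {f : Vec 2 → ℂ} (hf : Per f) (k : Freq) :
    UnitAddTorus.mFourierCoeff (desc f) k = fc f k := by
  rw [UnitAddTorus.mFourierCoeff_eq_integral (desc f) k 0, fc, setIntegral_congr_set box_eq]
  simp only [desc_mk hf, mFourier_coe, smul_eq_mul, mul_comm, Pi.zero_apply]

lemma norm_fc_le {f : Vec 2 → ℂ} (k : Freq) :
    ‖fc f k‖ ≤ ∫ x in box 2, ‖f x‖ := by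
  refine (norm_integral_le_integral_norm _).trans (le_of_eq ?_)
  simp only [norm_mul, norm_expo, mul_one]

lemma fc_fderiv {f : Vec 2 → ℂ} (hf : SmP f) (j : Fin 2) (k : Freq) :
    fc (fun x => fderiv ℝ f x (Pi.single j 1)) k = 2 * π * Complex.I * k j * fc f k := by
  have h := integral_fderiv_box (hf.mulC (smP_expo (-k))) (Pi.single j 1)
  have e : ∀ x, fderiv ℝ (fun x => f x * expo (-k) x) x (Pi.single j 1)
      = fderiv ℝ f x (Pi.single j 1) * expo (-k) x
        + (-(2 * π * Complex.I * k j)) * (f x * expo (-k) x) := by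
    intro x
    have h1 : HasFDerivAt (fun x => f x * expo (-k) x) _ x :=
      (hf.diff x).hasFDerivAt.mul ((smP_expo (-k)).diff x).hasFDerivAt
    rw [h1.fderiv]
    simp [fderiv_expo]
    ring
  simp_rw [e] at h
  rw [integral_add (integrable_box ((hf.fderiv_apply _).mulC (smP_expo (-k))).cont)
    ((integrable_box (hf.mulC (smP_expo (-k))).cont).const_mul _), integral_const_mul] at h
  unfold fc
  linear_combination h

lemma fc_add {f g : Vec 2 → ℂ} (hf : SmP f) (hg : SmP g) (k : Freq) :
    fc (fun x => f x + g x) k = fc f k + fc g k := by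
  unfold fc
  simp only [add_mul]
  exact integral_add (integrable_box (hf.mulC (smP_expo (-k))).cont)
    (integrable_box (hg.mulC (smP_expo (-k))).cont)

lemma summable_inv_one_add_sq : Summable fun k : ℤ => (1 + (k : ℝ) ^ 2)⁻¹ := by
  have h1 : Summable fun k : ℤ => 1 / (k : ℝ) ^ 2 := Real.summable_one_div_int_pow.2 one_lt_two
  have h2 : Summable fun k : ℤ => if k = 0 then (1:ℝ) else 0 :=
    summable_of_hasFiniteSupport ((Set.finite_singleton (0:ℤ)).subset fun k hk => by
      by_contra h; exact hk (if_neg h))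
  refine (h1.add h2).of_nonneg_of_le (fun k => by positivity) fun k => ?_
  by_cases hk : k = 0
  · simp [hk]
  · have : (0:ℝ) < (k:ℝ) ^ 2 := by positivity
    simp only [hk, if_false, add_zero, one_div]
    exact inv_anti₀ this (by linarith)

lemma summable_fc {f : Vec 2 → ℂ} (hf : SmP f) : Summable fun k => ‖fc f k‖ := by
  have hD : ∀ g : Vec 2 → ℂ, SmP g → ∀ j : Fin 2, ∃ G : Vec 2 → ℂ, SmP G ∧
      ∀ k, (1 + (k j : ℝ) ^ 2) * ‖fc g k‖ ≤ ‖fc G k‖ := by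
    intro g hg j
    set g2 := fun x => fderiv ℝ (fun y => fderiv ℝ g y (Pi.single j 1)) x (Pi.single j 1) with hg2
    have h2 : SmP g2 := (hg.fderiv_apply _).fderiv_apply _
    have h3 : SmP fun x => (-1 : ℂ) * g2 x :=
      SmP.mulC ⟨contDiff_const, fun _ _ => rfl⟩ h2
    refine ⟨fun x => g x + -1 * g2 x, ⟨hg.smooth.add h3.smooth, fun x k => by
      simp only [hg.per x k, h2.per x k]⟩, fun k => ?_⟩
    have e1 : fc (fun x => -1 * g2 x) k = -fc g2 k := by
      simp [fc, integral_neg]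
    rw [fc_add hg h3, e1, hg2, fc_fderiv (hg.fderiv_apply _), fc_fderiv hg]
    have : fc g k + -(2 * π * Complex.I * k j * (2 * π * Complex.I * k j * fc g k))
        = ((1 + 4 * π ^ 2 * (k j : ℝ) ^ 2 : ℝ) : ℂ) * fc g k := by
      push_cast
      linear_combination (-4 * π ^ 2 * (k j : ℂ) ^ 2 * fc g k) * Complex.I_sq
    rw [this, norm_mul, Complex.norm_real, Real.norm_of_nonneg (by positivity)]
    refine mul_le_mul_of_nonneg_right ?_ (norm_nonneg _)
    nlinarith [pi_gt_three, sq_nonneg (k j : ℝ), mul_nonneg (sq_nonneg (k j : ℝ))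
      (by nlinarith [pi_gt_three] : 0 ≤ 4 * π ^ 2 - 1)]
  obtain ⟨G, hG, h0⟩ := hD f hf 0
  obtain ⟨G', hG', h1⟩ := hD G hG 1
  have hs : Summable fun k : Freq => (∫ x in box 2, ‖G' x‖)
      * ((1 + (k 0 : ℝ) ^ 2)⁻¹ * (1 + (k 1 : ℝ) ^ 2)⁻¹) := by
    refine Summable.mul_left _ ?_
    have := summable_inv_one_add_sq.mul_of_nonneg summable_inv_one_add_sq
      (fun _ => by positivity) (fun _ => by positivity)
    exact ((finTwoArrowEquiv ℤ).summable_iff (f := fun p : ℤ × ℤ => (1 + (p.1 : ℝ) ^ 2)⁻¹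
      * (1 + (p.2 : ℝ) ^ 2)⁻¹)).2 this
  refine hs.of_nonneg_of_le (fun _ => norm_nonneg _) fun k => ?_
  have h3 := (h1 k).trans (norm_fc_le k)
  have p0 : (0:ℝ) < 1 + (k 0 : ℝ) ^ 2 := by positivity
  have p1 : (0:ℝ) < 1 + (k 1 : ℝ) ^ 2 := by positivity
  have h4 := (mul_le_mul_of_nonneg_left (h0 k) p1.le).trans h3
  rw [← mul_inv, ← div_eq_mul_inv, le_div_iff₀ (mul_pos p0 p1)]
  linarith

lemma hasSum_fourier {f : Vec 2 → ℂ} (hf : SmP f) (x : Vec 2) :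
    HasSum (fun k => fc f k * expo k x) (f x) := by
  have := UnitAddTorus.hasSum_mFourier_series_apply_of_summable
    (f := ⟨desc f, desc_continuous hf.per hf.cont⟩)
    (by
      refine Summable.of_norm ?_
      simpa only [ContinuousMap.coe_mk, mFourierCoeff_desc hf.per] using summable_fc hf)
    (fun i => (x i : UnitAddCircle))
  simpa only [ContinuousMap.coe_mk, mFourierCoeff_desc hf.per, desc_mk hf.per, mFourier_coe,
    smul_eq_mul] using this

lemma summable_mul_expo {c : Freq → ℂ} (hc : Summable fun k => ‖c k‖) (x : Vec 2) :
    Summable fun k => c k * expo k x :=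
  Summable.of_norm (by simpa only [norm_mul, norm_expo, mul_one] using hc)

lemma continuous_tsum_expo {c : Freq → ℂ} (hc : Summable fun k => ‖c k‖) :
    Continuous fun x => ∑' k, c k * expo k x :=
  continuous_tsum (fun k => continuous_const.mul (smP_expo k).cont) hc fun k x => by
    simp only [norm_mul, norm_expo, mul_one, le_refl]

/-- Integration of a continuous function against an absolutely convergent Fourier series. -/
lemma hasSum_integral_mul_expo {c : Freq → ℂ} (hc : Summable fun k => ‖c k‖) {g : Vec 2 → ℂ}
    (hg : Continuous g) : HasSum (fun k => c k * ∫ x in box 2, g x * expo k x)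
      (∫ x in box 2, g x * ∑' k, c k * expo k x) := by
  have h := hasSum_integral_of_summable_integral_norm (μ := volume.restrict (box 2))
    (F := fun k x => c k * (g x * expo k x))
    (fun k => (integrable_box (hg.mul (smP_expo k).cont)).const_mul _)
    (by
      simp only [norm_mul, norm_expo, mul_one, integral_const_mul]
      exact hc.mul_right _)
  simp only [integral_const_mul] at h
  have e : ∀ x, g x * ∑' k, c k * expo k x = ∑' k, c k * (g x * expo k x) := fun x => by
    rw [← tsum_mul_left]
    exact tsum_congr fun k => by ring
  simpa only [e] using h

lemma integral_expo {k : Freq} (hk : k ≠ 0) : ∫ x in box 2, expo k x = 0 := by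
  obtain ⟨j, hj⟩ := Function.ne_iff.1 hk
  have h := integral_fderiv_box (smP_expo k) (Pi.single j 1)
  simp only [fderiv_expo, integral_const_mul] at h
  refine (mul_eq_zero.1 h).resolve_left ?_
  simp only [Pi.zero_apply] at hj
  simp [hj, pi_ne_zero]

/-- Absolutely summable Fourier coefficients of a real function. -/
structure Herm (c : Freq → ℂ) : Prop where
  summable : Summable fun k => ‖c k‖
  conj : ∀ k, c (-k) = (starRingEnd ℂ) (c k)

/-- The sign attached to a total order on the frequencies. -/
structure IsSign (σ : Freq → ℝ) : Prop where
  zero : σ 0 = 0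
  val : ∀ k, k ≠ 0 → σ k = 1 ∨ σ k = -1
  odd : ∀ k, σ (-k) = -σ k
  add : ∀ k l, σ k = 1 → σ l = 1 → σ (k + l) = 1

/-- The real function with Fourier coefficients `c`. -/
def synth (c : Freq → ℂ) (x : Vec 2) : ℝ := ∑' k, (c k * expo k x).re

/-- The function with Fourier coefficients `-i m(k) c(k)`. -/
def conjSynth (m : Freq → ℝ) (c : Freq → ℂ) (x : Vec 2) : ℝ := ∑' k, m k * (c k * expo k x).im

lemma tsum_odd {g : Freq → ℝ} (h : ∀ k, g (-k) = -g k) : ∑' k, g k = 0 := by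
  have h1 := (Equiv.neg Freq).tsum_eq g
  simp only [Equiv.neg_apply, h, tsum_neg] at h1
  linarith

lemma IsSign.abs_le {σ : Freq → ℝ} (hσ : IsSign σ) (k : Freq) : |σ k| ≤ 1 := by
  by_cases hk : k = 0
  · simp [hk, hσ.zero]
  · rcases hσ.val k hk with h | h <;> simp [h]

lemma Herm.conj_expo {c : Freq → ℂ} (hc : Herm c) (k : Freq) (x : Vec 2) :
    c (-k) * expo (-k) x = (starRingEnd ℂ) (c k * expo k x) := by
  rw [hc.conj, expo_neg, map_mul]

lemma summable_bdd_mul {c : Freq → ℂ} (hc : Herm c) {m : Freq → ℝ} {B : ℝ}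
    (hm : ∀ k, |m k| ≤ B) {f : Freq → ℝ} (hf : ∀ k, |f k| ≤ ‖c k‖) : Summable fun k => m k * f k := by
  refine Summable.of_norm_bounded (hc.summable.mul_left B) fun k => ?_
  rw [norm_mul]
  exact mul_le_mul (hm k) (hf k) (norm_nonneg _) ((abs_nonneg _).trans (hm k))

lemma abs_re_le (c : Freq → ℂ) (k : Freq) (x : Vec 2) : |(c k * expo k x).re| ≤ ‖c k‖ := by
  have := Complex.abs_re_le_norm (c k * expo k x)
  rwa [norm_mul, norm_expo, mul_one] at this

lemma abs_im_le (c : Freq → ℂ) (k : Freq) (x : Vec 2) : |(c k * expo k x).im| ≤ ‖c k‖ := by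
  have := Complex.abs_im_le_norm (c k * expo k x)
  rwa [norm_mul, norm_expo, mul_one] at this

lemma continuous_synth {c : Freq → ℂ} (hc : Herm c) : Continuous (synth c) :=
  continuous_tsum (fun k => Complex.continuous_re.comp (continuous_const.mul (smP_expo k).cont))
    hc.summable fun k x => abs_re_le c k x

lemma continuous_conjSynth {c : Freq → ℂ} (hc : Herm c) {m : Freq → ℝ} {B : ℝ}
    (hm : ∀ k, |m k| ≤ B) : Continuous (conjSynth m c) :=
  continuous_tsum (fun k => continuous_const.mul
    (Complex.continuous_im.comp (continuous_const.mul (smP_expo k).cont)))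
    (hc.summable.mul_left B) fun k x => by
      rw [norm_mul]
      exact mul_le_mul (hm k) (abs_im_le c k x) (norm_nonneg _) ((abs_nonneg _).trans (hm k))

/-- The analytic projection has real part `synth c` and imaginary part the conjugate function. -/
lemma analytic_eq {c : Freq → ℂ} (hc : Herm c) {σ : Freq → ℝ} (hσ : IsSign σ) (x : Vec 2) :
    ∑' k, (((1 + σ k : ℝ) : ℂ) * c k) * expo k x
      = (synth c x : ℂ) + (conjSynth σ c x : ℂ) * Complex.I := by
  have s1 : Summable fun k => (((1 + σ k : ℝ) : ℂ) * c k) * expo k x := by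
    refine summable_mul_expo ?_ x
    refine (hc.summable.mul_left 2).of_nonneg_of_le (fun _ => norm_nonneg _) fun k => ?_
    rw [norm_mul, Complex.norm_real]
    refine mul_le_mul_of_nonneg_right ?_ (norm_nonneg _)
    rw [Real.norm_eq_abs, abs_le]
    have := abs_le.1 (hσ.abs_le k)
    constructor <;> linarith
  have sr := summable_bdd_mul hc (m := fun _ => 1) (B := 1) (by simp)
    (fun k => abs_re_le c k x)
  have si := summable_bdd_mul hc (m := fun _ => 1) (B := 1) (by simp)
    (fun k => abs_im_le c k x)
  have sσr := summable_bdd_mul hc hσ.abs_le (fun k => abs_re_le c k x)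
  have sσi := summable_bdd_mul hc hσ.abs_le (fun k => abs_im_le c k x)
  apply Complex.ext
  · rw [Complex.re_tsum s1]
    have : ∀ k, ((((1 + σ k : ℝ) : ℂ) * c k) * expo k x).re
        = 1 * (c k * expo k x).re + σ k * (c k * expo k x).re := by
      intro k
      rw [mul_assoc, Complex.re_ofReal_mul]; ring
    simp_rw [this]
    rw [sr.tsum_add sσr, tsum_odd (g := fun k => σ k * (c k * expo k x).re)]
    · simp [synth]
    · intro k
      rw [hc.conj_expo, hσ.odd, Complex.conj_re]; ring
  · rw [Complex.im_tsum s1]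
    have : ∀ k, ((((1 + σ k : ℝ) : ℂ) * c k) * expo k x).im
        = 1 * (c k * expo k x).im + σ k * (c k * expo k x).im := by
      intro k
      rw [mul_assoc, Complex.im_ofReal_mul]; ring
    simp_rw [this]
    rw [si.tsum_add sσi, tsum_odd (g := fun k => 1 * (c k * expo k x).im)]
    · simp [conjSynth]
    · intro k
      rw [hc.conj_expo, Complex.conj_im]; ring

/-- Powers of an analytic function have the expected mean. -/
lemma integral_analytic_pow {c : Freq → ℂ} (hc : Herm c) {σ : Freq → ℝ} (hσ : IsSign σ) (N : ℕ) :
    ∫ x in box 2, (∑' k, (((1 + σ k : ℝ) : ℂ) * c k) * expo k x) ^ N = c 0 ^ N := by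
  set d : Freq → ℂ := fun k => ((1 + σ k : ℝ) : ℂ) * c k with hd
  have hs : Summable fun k => ‖d k‖ := by
    refine (hc.summable.mul_left 2).of_nonneg_of_le (fun _ => norm_nonneg _) fun k => ?_
    rw [hd, norm_mul, Complex.norm_real]
    refine mul_le_mul_of_nonneg_right ?_ (norm_nonneg _)
    rw [Real.norm_eq_abs, abs_le]
    have := abs_le.1 (hσ.abs_le k)
    constructor <;> linarith
  have hF := continuous_tsum_expo hs
  set F := fun x => ∑' k, d k * expo k x with hFdef
  have hd0 : ∀ k, k ≠ 0 → σ k ≠ 1 → d k = 0 := fun k hk h => by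
    simp [hd, (hσ.val k hk).resolve_left h]
  have van : ∀ j k, σ k = 1 → ∫ x in box 2, F x ^ j * expo k x = 0 := by
    intro j
    induction j with
    | zero =>
      intro k hk
      simp only [pow_zero, one_mul]
      exact integral_expo fun h => by rw [h, hσ.zero] at hk; norm_num at hk
    | succ j ih =>
      intro k hk
      have h := hasSum_integral_mul_expo hs ((hF.pow j).mul (smP_expo k).cont)
      have e : ∀ x, F x ^ (j + 1) * expo k x = F x ^ j * expo k x * F x := fun x => by ring
      simp only [e]
      refine h.unique ?_
      convert hasSum_zero with l
      by_cases hl : l = 0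
      · subst hl
        simp only [expo_zero, mul_one]
        exact mul_eq_zero_of_right _ (ih k hk)
      · by_cases hl1 : σ l = 1
        · refine mul_eq_zero_of_right _ ?_
          have := ih (k + l) (hσ.add k l hk hl1)
          simpa only [expo_add, mul_assoc, Pi.mul_apply, Pi.pow_apply] using this
        · rw [hd0 l hl hl1, zero_mul]
  induction N with
  | zero => simp
  | succ j ih =>
    have h := hasSum_integral_mul_expo hs (hF.pow j)
    have h2 := h.unique (hasSum_single 0 fun l hl => by
      by_cases hl1 : σ l = 1
      · exact mul_eq_zero_of_right _ (van j l hl1)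
      · rw [hd0 l hl hl1, zero_mul])
    simp only [expo_zero, mul_one] at h2
    simp only [pow_succ]
    refine h2.trans ?_
    have hd00 : d 0 = c 0 := by simp [hd, hσ.zero]
    have ih' : ∫ x in box 2, F x ^ j = c 0 ^ j := ih
    rw [hd00]
    exact (congrArg (c 0 * ·) ih').trans (mul_comm _ _)

lemma norm_pow_sub_pow_le' {z w : ℂ} {B : ℝ} (hz : ‖z‖ ≤ B) (hw : ‖w‖ ≤ B) (j : ℕ) :
    ‖z ^ (j + 1) - w ^ (j + 1)‖ ≤ (j + 1) * ‖z - w‖ * B ^ j := by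
  have hB : 0 ≤ B := (norm_nonneg _).trans hz
  induction j with
  | zero => simp
  | succ j ih =>
    have e : z ^ (j + 1 + 1) - w ^ (j + 1 + 1)
        = z * (z ^ (j + 1) - w ^ (j + 1)) + (z - w) * w ^ (j + 1) := by ring
    rw [e]
    refine (norm_add_le _ _).trans ?_
    rw [norm_mul, norm_mul, norm_pow]
    have h1 := mul_le_mul hz ih (norm_nonneg _) hB
    have h2 := mul_le_mul_of_nonneg_left (pow_le_pow_left₀ (norm_nonneg w) hw (j + 1))
      (norm_nonneg (z - w))
    refine (add_le_add h1 h2).trans (le_of_eq ?_)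
    push_cast
    ring

lemma re_even_pow_ge (n : ℕ) : ∃ C : ℝ, 0 ≤ C ∧ ∀ u v : ℝ,
    v ^ (2 * n) / 2 - C * u ^ (2 * n) ≤ (-1) ^ n * (((u : ℂ) + v * Complex.I) ^ (2 * n)).re := by
  rcases Nat.eq_zero_or_pos n with rfl | hn
  · exact ⟨0, le_rfl, fun u v => by norm_num⟩
  obtain ⟨j, hj⟩ : ∃ j, 2 * n = j + 1 := ⟨2 * n - 1, by omega⟩
  set K : ℝ := 2 * (j + 1) * 2 ^ j with hK
  have hK1 : 1 ≤ K := by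
    have : (1:ℝ) ≤ 2 ^ j := one_le_pow₀ (by norm_num)
    rw [hK]; nlinarith [Nat.cast_nonneg (α := ℝ) j]
  refine ⟨(j + 1) * (1 + K) ^ j, by positivity, fun u v => ?_⟩
  set z : ℂ := (u : ℂ) + v * Complex.I
  set w : ℂ := v * Complex.I
  have hzw : ‖z - w‖ = |u| := by simp [z, w]
  have hw : ‖w‖ = |v| := by simp [w]
  have hz : ‖z‖ ≤ |u| + |v| := by
    refine (norm_add_le _ _).trans ?_
    simp
  have hd := norm_pow_sub_pow_le' hz (hw.le.trans (le_add_of_nonneg_left (abs_nonneg u))) j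
  rw [hzw, ← hj] at hd
  have hw2 : w ^ (2 * n) = (((-1) ^ n * v ^ (2 * n) : ℝ) : ℂ) := by
    simp only [w]
    rw [mul_pow, pow_mul Complex.I, Complex.I_sq]
    push_cast
    ring
  have hre := (Complex.abs_re_le_norm (z ^ (2 * n) - w ^ (2 * n))).trans hd
  rw [Complex.sub_re, hw2, Complex.ofReal_re] at hre
  have hsq : ((-1:ℝ) ^ n) * (-1) ^ n = 1 := by rw [← mul_pow]; simp
  have habs : |(-1:ℝ) ^ n * (z ^ (2 * n)).re - v ^ (2 * n)| ≤ (j + 1) * |u| * (|u| + |v|) ^ j := by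
    have e : (-1:ℝ) ^ n * (z ^ (2 * n)).re - v ^ (2 * n)
        = (-1) ^ n * ((z ^ (2 * n)).re - (-1) ^ n * v ^ (2 * n)) := by
      linear_combination v ^ (2 * n) * hsq
    rw [e, abs_mul, abs_pow, abs_neg, abs_one, one_pow, one_mul]
    exact hre
  have h3 := (abs_le.1 habs).1
  suffices (j + 1) * |u| * (|u| + |v|) ^ j
      ≤ v ^ (2 * n) / 2 + (j + 1) * (1 + K) ^ j * u ^ (2 * n) by linarith
  have hv : v ^ (2 * n) = |v| ^ (j + 1) := by rw [← hj, (even_two_mul n).pow_abs]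
  have hu : u ^ (2 * n) = |u| ^ (j + 1) := by rw [← hj, (even_two_mul n).pow_abs]
  rw [hv, hu]
  have a0 := abs_nonneg u
  have b0 := abs_nonneg v
  generalize |u| = a at *
  generalize |v| = b at *
  by_cases hab : b ≤ K * a
  · have : (a + b) ^ j ≤ ((1 + K) * a) ^ j := pow_le_pow_left₀ (by positivity) (by linarith) j
    have h4 := mul_le_mul_of_nonneg_left this (by positivity : 0 ≤ (j + 1) * a)
    have h5 : 0 ≤ b ^ (j + 1) / 2 := by positivity
    refine h4.trans ?_
    rw [mul_pow]
    refine le_trans (le_of_eq ?_) (le_add_of_nonneg_left h5)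
    ring
  · push Not at hab
    have hab' : a ≤ b := by nlinarith
    have : (a + b) ^ j ≤ (2 * b) ^ j := pow_le_pow_left₀ (by positivity) (by linarith) j
    have h4 := mul_le_mul_of_nonneg_left this (by positivity : 0 ≤ (j + 1) * a)
    have h5 : 0 ≤ (j + 1) * (1 + K) ^ j * a ^ (j + 1) := by positivity
    refine h4.trans (le_trans ?_ (le_add_of_nonneg_right h5))
    rw [mul_pow, pow_succ]
    have h6 : 0 ≤ b ^ j := by positivity
    have h7 := mul_le_mul_of_nonneg_right hab.le h6
    rw [hK] at h7
    nlinarith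

lemma synth_mean {c : Freq → ℂ} (hc : Herm c) :
    (c 0).im = 0 ∧ (c 0).re = ∫ x in box 2, synth c x := by
  have h0 : (c 0).im = 0 := by
    have := congrArg Complex.im (hc.conj 0)
    simp only [neg_zero, Complex.conj_im] at this
    linarith
  refine ⟨h0, ?_⟩
  have h := hasSum_integral_mul_expo hc.summable (continuous_const (y := (1:ℂ)))
  simp only [one_mul] at h
  have h2 := h.unique (hasSum_single 0 fun k hk => by rw [integral_expo hk, mul_zero])
  simp only [expo_zero, integral_const, measureReal_def, Measure.restrict_apply,
    MeasurableSet.univ, univ_inter, volume_box, ENNReal.toReal_one, one_smul, mul_one] at h2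
  have h3 : ∫ x in box 2, synth c x = ∫ x in box 2, (∑' k, c k * expo k x).re := by
    congr 1; ext x
    rw [Complex.re_tsum (summable_mul_expo hc.summable x)]; rfl
  have h4 := integral_re (𝕜 := ℂ) (integrable_box (continuous_tsum_expo hc.summable))
  rw [h3, ← h2]
  exact h4.symm

lemma integral_pow_le_even {f : Vec 2 → ℝ} (hf : Continuous f) (n : ℕ) :
    (∫ x in box 2, f x) ^ (2 * n) ≤ ∫ x in box 2, f x ^ (2 * n) :=
  ((even_two_mul n).convexOn_pow).map_integral_le (by fun_prop) isClosed_univ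
    (Eventually.of_forall fun _ => mem_univ _) (integrable_box hf) (integrable_box (hf.pow (2 * n)))

/-- Boundedness of the conjugate function in `L^{2n}`, uniformly in the order. -/
lemma conj_bound (n : ℕ) : ∃ C : ℝ, 0 ≤ C ∧ ∀ σ, IsSign σ → ∀ c, Herm c →
    ∫ x in box 2, conjSynth σ c x ^ (2 * n) ≤ C * ∫ x in box 2, synth c x ^ (2 * n) := by
  obtain ⟨C, hC, hp⟩ := re_even_pow_ge n
  refine ⟨2 * (C + 1), by positivity, fun σ hσ c hc => ?_⟩
  have h := integral_analytic_pow hc hσ (2 * n)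
  simp only [analytic_eq hc hσ] at h
  have cu := continuous_synth hc
  have cv := continuous_conjSynth hc hσ.abs_le
  have cF : Continuous fun x => ((synth c x : ℂ) + (conjSynth σ c x : ℂ) * Complex.I) ^ (2 * n) :=
    ((Complex.continuous_ofReal.comp cu).add
      ((Complex.continuous_ofReal.comp cv).mul continuous_const)).pow _
  have h4 := integral_re (𝕜 := ℂ) (integrable_box cF)
  rw [h] at h4
  have i1 : IntegrableOn (fun x => conjSynth σ c x ^ (2 * n) / 2) (box 2) :=
    integrable_box ((cv.pow _).div_const _)
  have i2 : IntegrableOn (fun x => C * synth c x ^ (2 * n)) (box 2) :=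
    integrable_box (continuous_const.mul (cu.pow _))
  have h5 : ∫ x in box 2, (conjSynth σ c x ^ (2 * n) / 2 - C * synth c x ^ (2 * n))
      ≤ ∫ x in box 2, (-1) ^ n *
        (((synth c x : ℂ) + (conjSynth σ c x : ℂ) * Complex.I) ^ (2 * n)).re :=
    integral_mono (i1.sub i2) (integrable_box (continuous_const.mul
      (Complex.continuous_re.comp cF))) fun x => hp _ _
  rw [integral_sub i1 i2, integral_div, integral_const_mul, integral_const_mul] at h5
  have h6 : ∫ x in box 2, (((synth c x : ℂ) + (conjSynth σ c x : ℂ) * Complex.I) ^ (2 * n)).re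
      = (c 0 ^ (2 * n)).re := h4
  obtain ⟨m1, m2⟩ := synth_mean hc
  have h7 : c 0 = ((∫ x in box 2, synth c x : ℝ) : ℂ) := Complex.ext (by simp [m2]) (by simp [m1])
  rw [h6, h7, ← Complex.ofReal_pow, Complex.ofReal_re] at h5
  have h8 := integral_pow_le_even cu n
  have h9 : (-1 : ℝ) ^ n * (∫ x in box 2, synth c x) ^ (2 * n)
      ≤ (∫ x in box 2, synth c x) ^ (2 * n) := by
    have : 0 ≤ (∫ x in box 2, synth c x) ^ (2 * n) := by rw [pow_mul]; positivity
    refine mul_le_of_le_one_left this ?_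
    rcases neg_one_pow_eq_or ℝ n with h | h <;> rw [h]; norm_num
  linarith

lemma norm_avg_le {m η : ℝ} {B : ℝ} (hη : |η| ≤ B) (hm : |m| ≤ 1) : |η * m| ≤ B := by
  rw [abs_mul]
  nlinarith [abs_nonneg η, abs_nonneg m]

lemma abs_conjSynth_le {c : Freq → ℂ} (hc : Herm c) {m : Freq → ℝ} (hm : ∀ k, |m k| ≤ 1)
    (x : Vec 2) : |conjSynth m c x| ≤ ∑' k, ‖c k‖ := by
  have := tsum_of_norm_bounded (f := fun k => m k * (c k * expo k x).im) hc.summable.hasSum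
    fun k => by
      rw [norm_mul]
      exact (mul_le_mul (hm k) (abs_im_le c k x) (abs_nonneg _) zero_le_one).trans (by simp)
  exact this

/-- Averages of conjugate functions over a family of orders are bounded in `L^{2n}`. -/
lemma conj_average (n : ℕ) : ∃ C : ℝ, 0 ≤ C ∧ ∀ (μ₀ : Measure ℝ) [IsProbabilityMeasure μ₀]
    (σ : ℝ → Freq → ℝ) (η : ℝ → ℝ) (B : ℝ), (∀ k, Measurable fun s => σ s k) →
    (∀ s k, |σ s k| ≤ 1) → (∀ᵐ s ∂μ₀, IsSign (σ s)) → Measurable η → (∀ s, |η s| ≤ B) →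
    ∀ c, Herm c → ∫ x in box 2, conjSynth (fun k => ∫ s, η s * σ s k ∂μ₀) c x ^ (2 * n)
      ≤ B ^ (2 * n) * C * ∫ x in box 2, synth c x ^ (2 * n) := by
  obtain ⟨C, hC, hb⟩ := conj_bound n
  refine ⟨C, hC, fun μ₀ _ σ η B hσm hσ1 hσ hηm hη c hc => ?_⟩
  have hB : 0 ≤ B := (abs_nonneg _).trans (hη 0)
  set S := ∑' k, ‖c k‖ with hS
  have intη : ∀ k, Integrable (fun s => η s * σ s k) μ₀ := fun k =>
    Integrable.of_bound (hηm.mul (hσm k)).aestronglyMeasurable B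
      (Eventually.of_forall fun s => norm_avg_le (hη s) (hσ1 s k))
  have joint : Measurable fun q : Vec 2 × ℝ => η q.2 * conjSynth (σ q.2) c q.1 := by
    refine (hηm.comp measurable_snd).mul ?_
    refine Measurable.tsum fun k => ?_
    exact ((hσm k).comp measurable_snd).mul ((Complex.continuous_im.comp
      (continuous_const.mul (smP_expo k).cont)).measurable.comp measurable_fst)
  have bd : ∀ x s, |η s * conjSynth (σ s) c x| ≤ B * S := fun x s => by
    rw [abs_mul]
    exact mul_le_mul (hη s) (abs_conjSynth_le hc (hσ1 s) x) (abs_nonneg _) hB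
  have rep : ∀ x, conjSynth (fun k => ∫ s, η s * σ s k ∂μ₀) c x
      = ∫ s, η s * conjSynth (σ s) c x ∂μ₀ := by
    intro x
    have hF : ∀ k, Integrable (fun s => η s * σ s k * (c k * expo k x).im) μ₀ :=
      fun k => (intη k).mul_const _
    have h := hasSum_integral_of_summable_integral_norm (μ := μ₀) hF (by
      refine (hc.summable.mul_left B).of_nonneg_of_le (fun k => by positivity) fun k => ?_
      have := norm_integral_le_of_norm_le_const (μ := μ₀) (C := B * ‖c k‖)
        (f := fun s => ‖η s * σ s k * (c k * expo k x).im‖) (Eventually.of_forall fun s => by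
          rw [norm_norm, norm_mul]
          exact mul_le_mul (norm_avg_le (hη s) (hσ1 s k)) (abs_im_le c k x) (norm_nonneg _) hB)
      simp only [measureReal_def, measure_univ, ENNReal.toReal_one, mul_one] at this
      exact (le_abs_self _).trans this)
    have h2 := h.tsum_eq
    simp only [integral_mul_const] at h2
    rw [conjSynth, h2]
    congr 1; ext s
    rw [conjSynth, ← tsum_mul_left]
    simp only [mul_assoc]
  have ptw : ∀ x, conjSynth (fun k => ∫ s, η s * σ s k ∂μ₀) c x ^ (2 * n)
      ≤ ∫ s, (η s * conjSynth (σ s) c x) ^ (2 * n) ∂μ₀ := by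
    intro x
    rw [rep]
    have mx : Measurable fun s => η s * conjSynth (σ s) c x := joint.comp measurable_prodMk_left
    exact ((even_two_mul n).convexOn_pow).map_integral_le (by fun_prop) isClosed_univ
      (Eventually.of_forall fun _ => mem_univ _)
      (Integrable.of_bound mx.aestronglyMeasurable (B * S) (Eventually.of_forall fun s => bd x s))
      (Integrable.of_bound (mx.pow_const _).aestronglyMeasurable ((B * S) ^ (2 * n))
        (Eventually.of_forall fun s => by
          rw [Function.comp_apply, norm_pow]; exact pow_le_pow_left₀ (norm_nonneg _) (bd x s) _))
  have ij : Integrable (Function.uncurry fun x s => (η s * conjSynth (σ s) c x) ^ (2 * n))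
      ((volume.restrict (box 2)).prod μ₀) :=
    Integrable.of_bound (joint.pow_const _).aestronglyMeasurable ((B * S) ^ (2 * n))
      (Eventually.of_forall fun q => by
        change ‖(η q.2 * conjSynth (σ q.2) c q.1) ^ (2 * n)‖ ≤ _
        rw [norm_pow]; exact pow_le_pow_left₀ (norm_nonneg _) (bd q.1 q.2) _)
  have cA : Continuous (conjSynth (fun k => ∫ s, η s * σ s k ∂μ₀) c) :=
    continuous_conjSynth hc (B := B) fun k => by
      have := norm_integral_le_of_norm_le_const (μ := μ₀) (C := B)
        (f := fun s => η s * σ s k) (Eventually.of_forall fun s => norm_avg_le (hη s) (hσ1 s k))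
      simpa [measureReal_def] using this
  calc ∫ x in box 2, conjSynth (fun k => ∫ s, η s * σ s k ∂μ₀) c x ^ (2 * n)
      ≤ ∫ x in box 2, ∫ s, (η s * conjSynth (σ s) c x) ^ (2 * n) ∂μ₀ :=
        integral_mono (integrable_box (cA.pow _)) ij.integral_prod_left ptw
    _ = ∫ s, (∫ x in box 2, (η s * conjSynth (σ s) c x) ^ (2 * n)) ∂μ₀ := integral_integral_swap ij
    _ ≤ ∫ s, B ^ (2 * n) * C * (∫ x in box 2, synth c x ^ (2 * n)) ∂μ₀ := by
        refine integral_mono_ae ij.integral_prod_right (integrable_const _) ?_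
        filter_upwards [hσ] with s hs
        simp only [mul_pow, integral_const_mul]
        rw [mul_assoc]
        refine mul_le_mul ?_ (hb _ hs c hc)
          (integral_nonneg fun x => by rw [pow_mul]; positivity) (by positivity)
        rw [← (even_two_mul n).pow_abs]
        exact pow_le_pow_left₀ (abs_nonneg _) (hη s) _
    _ = _ := by simp

/-- The lexicographic sign on frequencies. -/
def lexSign (k : Freq) : ℝ := if k 1 = 0 then SignType.sign ((k 0 : ℤ) : ℝ) else
  SignType.sign ((k 1 : ℤ) : ℝ)

/-- The sign of a linear form with slope `s` on frequencies. -/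
def slopeSign (s : ℝ) (k : Freq) : ℝ := SignType.sign ((k 0 : ℝ) + s * k 1)

lemma sign_cases {y : ℝ} (hy : y ≠ 0) : ((SignType.sign y : SignType) : ℝ) = 1 ∨
    ((SignType.sign y : SignType) : ℝ) = -1 := by
  rcases lt_or_gt_of_ne hy with h | h
  · right; simp [sign_neg h]
  · left; simp [sign_pos h]

lemma sign_eq_one {y : ℝ} : ((SignType.sign y : SignType) : ℝ) = 1 ↔ 0 < y := by
  rcases lt_trichotomy y 0 with h | h | h
  · simp [sign_neg h]; norm_num; exact h.le
  · simp [h]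
  · simp [sign_pos h, h]

lemma sign_neg_cast (y : ℝ) : ((SignType.sign (-y) : SignType) : ℝ) = -(SignType.sign y : ℝ) := by
  rw [Left.sign_neg]; simp

lemma isSign_slope {s : ℝ} (h : ∀ k : Freq, k ≠ 0 → (k 0 : ℝ) + s * k 1 ≠ 0) :
    IsSign (slopeSign s) where
  zero := by simp [slopeSign]
  val k hk := sign_cases (h k hk)
  odd k := by
    rw [slopeSign, slopeSign, ← sign_neg_cast]
    congr 2
    simp; ring
  add k l hk hl := by
    rw [slopeSign, sign_eq_one] at *
    simp only [Pi.add_apply, Int.cast_add]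
    linarith

lemma isSign_lex : IsSign lexSign where
  zero := by simp [lexSign]
  val k hk := by
    rw [lexSign]
    split_ifs with h
    · refine sign_cases fun h0 => hk ?_
      ext i; fin_cases i
      · exact_mod_cast h0
      · exact h
    · exact sign_cases (by exact_mod_cast h)
  odd k := by
    simp only [lexSign, Pi.neg_apply, neg_eq_zero, Int.cast_neg, sign_neg_cast]
    split_ifs <;> rfl
  add k l hk hl := by
    rw [lexSign] at *
    split_ifs at hk hl with h1 h2 h2 <;> rw [sign_eq_one] at hk hl
    · rw [if_pos (by simp [h1, h2]), sign_eq_one]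
      simp only [Pi.add_apply, Int.cast_add]; linarith
    · rw [if_neg (by simp [h1, h2]), sign_eq_one]
      simpa [h1] using hl
    · rw [if_neg (by simp [h1, h2]), sign_eq_one]
      simpa [h2] using hk
    · have : 0 < ((k + l) 1 : ℝ) := by
        simp only [Pi.add_apply, Int.cast_add]; linarith
      rw [if_neg (by intro h; rw [h] at this; simp at this), sign_eq_one]
      exact this

lemma measurable_slope (k : Freq) : Measurable fun s => slopeSign s k := by
  have : Measurable fun y : ℝ => ((SignType.sign y : SignType) : ℝ) := by
    have e : (fun y : ℝ => ((SignType.sign y : SignType) : ℝ))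
        = fun y => if 0 < y then 1 else if y < 0 then -1 else 0 := by
      ext y
      rcases lt_trichotomy y 0 with h | h | h
      · simp [sign_neg h, h, h.le]
      · simp [h]
      · simp [sign_pos h, h]
    rw [e]
    exact Measurable.ite measurableSet_Ioi measurable_const
      (Measurable.ite measurableSet_Iio measurable_const measurable_const)
  exact this.comp (by fun_prop)

lemma abs_sign_le (y : ℝ) : |((SignType.sign y : SignType) : ℝ)| ≤ 1 := by
  by_cases h : y = 0
  · simp [h]
  · rcases sign_cases h with h | h <;> simp [h]

lemma ae_isSign_slope : ∀ᵐ s : ℝ, IsSign (slopeSign s) := by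
  have : ∀ᵐ s : ℝ, ∀ k : Freq, k ≠ 0 → (k 0 : ℝ) + s * k 1 ≠ 0 := by
    rw [ae_all_iff]
    intro k
    by_cases h1 : k 1 = 0
    · refine Eventually.of_forall fun s hk h => hk ?_
      rw [h1] at h
      ext i; fin_cases i
      · simpa using h
      · exact h1
    · have : ∀ᵐ s : ℝ, s ≠ -(k 0 : ℝ) / k 1 := by
        rw [ae_iff]; simp
      filter_upwards [this] with s hs _ h
      have h1' : (k 1 : ℝ) ≠ 0 := by exact_mod_cast h1
      exact hs (by field_simp; linarith)
  filter_upwards [this] with s hs using isSign_slope hs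

/-- The kernel average of the slope signs, compared with the lexicographic sign. -/
lemma lexSign_mul_integral {H h : ℝ → ℝ} (hH : ∀ s, HasDerivAt H (h s) s) (hi : Integrable h)
    (ht : Tendsto H atTop (nhds 0)) (hb : Tendsto H atBot (nhds 0)) (k : Freq) :
    lexSign k * ∫ s, h s * slopeSign s k = if k 1 = 0 then 0 else -2 * H (-(k 0 : ℝ) / k 1) := by
  have I1 : ∀ a, ∫ s in Ioi a, h s = -H a := fun a => by
    rw [integral_Ioi_of_hasDerivAt_of_tendsto' (fun x _ => hH x) hi.integrableOn ht]; simp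
  have I2 : ∀ a, ∫ s in Iic a, h s = H a := fun a => by
    rw [integral_Iic_of_hasDerivAt_of_tendsto' (fun x _ => hH x) hi.integrableOn hb]; simp
  split_ifs with h1
  · simp only [slopeSign, h1, Int.cast_zero, mul_zero, add_zero]
    rw [integral_mul_const, ← intervalIntegral.integral_Iic_add_Ioi (b := 0) hi.integrableOn
      hi.integrableOn, I1, I2]
    ring
  · have h1' : (k 1 : ℝ) ≠ 0 := by exact_mod_cast h1
    set a := -(k 0 : ℝ) / k 1 with ha
    have e : ∀ s, slopeSign s k = (SignType.sign (k 1 : ℝ) : ℝ) * (SignType.sign (s - a) : ℝ) := by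
      intro s
      rw [slopeSign, ← SignType.coe_mul, ← sign_mul]
      congr 2
      rw [ha]; field_simp; ring
    have hint : Integrable fun s => h s * slopeSign s k :=
      hi.mul_bdd (c := 1) (measurable_slope k).aestronglyMeasurable
        (Eventually.of_forall fun s => abs_sign_le _)
    rw [← intervalIntegral.integral_Iic_add_Ioi (b := a) hint.integrableOn hint.integrableOn]
    have J1 : ∫ s in Ioi a, h s * slopeSign s k = (SignType.sign (k 1 : ℝ) : ℝ) * -H a := by
      rw [← I1, ← integral_const_mul]
      refine setIntegral_congr_fun measurableSet_Ioi fun s hs => ?_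
      have hs' : a < s := hs
      simp only [e, sign_pos (sub_pos.2 hs')]
      simp only [SignType.coe_one]; ring
    have J2 : ∫ s in Iic a, h s * slopeSign s k = -(SignType.sign (k 1 : ℝ) : ℝ) * H a := by
      rw [← I2, ← integral_const_mul, integral_Iic_eq_integral_Iio, integral_Iic_eq_integral_Iio]
      refine setIntegral_congr_fun measurableSet_Iio fun s hs => ?_
      have hs' : s < a := hs
      simp only [e, sign_neg (sub_neg.2 hs')]
      simp only [SignType.coe_one, SignType.coe_neg]; ring
    rw [J1, J2, lexSign, if_neg h1]
    have : (SignType.sign (k 1 : ℝ) : ℝ) * (SignType.sign (k 1 : ℝ) : ℝ) = 1 := by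
      rcases sign_cases h1' with h | h <;> rw [h] <;> norm_num
    linear_combination (-2 * H a) * this

lemma herm_mul {c : Freq → ℂ} (hc : Herm c) {m : Freq → ℝ} {B : ℝ} (hm : ∀ k, |m k| ≤ B)
    (he : ∀ k, m (-k) = m k) : Herm fun k => (m k : ℂ) * c k where
  summable := (hc.summable.mul_left B).of_nonneg_of_le (fun _ => norm_nonneg _) fun k => by
    rw [norm_mul, Complex.norm_real]
    exact mul_le_mul_of_nonneg_right (hm k) (norm_nonneg _)
  conj k := by rw [hc.conj, he, map_mul, Complex.conj_ofReal]

lemma herm_neg_I_mul {c : Freq → ℂ} (hc : Herm c) {m : Freq → ℝ} {B : ℝ} (hm : ∀ k, |m k| ≤ B)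
    (ho : ∀ k, m (-k) = -m k) : Herm fun k => -Complex.I * (m k : ℂ) * c k where
  summable := (hc.summable.mul_left B).of_nonneg_of_le (fun _ => norm_nonneg _) fun k => by
    rw [norm_mul, norm_mul, norm_neg, Complex.norm_I, one_mul, Complex.norm_real]
    exact mul_le_mul_of_nonneg_right (hm k) (norm_nonneg _)
  conj k := by
    rw [hc.conj, ho, map_mul, map_mul, Complex.conj_ofReal, map_neg, Complex.conj_I]
    push_cast; ring

lemma slopeSign_neg (s : ℝ) (k : Freq) : slopeSign s (-k) = -slopeSign s k := by
  rw [slopeSign, slopeSign, ← sign_neg_cast]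
  congr 2
  simp; ring

/-- A multiplier obtained by averaging orders is bounded in `L^{2n}`. -/
lemma slope_multiplier (n : ℕ) : ∃ C : ℝ, 0 ≤ C ∧ ∀ (H η : ℝ → ℝ) (B : ℝ), Measurable η →
    (∀ s, |η s| ≤ B) → (∀ s, HasDerivAt H (π⁻¹ * (s ^ 2 + 1)⁻¹ * η s) s) →
    Tendsto H atTop (nhds 0) → Tendsto H atBot (nhds 0) → ∀ c, Herm c →
    ∫ x in box 2, synth (fun k => ((if k 1 = 0 then 0 else 2 * H (-(k 0 : ℝ) / k 1) : ℝ) : ℂ) * c k)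
      x ^ (2 * n) ≤ B ^ (2 * n) * C * ∫ x in box 2, synth c x ^ (2 * n) := by
  obtain ⟨C, hC, hb⟩ := conj_average n
  obtain ⟨C', hC', hb'⟩ := conj_bound n
  refine ⟨C * C', by positivity, fun H η B hηm hη hH ht hbt c hc => ?_⟩
  set μ₀ := ProbabilityTheory.cauchyMeasure 0 1 with hμ
  have hw : μ₀ = volume.withDensity (ProbabilityTheory.cauchyPDF 0 1) :=
    ProbabilityTheory.cauchyMeasure_of_scale_ne_zero 0 one_ne_zero
  have hae : ∀ᵐ s ∂μ₀, IsSign (slopeSign s) := by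
    rw [hw]
    exact (withDensity_absolutelyContinuous _ _).ae_le ae_isSign_slope
  set A : Freq → ℝ := fun k => ∫ s, η s * slopeSign s k ∂μ₀ with hA
  have hAB : ∀ k, |A k| ≤ B := fun k => by
    have := norm_integral_le_of_norm_le_const (μ := μ₀) (C := B)
      (f := fun s => η s * slopeSign s k)
      (Eventually.of_forall fun s => norm_avg_le (hη s) (abs_sign_le _))
    simpa [measureReal_def] using this
  have hAo : ∀ k, A (-k) = -A k := fun k => by
    simp only [hA, slopeSign_neg, mul_neg, integral_neg]
  have hAk : ∀ k, A k = ∫ s, π⁻¹ * (s ^ 2 + 1)⁻¹ * η s * slopeSign s k := fun k => by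
    change ∫ s, η s * slopeSign s k ∂μ₀ = _
    rw [hw, integral_withDensity_eq_integral_toReal_smul
      (ProbabilityTheory.measurable_cauchyPDF 0 1)
      (Eventually.of_forall fun s => ENNReal.ofReal_lt_top)]
    congr 1; ext s
    rw [ProbabilityTheory.cauchyPDF, ENNReal.toReal_ofReal
      (ProbabilityTheory.cauchyPDF_pos 0 one_ne_zero s).le, ProbabilityTheory.cauchyPDFReal]
    simp only [NNReal.coe_one, mul_one, sub_zero, one_pow, smul_eq_mul, mul_assoc]
  have hint : Integrable fun s => π⁻¹ * (s ^ 2 + 1)⁻¹ * η s := by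
    have h1 : Integrable fun s : ℝ => π⁻¹ * (s ^ 2 + 1)⁻¹ := by
      have := integrable_inv_one_add_sq.const_mul π⁻¹
      simpa only [add_comm] using this
    exact h1.mul_bdd (c := B) hηm.aestronglyMeasurable (Eventually.of_forall hη)
  have key : ∀ k, lexSign k * A k = -(if k 1 = 0 then 0 else 2 * H (-(k 0 : ℝ) / k 1)) := by
    intro k
    rw [hAk, lexSign_mul_integral hH hint ht hbt]
    split_ifs <;> ring
  have hc' := herm_neg_I_mul hc hAB hAo
  have e1 : ∀ x, synth (fun k => -Complex.I * (A k : ℂ) * c k) x = conjSynth A c x := fun x => by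
    simp only [synth, conjSynth]
    congr 1; ext k
    rw [show -Complex.I * (A k : ℂ) * c k * expo k x
      = (A k : ℂ) * (-Complex.I * (c k * expo k x)) by ring, Complex.re_ofReal_mul]
    congr 1
    simp [Complex.mul_re]
  have e2 : ∀ x, conjSynth lexSign (fun k => -Complex.I * (A k : ℂ) * c k) x
      = synth (fun k => ((if k 1 = 0 then 0 else 2 * H (-(k 0 : ℝ) / k 1) : ℝ) : ℂ) * c k) x :=
    fun x => by
      simp only [synth, conjSynth]
      congr 1; ext k
      rw [show -Complex.I * (A k : ℂ) * c k * expo k x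
        = (A k : ℂ) * (-Complex.I * (c k * expo k x)) by ring, Complex.im_ofReal_mul,
        ← mul_assoc, key, mul_assoc, Complex.re_ofReal_mul, neg_mul, ← mul_neg]
      congr 1
      simp [Complex.mul_im]
  have h1 := hb' _ isSign_lex _ hc'
  have h2 := hb μ₀ slopeSign η B measurable_slope (fun s k => abs_sign_le _) hae hηm hη c hc
  simp only [e1, e2] at h1
  refine h1.trans ((mul_le_mul_of_nonneg_left h2 hC').trans (le_of_eq ?_))
  ring

lemma sub_even_pow_le (a b : ℝ) (n : ℕ) :
    (a - b) ^ (2 * n) ≤ 2 ^ (2 * n) * (a ^ (2 * n) + b ^ (2 * n)) := by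
  rw [← (even_two_mul n).pow_abs (a - b), ← (even_two_mul n).pow_abs a,
    ← (even_two_mul n).pow_abs b]
  refine (pow_le_pow_left₀ (abs_nonneg _) (abs_sub _ _) _).trans
    ((add_pow_le (abs_nonneg _) (abs_nonneg _) _).trans ?_)
  exact mul_le_mul_of_nonneg_right (pow_le_pow_right₀ (by norm_num) (by omega)) (by positivity)

/-- The symbol of the second-order Riesz transforms. -/
def rieszSym (i j : Fin 2) (k : Freq) : ℝ := (k i : ℝ) * k j / ((k 0 : ℝ) ^ 2 + (k 1 : ℝ) ^ 2)

lemma abs_rieszSym_le (i j : Fin 2) (k : Freq) : |rieszSym i j k| ≤ 1 := by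
  rw [rieszSym, abs_div, abs_of_nonneg (by positivity : (0:ℝ) ≤ (k 0 : ℝ) ^ 2 + (k 1 : ℝ) ^ 2)]
  refine div_le_one_of_le₀ ?_ (by positivity)
  rw [abs_le]
  fin_cases i <;> fin_cases j <;> simp only [Fin.zero_eta, Fin.mk_one] <;> constructor <;>
    nlinarith [sq_nonneg ((k 0 : ℝ) + k 1), sq_nonneg ((k 0 : ℝ) - k 1), sq_nonneg (k 0 : ℝ),
      sq_nonneg (k 1 : ℝ)]

lemma rieszSym_neg (i j : Fin 2) (k : Freq) : rieszSym i j (-k) = rieszSym i j k := by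
  simp [rieszSym]

lemma tendsto_div_one_add_sq (l : Filter ℝ) (hl : Tendsto (fun s : ℝ => |s|) l atTop) (a b : ℝ) :
    Tendsto (fun s => (a * s + b) / (s ^ 2 + 1)) l (nhds 0) := by
  have h1 : Tendsto (fun s : ℝ => (|a| + |b|) * |s|⁻¹) l (nhds 0) := by
    simpa using (tendsto_inv_atTop_zero.comp hl).const_mul (|a| + |b|)
  refine squeeze_zero_norm' ?_ h1
  filter_upwards [hl.eventually_ge_atTop 1] with s hs
  rw [norm_div, Real.norm_eq_abs, Real.norm_eq_abs, abs_of_pos (by positivity : 0 < s ^ 2 + 1),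
    div_le_iff₀ (by positivity)]
  have h2 : |a * s + b| ≤ |a| * |s| + |b| := by
    rw [← abs_mul]; exact abs_add_le _ _
  have h3 : (|a| + |b|) * |s| ≤ (|a| + |b|) * |s|⁻¹ * (s ^ 2 + 1) := by
    rw [mul_assoc]
    refine mul_le_mul_of_nonneg_left ?_ (by positivity)
    rw [← sq_abs s]
    have : 0 < |s| := by linarith
    rw [mul_add, pow_two, ← mul_assoc, inv_mul_cancel₀ this.ne']
    have : 0 < |s|⁻¹ := by positivity
    linarith
  nlinarith [abs_nonneg b]

lemma riesz_bound (n : ℕ) : ∃ C : ℝ, 0 ≤ C ∧ ∀ i j c, Herm c →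
    ∫ x in box 2, synth (fun k => (rieszSym i j k : ℂ) * c k) x ^ (2 * n)
      ≤ C * ∫ x in box 2, synth c x ^ (2 * n) := by
  obtain ⟨C, hC, hb⟩ := slope_multiplier n
  have top : Tendsto (fun s : ℝ => |s|) atTop atTop := tendsto_abs_atTop_atTop
  have bot : Tendsto (fun s : ℝ => |s|) atBot atTop := tendsto_abs_atBot_atTop
  have b01 : ∀ c, Herm c → ∫ x in box 2, synth (fun k => (rieszSym 0 1 k : ℂ) * c k) x ^ (2 * n)
      ≤ π ^ (2 * n) * C * ∫ x in box 2, synth c x ^ (2 * n) := by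
    intro c hc
    have h := hb (fun s => (-(1 / 2) * s + 0) / (s ^ 2 + 1))
      (fun s => -π * (1 - s ^ 2) / (2 * (s ^ 2 + 1))) π (by fun_prop) (fun s => ?_) (fun s => ?_)
      (tendsto_div_one_add_sq _ top _ _) (tendsto_div_one_add_sq _ bot _ _) c hc
    · have e : ∀ k : Freq, rieszSym 0 1 k = if k 1 = 0 then 0 else
          2 * ((-(1 / 2) * (-(k 0 : ℝ) / k 1) + 0) / ((-(k 0 : ℝ) / k 1) ^ 2 + 1)) := fun k => by
        rw [rieszSym]
        split_ifs with h1
        · simp [h1]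
        · have h1' : (k 1 : ℝ) ≠ 0 := by exact_mod_cast h1
          have : (k 0 : ℝ) ^ 2 + (k 1 : ℝ) ^ 2 ≠ 0 := by positivity
          field_simp
          ring
      simpa only [e] using h
    · rw [abs_div, abs_of_pos (by positivity : 0 < 2 * (s ^ 2 + 1)), div_le_iff₀ (by positivity),
        neg_mul, abs_neg, abs_mul, abs_of_pos pi_pos]
      refine mul_le_mul_of_nonneg_left ?_ pi_pos.le
      rw [abs_le]
      constructor <;> nlinarith [sq_nonneg s]
    · have := ((hasDerivAt_id s).const_mul (-(1 / 2) : ℝ)).add_const 0 |>.div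
        (((hasDerivAt_id s).pow 2).add_const 1) (by positivity : id s ^ 2 + 1 ≠ 0)
      refine this.congr_deriv ?_
      simp only [id, Pi.pow_apply]
      field_simp
      ring
  have b11 : ∀ c, Herm c → ∫ x in box 2, synth (fun k => (rieszSym 1 1 k : ℂ) * c k) x ^ (2 * n)
      ≤ π ^ (2 * n) * C * ∫ x in box 2, synth c x ^ (2 * n) := by
    intro c hc
    have h := hb (fun s => (0 * s + 1 / 2) / (s ^ 2 + 1))
      (fun s => -π * s / (s ^ 2 + 1)) π (by fun_prop) (fun s => ?_) (fun s => ?_)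
      (tendsto_div_one_add_sq _ top _ _) (tendsto_div_one_add_sq _ bot _ _) c hc
    · have e : ∀ k : Freq, rieszSym 1 1 k = if k 1 = 0 then 0 else
          2 * ((0 * (-(k 0 : ℝ) / k 1) + 1 / 2) / ((-(k 0 : ℝ) / k 1) ^ 2 + 1)) := fun k => by
        rw [rieszSym]
        split_ifs with h1
        · simp [h1]
        · have h1' : (k 1 : ℝ) ≠ 0 := by exact_mod_cast h1
          have : (k 0 : ℝ) ^ 2 + (k 1 : ℝ) ^ 2 ≠ 0 := by positivity
          field_simp
          ring
      simpa only [e] using h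
    · rw [abs_div, abs_of_pos (by positivity : 0 < s ^ 2 + 1), div_le_iff₀ (by positivity),
        neg_mul, abs_neg, abs_mul, abs_of_pos pi_pos]
      refine mul_le_mul_of_nonneg_left ?_ pi_pos.le
      rw [abs_le]
      constructor <;> nlinarith [sq_nonneg (s + 1), sq_nonneg (s - 1)]
    · have := ((hasDerivAt_id s).const_mul (0 : ℝ)).add_const (1 / 2) |>.div
        (((hasDerivAt_id s).pow 2).add_const 1) (by positivity : id s ^ 2 + 1 ≠ 0)
      refine this.congr_deriv ?_
      simp only [id, Pi.pow_apply]
      field_simp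
      ring
  set K := π ^ (2 * n) * C with hK
  have hK0 : 0 ≤ K := by positivity
  have b00 : ∀ c, Herm c → ∫ x in box 2, synth (fun k => (rieszSym 0 0 k : ℂ) * c k) x ^ (2 * n)
      ≤ 2 ^ (2 * n) * (2 ^ (2 * n) * (1 + 1) + K) * ∫ x in box 2, synth c x ^ (2 * n) := by
    intro c hc
    have h1 := herm_mul hc (abs_rieszSym_le 1 1) (rieszSym_neg 1 1)
    have e : ∀ x, synth (fun k => (rieszSym 0 0 k : ℂ) * c k) x
        = (synth c x - ∫ y in box 2, synth c y)
          - synth (fun k => (rieszSym 1 1 k : ℂ) * c k) x := by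
      intro x
      have s0 : HasSum (fun k => (c k * expo k x).re) (synth c x) :=
        (hc.summable.of_norm_bounded fun k => abs_re_le c k x).hasSum
      have s1 : HasSum (fun k => ((rieszSym 1 1 k : ℂ) * c k * expo k x).re)
          (synth (fun k => (rieszSym 1 1 k : ℂ) * c k) x) :=
        (h1.summable.of_norm_bounded fun k => abs_re_le (fun k => (rieszSym 1 1 k : ℂ) * c k) k x).hasSum
      have s2 := hasSum_ite_eq (0 : Freq) (∫ y in box 2, synth c y)
      have s3 := (s0.sub s2).sub s1
      refine Eq.trans (tsum_congr fun k => ?_) s3.tsum_eq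
      obtain ⟨m1, m2⟩ := synth_mean hc
      simp only [mul_assoc, Complex.re_ofReal_mul]
      split_ifs with hk
      · subst hk
        simp [rieszSym, expo_zero, m2]
      · have : rieszSym 0 0 k = 1 - rieszSym 1 1 k := by
          have h2 : (k 0 : ℝ) ^ 2 + (k 1 : ℝ) ^ 2 ≠ 0 := fun h => hk (by
            ext i; fin_cases i
            · have : (k 0 : ℝ) ^ 2 = 0 := by nlinarith [sq_nonneg (k 0 : ℝ), sq_nonneg (k 1 : ℝ)]
              simpa using this
            · have : (k 1 : ℝ) ^ 2 = 0 := by nlinarith [sq_nonneg (k 0 : ℝ), sq_nonneg (k 1 : ℝ)]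
              simpa using this)
          rw [rieszSym, rieszSym]
          field_simp
          ring
        rw [this]
        ring
    have cs := continuous_synth hc
    have c1 := continuous_synth h1
    have i0 : IntegrableOn (fun x => synth c x ^ (2 * n)) (box 2) := integrable_box (cs.pow _)
    have i1 : IntegrableOn (fun x => synth (fun k => (rieszSym 1 1 k : ℂ) * c k) x ^ (2 * n))
      (box 2) := integrable_box (c1.pow _)
    set m := ∫ y in box 2, synth c y with hm
    have hmm := integral_pow_le_even cs n
    rw [← hm] at hmm
    have ic : IntegrableOn (fun _ : Vec 2 => m ^ (2 * n)) (box 2) := integrable_box continuous_const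
    have i2 : IntegrableOn (fun x => 2 ^ (2 * n) * (synth c x ^ (2 * n) + m ^ (2 * n))) (box 2) :=
      (i0.add ic).const_mul _
    calc ∫ x in box 2, synth (fun k => (rieszSym 0 0 k : ℂ) * c k) x ^ (2 * n)
        ≤ ∫ x in box 2, 2 ^ (2 * n) * (2 ^ (2 * n) * (synth c x ^ (2 * n) + m ^ (2 * n))
          + synth (fun k => (rieszSym 1 1 k : ℂ) * c k) x ^ (2 * n)) := by
          refine integral_mono (integrable_box ?_) (((((i0.add ic).const_mul _).add i1).const_mul _))
            fun x => ?_
          · simp only [e]; fun_prop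
          · simp only [e]
            refine (sub_even_pow_le _ _ _).trans (mul_le_mul_of_nonneg_left ?_ (by positivity))
            exact add_le_add (sub_even_pow_le _ _ _) le_rfl
      _ = 2 ^ (2 * n) * (2 ^ (2 * n) * ((∫ x in box 2, synth c x ^ (2 * n)) + m ^ (2 * n))
          + ∫ x in box 2, synth (fun k => (rieszSym 1 1 k : ℂ) * c k) x ^ (2 * n)) := by
          rw [integral_const_mul, integral_add i2 i1, integral_const_mul,
            integral_add i0 ic]
          simp
      _ ≤ _ := by
          rw [mul_assoc]
          refine mul_le_mul_of_nonneg_left ?_ (by positivity)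
          have h3 := b11 c hc
          have h4 : (0:ℝ) ≤ 2 ^ (2 * n) := by positivity
          nlinarith
  refine ⟨2 ^ (2 * n) * (2 ^ (2 * n) * (1 + 1) + K), by positivity, fun i j c hc => ?_⟩
  have hI : 0 ≤ ∫ x in box 2, synth c x ^ (2 * n) :=
    integral_nonneg fun x => by rw [pow_mul]; positivity
  have hK2 : K ≤ 2 ^ (2 * n) * (2 ^ (2 * n) * (1 + 1) + K) := by
    have : (1:ℝ) ≤ 2 ^ (2 * n) := one_le_pow₀ (by norm_num)
    nlinarith
  have up := mul_le_mul_of_nonneg_right hK2 hI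
  have e10 : rieszSym 1 0 = rieszSym 0 1 := by
    ext k; rw [rieszSym, rieszSym, mul_comm ((k 1 : ℤ) : ℝ)]
  fin_cases i <;> fin_cases j <;> simp only [Fin.zero_eta, Fin.mk_one]
  · exact b00 c hc
  · exact (b01 c hc).trans up
  · rw [e10]
    exact (b01 c hc).trans up
  · exact (b11 c hc).trans up

/-- Fourier coefficients of a real function. -/
def rc (f : Vec 2 → ℝ) (k : Freq) : ℂ := fc (fun x => (f x : ℂ)) k

lemma rc_pdir {f : Vec 2 → ℝ} (hf : SmP f) (j : Fin 2) (k : Freq) :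
    rc (pdir j f) k = 2 * π * Complex.I * k j * rc f k := by
  rw [rc, rc, ← fc_fderiv hf.ofReal]
  congr 1; ext x
  have := (Complex.ofRealCLM.hasFDerivAt (x := f x)).comp x (hf.diff x).hasFDerivAt
  have h2 : fderiv ℝ (fun x => (f x : ℂ)) x = Complex.ofRealCLM.comp (fderiv ℝ f x) := this.fderiv
  rw [h2]; rfl

lemma rc_add {f g : Vec 2 → ℝ} (hf : SmP f) (hg : SmP g) (k : Freq) :
    rc (fun x => f x + g x) k = rc f k + rc g k := by
  simp only [rc, Complex.ofReal_add]
  exact fc_add hf.ofReal hg.ofReal k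

lemma rc_neg (f : Vec 2 → ℝ) (k : Freq) : rc f (-k) = (starRingEnd ℂ) (rc f k) := by
  rw [rc, rc, fc, fc, ← integral_conj]
  simp only [map_mul, Complex.conj_ofReal, ← expo_neg]

lemma herm_rc {f : Vec 2 → ℝ} (hf : SmP f) : Herm (rc f) := ⟨summable_fc hf.ofReal, rc_neg f⟩

lemma synth_rc {f : Vec 2 → ℝ} (hf : SmP f) (x : Vec 2) : synth (rc f) x = f x := by
  have h := Complex.hasSum_re (hasSum_fourier hf.ofReal x)
  exact h.tsum_eq

lemma synth_add {c d : Freq → ℂ} (hc : Herm c) (hd : Herm d) (x : Vec 2) :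
    synth (fun k => c k + d k) x = synth c x + synth d x := by
  have h1 : Summable fun k => (c k * expo k x).re :=
    hc.summable.of_norm_bounded fun k => abs_re_le c k x
  have h2 : Summable fun k => (d k * expo k x).re :=
    hd.summable.of_norm_bounded fun k => abs_re_le d k x
  rw [synth, synth, synth, ← h1.tsum_add h2]
  simp only [add_mul, Complex.add_re]

lemma freq_sq_ne_zero {k : Freq} (hk : k ≠ 0) : (k 0 : ℝ) ^ 2 + (k 1 : ℝ) ^ 2 ≠ 0 := fun h => hk (by
  ext i; fin_cases i
  · have : (k 0 : ℝ) ^ 2 = 0 := by nlinarith [sq_nonneg (k 0 : ℝ), sq_nonneg (k 1 : ℝ)]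
    simpa using this
  · have : (k 1 : ℝ) ^ 2 = 0 := by nlinarith [sq_nonneg (k 0 : ℝ), sq_nonneg (k 1 : ℝ)]
    simpa using this)

/-- Calderón–Zygmund estimate for `Δφ = div G` in even Lebesgue exponents. -/
lemma calderon_zygmund (n : ℕ) : ∃ C : ℝ, 0 ≤ C ∧ ∀ φ G₀ G₁ : Vec 2 → ℝ, SmP φ → SmP G₀ → SmP G₁ →
    (∀ x, pdir 0 (pdir 0 φ) x + pdir 1 (pdir 1 φ) x = pdir 0 G₀ x + pdir 1 G₁ x) → ∀ i,
    ∫ x in box 2, pdir i φ x ^ (2 * n)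
      ≤ C * ((∫ x in box 2, G₀ x ^ (2 * n)) + ∫ x in box 2, G₁ x ^ (2 * n)) := by
  obtain ⟨C, hC, hb⟩ := riesz_bound n
  refine ⟨2 ^ (2 * n) * C, by positivity, fun φ G₀ G₁ hφ h0 h1 he i => ?_⟩
  have m0 := herm_mul (herm_rc h0) (abs_rieszSym_le i 0) (rieszSym_neg i 0)
  have m1 := herm_mul (herm_rc h1) (abs_rieszSym_le i 1) (rieszSym_neg i 1)
  have e : ∀ x, pdir i φ x = synth (fun k => (rieszSym i 0 k : ℂ) * rc G₀ k) x
      + synth (fun k => (rieszSym i 1 k : ℂ) * rc G₁ k) x := by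
    intro x
    rw [← synth_rc (hφ.pdir i) x, ← synth_add m0 m1]
    congr 1; ext k
    rw [rc_pdir hφ]
    by_cases hk : k = 0
    · subst hk; simp [rieszSym]
    · have hq := congrArg (fun f => rc f k) (funext he)
      simp only [rc_add ((hφ.pdir 0).pdir 0) ((hφ.pdir 1).pdir 1), rc_add (h0.pdir 0) (h1.pdir 1),
        rc_pdir (hφ.pdir 0), rc_pdir (hφ.pdir 1), rc_pdir hφ, rc_pdir h0, rc_pdir h1] at hq
      have hk2 : ((k 0 : ℂ) ^ 2 + (k 1 : ℂ) ^ 2) ≠ 0 := by exact_mod_cast freq_sq_ne_zero hk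
      rw [rieszSym, rieszSym]
      push_cast
      have hpi : (2 * π * Complex.I : ℂ) ≠ 0 := by simp [pi_ne_zero]
      rw [div_mul_eq_mul_div, div_mul_eq_mul_div, ← add_div, eq_div_iff hk2]
      apply mul_left_cancel₀ hpi
      linear_combination (k i : ℂ) * hq
  have c0 := continuous_synth m0
  have c1 := continuous_synth m1
  have i0 : IntegrableOn (fun x => synth (fun k => (rieszSym i 0 k : ℂ) * rc G₀ k) x ^ (2 * n))
    (box 2) := integrable_box (c0.pow (2 * n))
  have i1 : IntegrableOn (fun x => synth (fun k => (rieszSym i 1 k : ℂ) * rc G₁ k) x ^ (2 * n))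
    (box 2) := integrable_box (c1.pow (2 * n))
  have hle : ∫ x in box 2, pdir i φ x ^ (2 * n) ≤ ∫ x in box 2,
      2 ^ (2 * n) * (synth (fun k => (rieszSym i 0 k : ℂ) * rc G₀ k) x ^ (2 * n)
        + synth (fun k => (rieszSym i 1 k : ℂ) * rc G₁ k) x ^ (2 * n)) := by
    refine integral_mono (integrable_box ((hφ.pdir i).cont.pow _)) ((i0.add i1).const_mul _)
      fun x => ?_
    simp only [e]
    have := sub_even_pow_le (synth (fun k => (rieszSym i 0 k : ℂ) * rc G₀ k) x)
      (-synth (fun k => (rieszSym i 1 k : ℂ) * rc G₁ k) x) n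
    rwa [sub_neg_eq_add, (even_two_mul n).neg_pow] at this
  refine hle.trans ?_
  rw [integral_const_mul, integral_add i0 i1, mul_assoc]
  refine mul_le_mul_of_nonneg_left ?_ (by positivity)
  rw [mul_add]
  have a0 := hb i 0 _ (herm_rc h0)
  have a1 := hb i 1 _ (herm_rc h1)
  simp only [synth_rc h0] at a0
  simp only [synth_rc h1] at a1
  exact add_le_add a0 a1

lemma fc_mul_expo (g : Vec 2 → ℂ) (k l : Freq) :
    ∫ x in box 2, g x * expo l x * expo k x = fc g (-(k + l)) := by
  simp only [fc, neg_neg, expo_add]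
  congr 1; ext x; ring

lemma parseval {f : Vec 2 → ℝ} (hf : SmP f) :
    HasSum (fun k => ‖rc f k‖ ^ 2) (∫ x in box 2, f x ^ 2) := by
  have h := hasSum_integral_mul_expo (summable_fc hf.ofReal) hf.ofReal.cont
  have e : ∀ x, (f x : ℂ) * ∑' k, fc (fun x => (f x : ℂ)) k * expo k x = ((f x ^ 2 : ℝ) : ℂ) := by
    intro x
    rw [(hasSum_fourier hf.ofReal x).tsum_eq]; push_cast; ring
  simp only [e, integral_complex_ofReal] at h
  have e2 : ∀ k, fc (fun x => (f x : ℂ)) k * ∫ x in box 2, (f x : ℂ) * expo k x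
      = ((‖rc f k‖ ^ 2 : ℝ) : ℂ) := by
    intro k
    have : ∫ x in box 2, (f x : ℂ) * expo k x = rc f (-k) := by simp [rc, fc]
    rw [this, rc_neg]
    change rc f k * _ = _
    rw [Complex.mul_conj, Complex.normSq_eq_norm_sq]
  simp only [e2] at h
  exact_mod_cast Complex.hasSum_ofReal.1 h

lemma parseval_grad {f : Vec 2 → ℝ} (hf : SmP f) :
    HasSum (fun k => 4 * π ^ 2 * ((k 0 : ℝ) ^ 2 + (k 1 : ℝ) ^ 2) * ‖rc f k‖ ^ 2) (gradSq f) := by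
  convert (parseval (hf.pdir 0)).add (parseval (hf.pdir 1)) using 1
  · ext k
    simp only [rc_pdir hf, norm_mul, Complex.norm_I, mul_one, Complex.norm_real,
      Complex.norm_intCast, Complex.norm_ofNat, mul_pow, Real.norm_eq_abs, sq_abs]
    ring
  · rfl

/-- Poincaré inequality. -/
lemma poincare {f : Vec 2 → ℝ} (hf : SmP f) (h0 : ∫ x in box 2, f x = 0) :
    ∫ x in box 2, f x ^ 2 ≤ gradSq f := by
  refine hasSum_le (fun k => ?_) (parseval hf) (parseval_grad hf)
  by_cases hk : k = 0
  · subst hk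
    have : rc f 0 = ((∫ x in box 2, f x : ℝ) : ℂ) := by
      simp only [rc, fc, neg_zero, expo_zero, mul_one, integral_complex_ofReal]
    rw [this, h0]; simp
  · refine le_mul_of_one_le_left (by positivity) ?_
    have h1 : (1:ℝ) ≤ (k 0 : ℝ) ^ 2 + (k 1 : ℝ) ^ 2 := by
      have h2 : 0 < (k 0) ^ 2 + (k 1) ^ 2 := lt_of_le_of_ne (by positivity) fun h =>
        freq_sq_ne_zero hk (by exact_mod_cast h.symm)
      exact_mod_cast h2
    nlinarith [pi_gt_three]

section

open scoped ENNReal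

/-- The maximum norm of a frequency. -/
def supFreq (k : Freq) : ℕ := max (k 0).natAbs (k 1).natAbs

lemma supFreq_neg (k : Freq) : supFreq (-k) = supFreq k := by simp [supFreq]

lemma supFreq_pos {k : Freq} (hk : k ≠ 0) : 1 ≤ supFreq k := by
  by_contra h
  apply hk
  have h1 : supFreq k = 0 := by omega
  simp only [supFreq, Nat.max_eq_zero_iff, Int.natAbs_eq_zero] at h1
  ext i; fin_cases i
  · exact h1.1
  · exact h1.2

lemma supFreq_sq_le (k : Freq) : (supFreq k : ℝ) ^ 2 ≤ (k 0 : ℝ) ^ 2 + (k 1 : ℝ) ^ 2 := by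
  have h0 : (((k 0).natAbs : ℕ) : ℝ) ^ 2 = (k 0 : ℝ) ^ 2 := by
    rw [← Int.cast_natCast, Int.natCast_natAbs]; push_cast; exact sq_abs _
  have h1 : (((k 1).natAbs : ℕ) : ℝ) ^ 2 = (k 1 : ℝ) ^ 2 := by
    rw [← Int.cast_natCast, Int.natCast_natAbs]; push_cast; exact sq_abs _
  rcases max_choice (k 0).natAbs (k 1).natAbs with h | h
  · rw [supFreq, h, h0]; nlinarith [sq_nonneg (k 1 : ℝ)]
  · rw [supFreq, h, h1]; nlinarith [sq_nonneg (k 0 : ℝ)]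

/-- The two-dimensional cross product of frequencies. -/
def crossFreq (k l : Freq) : ℤ := k 0 * l 1 - k 1 * l 0

lemma natAbs_crossFreq_le (k l : Freq) : (crossFreq k l).natAbs ≤ 2 * (supFreq k * supFreq l) := by
  calc (crossFreq k l).natAbs ≤ (k 0 * l 1).natAbs + (k 1 * l 0).natAbs := by
        unfold crossFreq; omega
    _ = (k 0).natAbs * (l 1).natAbs + (k 1).natAbs * (l 0).natAbs := by
        rw [Int.natAbs_mul, Int.natAbs_mul]
    _ ≤ supFreq k * supFreq l + supFreq k * supFreq l := by
        gcongr
        · exact le_max_left _ _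
        · exact le_max_right _ _
        · exact le_max_right _ _
        · exact le_max_left _ _
    _ = _ := by ring

lemma tsum_mul_sq_le {ι : Type*} (f g : ι → ℝ≥0∞) :
    ∑' i, f i * g i ≤ (∑' i, f i ^ (2:ℝ)) ^ (1 / 2 : ℝ) * (∑' i, g i ^ (2:ℝ)) ^ (1 / 2 : ℝ) := by
  rw [ENNReal.tsum_eq_iSup_sum]
  refine iSup_le fun s => ?_
  refine (ENNReal.inner_le_Lp_mul_Lq s f g (Real.HolderConjugate.two_two)).trans ?_
  gcongr <;> exact ENNReal.sum_le_tsum s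

lemma tsum_supFreq_le (N : ℕ) :
    ∑' k : Freq, (if supFreq k ≤ N then (1:ℝ≥0∞) else 0) = ((2 * N + 1) ^ 2 : ℕ) := by
  have hfin : ∀ k : Freq, supFreq k ≤ N ↔
      k ∈ Fintype.piFinset fun _ : Fin 2 => Finset.Icc (-(N:ℤ)) N := by
    intro k
    simp only [supFreq, max_le_iff, Fintype.mem_piFinset, Finset.mem_Icc, Fin.forall_fin_two]
    omega
  rw [tsum_eq_sum (s := Fintype.piFinset fun _ : Fin 2 => Finset.Icc (-(N:ℤ)) N)
    (fun k hk => if_neg fun h => hk ((hfin k).1 h)),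
    Finset.sum_congr rfl fun k hk => if_pos ((hfin k).2 hk)]
  simp only [Finset.sum_const, Fintype.card_piFinset_const, Int.card_Icc, nsmul_eq_mul, mul_one]
  congr 2
  omega

/-- The resonant trilinear sum. -/
def triSum (X Y Z : Freq → ℝ≥0∞) : ℝ≥0∞ :=
  ∑' p : Freq × Freq, if -(p.1 + p.2) ≠ 0 ∧ supFreq p.1 ≤ supFreq (p.1 + p.2) then
    X (-(p.1 + p.2)) * (Y p.1 * Z p.2) else 0

lemma triSum_le (X Y Z : Freq → ℝ≥0∞) :
    triSum X Y Z ≤ (∑' k, 9 * ((supFreq k : ℝ≥0∞) * X k) ^ (2:ℝ)) ^ (1 / 2 : ℝ) *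
      ((∑' k, Y k ^ (2:ℝ)) * ∑' k, Z k ^ (2:ℝ)) ^ (1 / 2 : ℝ) := by
  have h1 : triSum X Y Z = ∑' p : Freq × Freq,
      (if -(p.1 + p.2) ≠ 0 ∧ supFreq p.1 ≤ supFreq (p.1 + p.2) then X (-(p.1 + p.2)) else 0) *
        (Y p.1 * Z p.2) := by
    refine tsum_congr fun p => ?_
    split_ifs <;> simp
  rw [h1]
  refine (tsum_mul_sq_le _ _).trans ?_
  gcongr ?_ ^ _ * ?_ ^ _
  · calc _ = ∑' p : Freq × Freq, (if p.2 ≠ 0 ∧ supFreq p.1 ≤ supFreq p.2 then X p.2 else 0) ^ (2:ℝ) := by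
          let e : Freq × Freq ≃ Freq × Freq :=
            { toFun := fun p => (p.1, -(p.1 + p.2))
              invFun := fun p => (p.1, -(p.1 + p.2))
              left_inv := fun p => by ext <;> simp
              right_inv := fun p => by ext <;> simp }
          rw [← e.tsum_eq]
          refine tsum_congr fun p => ?_
          have e1 : -(p.1 + -(p.1 + p.2)) = p.2 := by abel
          have e2 : supFreq (p.1 + -(p.1 + p.2)) = supFreq p.2 := by rw [← supFreq_neg, e1]
          simp only [e, Equiv.coe_fn_mk, e1, e2]
      _ = ∑' n : Freq, ∑' l : Freq, (if n ≠ 0 ∧ supFreq l ≤ supFreq n then X n else 0) ^ (2:ℝ) := by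
          rw [ENNReal.tsum_prod', ENNReal.tsum_comm]
      _ ≤ _ := by
          refine ENNReal.tsum_le_tsum fun n => ?_
          by_cases hn : n = 0
          · simp [hn]
          · have h2 : ∀ l : Freq, (if n ≠ 0 ∧ supFreq l ≤ supFreq n then X n else 0) ^ (2:ℝ)
                = X n ^ (2:ℝ) * (if supFreq l ≤ supFreq n then 1 else 0) := by
              intro l
              by_cases hl : supFreq l ≤ supFreq n <;> simp [hn, hl]
            simp_rw [h2]
            rw [ENNReal.tsum_mul_left, tsum_supFreq_le, ENNReal.mul_rpow_of_nonneg _ _ (by norm_num),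
              ← mul_assoc, mul_comm]
            gcongr
            have h3 : (2 * supFreq n + 1) ^ 2 ≤ 9 * supFreq n ^ 2 := by
              nlinarith [supFreq_pos hn]
            calc (((2 * supFreq n + 1) ^ 2 : ℕ) : ℝ≥0∞) ≤ ((9 * supFreq n ^ 2 : ℕ) : ℝ≥0∞) := by
                  exact_mod_cast h3
              _ = 9 * (supFreq n : ℝ≥0∞) ^ (2:ℝ) := by
                  rw [ENNReal.rpow_two]; push_cast; rfl
  · rw [ENNReal.tsum_prod']
    simp_rw [ENNReal.mul_rpow_of_nonneg _ _ (show (0:ℝ) ≤ 2 by norm_num), ENNReal.tsum_mul_left,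
      ENNReal.tsum_mul_right]
    exact le_rfl

lemma cross_tsum_le (X Y Z : Freq → ℝ≥0∞) :
    ∑' p : Freq × Freq, ((crossFreq p.1 p.2).natAbs : ℝ≥0∞) * (Y p.1 * Z p.2 * X (-(p.1 + p.2)))
      ≤ 2 * triSum X (fun k => supFreq k * Y k) (fun k => supFreq k * Z k)
        + 2 * triSum Y (fun k => supFreq k * Z k) (fun k => supFreq k * X k)
        + 2 * triSum Z (fun k => supFreq k * X k) (fun k => supFreq k * Y k) := by
  let e : Freq × Freq ≃ Freq × Freq :=
    { toFun := fun p => (p.2, -(p.1 + p.2))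
      invFun := fun p => (-(p.1 + p.2), p.1)
      left_inv := fun p => by ext <;> simp
      right_inv := fun p => by ext <;> simp }
  unfold triSum
  rw [← e.tsum_eq (fun p : Freq × Freq => if -(p.1 + p.2) ≠ 0 ∧ supFreq p.1 ≤ supFreq (p.1 + p.2)
      then Y (-(p.1 + p.2)) * (supFreq p.1 * Z p.1 * (supFreq p.2 * X p.2)) else 0),
    ← e.symm.tsum_eq (fun p : Freq × Freq => if -(p.1 + p.2) ≠ 0 ∧ supFreq p.1 ≤ supFreq (p.1 + p.2)
      then Z (-(p.1 + p.2)) * (supFreq p.1 * X p.1 * (supFreq p.2 * Y p.2)) else 0),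
    ← ENNReal.tsum_mul_left, ← ENNReal.tsum_mul_left, ← ENNReal.tsum_mul_left,
    ← ENNReal.tsum_add, ← ENNReal.tsum_add]
  refine ENNReal.tsum_le_tsum fun ⟨l, m⟩ => ?_
  have e1 : -(m + -(l + m)) = l := by abel
  have e2 : -(-(l + m) + l) = m := by abel
  have e3 : supFreq (m + -(l + m)) = supFreq l := by rw [← supFreq_neg, e1]
  have e4 : supFreq (-(l + m) + l) = supFreq m := by rw [← supFreq_neg, e2]
  simp only [e, Equiv.coe_fn_mk, Equiv.coe_fn_symm_mk, e1, e2, e3, e4, supFreq_neg]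
  by_cases h0 : crossFreq l m = 0
  · simp [h0]
  have hl : l ≠ 0 := by rintro rfl; simp [crossFreq] at h0
  have hm : m ≠ 0 := by rintro rfl; simp [crossFreq] at h0
  have hn : -(l + m) ≠ 0 := by
    intro h
    have : m = -l := by rw [neg_eq_zero] at h; exact (neg_eq_of_add_eq_zero_right h).symm
    subst this
    apply h0; simp [crossFreq]; ring
  have c1 : (crossFreq l m).natAbs ≤ 2 * (supFreq l * supFreq m) := natAbs_crossFreq_le l m
  have c2 : (crossFreq l m).natAbs ≤ 2 * (supFreq m * supFreq (l + m)) := by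
    have := natAbs_crossFreq_le m (-(l + m))
    rw [supFreq_neg] at this
    convert this using 2
    simp [crossFreq]; ring
  have c3 : (crossFreq l m).natAbs ≤ 2 * (supFreq (l + m) * supFreq l) := by
    have := natAbs_crossFreq_le (-(l + m)) l
    rw [supFreq_neg] at this
    convert this using 2
    simp [crossFreq]; ring
  have k1 : ((crossFreq l m).natAbs : ℝ≥0∞) ≤ 2 * (supFreq l * supFreq m) := by exact_mod_cast c1
  have k2 : ((crossFreq l m).natAbs : ℝ≥0∞) ≤ 2 * (supFreq m * supFreq (l + m)) := by
    exact_mod_cast c2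
  have k3 : ((crossFreq l m).natAbs : ℝ≥0∞) ≤ 2 * (supFreq (l + m) * supFreq l) := by
    exact_mod_cast c3
  by_cases g1 : supFreq l ≤ supFreq (l + m)
  · rw [if_pos ⟨hn, g1⟩]
    refine le_trans ?_ (le_add_right le_self_add)
    refine (mul_le_mul_left k1 _).trans (le_of_eq ?_)
    ring
  · by_cases g2 : supFreq m ≤ supFreq l
    · rw [if_pos (show l ≠ 0 ∧ supFreq m ≤ supFreq l from ⟨hl, g2⟩)]
      refine le_trans ?_ (le_add_right le_add_self)
      refine (mul_le_mul_left k2 _).trans (le_of_eq ?_)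
      ring
    · rw [if_pos (show m ≠ 0 ∧ supFreq (l + m) ≤ supFreq m from ⟨hm, by omega⟩)]
      refine le_trans ?_ le_add_self
      refine (mul_le_mul_left k3 _).trans (le_of_eq ?_)
      ring

lemma triSum_mul_le (X Y Z : Freq → ℝ≥0∞) :
    triSum X (fun k => supFreq k * Y k) (fun k => supFreq k * Z k) ≤
      3 * ((∑' k, ((supFreq k : ℝ≥0∞) * X k) ^ (2:ℝ)) ^ (1 / 2 : ℝ) *
        (∑' k, ((supFreq k : ℝ≥0∞) * Y k) ^ (2:ℝ)) ^ (1 / 2 : ℝ) *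
        (∑' k, ((supFreq k : ℝ≥0∞) * Z k) ^ (2:ℝ)) ^ (1 / 2 : ℝ)) := by
  refine (triSum_le _ _ _).trans (le_of_eq ?_)
  have h9 : (9:ℝ≥0∞) ^ (1 / 2 : ℝ) = 3 := by
    rw [show (9:ℝ≥0∞) = 3 ^ (2:ℝ) by rw [ENNReal.rpow_two]; norm_num, ← ENNReal.rpow_mul]
    norm_num
  rw [ENNReal.tsum_mul_left, ENNReal.mul_rpow_of_nonneg _ _ (by norm_num),
    ENNReal.mul_rpow_of_nonneg _ _ (by norm_num), h9]
  ring

lemma tsum_enorm_rc_le {f : Vec 2 → ℝ} (hf : SmP f) :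
    (∑' k, ((supFreq k : ℝ≥0∞) * ‖rc f k‖ₑ) ^ (2:ℝ)) ^ (1 / 2 : ℝ) ≤
      ENNReal.ofReal (√(gradSq f)) := by
  have h := parseval_grad hf
  rw [Real.sqrt_eq_rpow, ← ENNReal.ofReal_rpow_of_nonneg (gradSq_nonneg f) (by norm_num), ← h.tsum_eq,
    ENNReal.ofReal_tsum_of_nonneg (fun k => by positivity) h.summable]
  gcongr with k
  rw [ENNReal.rpow_two, ← ofReal_norm, ← ENNReal.ofReal_natCast,
    ← ENNReal.ofReal_mul (by positivity), ← ENNReal.ofReal_pow (by positivity), mul_pow]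
  refine ENNReal.ofReal_le_ofReal (mul_le_mul_of_nonneg_right ?_ (by positivity))
  refine (supFreq_sq_le k).trans (le_mul_of_one_le_left (by positivity) ?_)
  nlinarith [pi_gt_three]

lemma hasSum_trilinear {P g h : Vec 2 → ℝ} (hP : SmP P) (hg : SmP g) (hh : SmP h) (i j : Fin 2) :
    HasSum (fun l : Freq => rc (pdir i g) l * ∑' m : Freq, rc (pdir j h) m * rc P (-(l + m)))
      (∫ x in box 2, (((P x * (pdir i g x * pdir j h x) : ℝ)) : ℂ)) ∧
    ∀ l, Summable fun m : Freq => rc (pdir j h) m * rc P (-(l + m)) := by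
  have e : ∀ {f : Vec 2 → ℝ}, SmP f → ∀ x, ∑' k, rc f k * expo k x = (f x : ℂ) :=
    fun hf x => (hasSum_fourier hf.ofReal x).tsum_eq
  have h2 : ∀ l, HasSum (fun m => rc (pdir j h) m * rc P (-(l + m)))
      (∫ x in box 2, (P x : ℂ) * pdir j h x * expo l x) := by
    intro l
    have := hasSum_integral_mul_expo (summable_fc (hh.pdir j).ofReal)
      (hP.ofReal.mulC (smP_expo l)).cont
    convert this using 1
    · ext m
      congr 1
      have := fc_mul_expo (fun x => (P x : ℂ) * expo l x) (-m) 0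
      simp only [rc, fc, neg_neg, mul_assoc, ← expo_add]
    · refine integral_congr_ae (ae_of_all _ fun x => ?_)
      simp only
      have := e (hh.pdir j) x
      simp only [rc] at this
      rw [this]; ring
  refine ⟨?_, fun l => (h2 l).summable⟩
  have := hasSum_integral_mul_expo (summable_fc (hg.pdir i).ofReal)
    (hP.ofReal.mulC (hh.pdir j).ofReal).cont
  convert this using 1
  · ext l
    rw [(h2 l).tsum_eq]; rfl
  · refine integral_congr_ae (ae_of_all _ fun x => ?_)
    simp only
    have := e (hg.pdir i) x
    simp only [rc] at this
    rw [this]; push_cast; ring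

/-- A Wente-type inequality: integration of a Jacobian against a function in `H¹`. -/
lemma wente : ∃ C : ℝ, 0 ≤ C ∧ ∀ P g h : Vec 2 → ℝ, SmP P → SmP g → SmP h →
    |∫ x in box 2, P x * (pdir 0 g x * pdir 1 h x - pdir 1 g x * pdir 0 h x)| ≤
      C * (√(gradSq P) * √(gradSq g) * √(gradSq h)) := by
  refine ⟨4 * π ^ 2 * 18, by positivity, fun P g h hP hg hh => ?_⟩
  obtain ⟨a1, s1⟩ := hasSum_trilinear hP hg hh 0 1
  obtain ⟨a2, s2⟩ := hasSum_trilinear hP hg hh 1 0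
  set α : Freq → ℝ≥0∞ := fun k => ‖rc P k‖ₑ
  set β : Freq → ℝ≥0∞ := fun k => ‖rc g k‖ₑ
  set δ : Freq → ℝ≥0∞ := fun k => ‖rc h k‖ₑ
  have key : ‖∫ x in box 2, P x * (pdir 0 g x * pdir 1 h x - pdir 1 g x * pdir 0 h x)‖ₑ ≤
      ENNReal.ofReal (4 * π ^ 2) * ∑' p : Freq × Freq,
        ((crossFreq p.1 p.2).natAbs : ℝ≥0∞) * (β p.1 * δ p.2 * α (-(p.1 + p.2))) := by
    have e0 : ‖∫ x in box 2, P x * (pdir 0 g x * pdir 1 h x - pdir 1 g x * pdir 0 h x)‖ₑ =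
        ‖∑' l : Freq, (rc (pdir 0 g) l * ∑' m : Freq, rc (pdir 1 h) m * rc P (-(l + m)) -
          rc (pdir 1 g) l * ∑' m : Freq, rc (pdir 0 h) m * rc P (-(l + m)))‖ₑ := by
      rw [(a1.sub a2).tsum_eq, integral_complex_ofReal, integral_complex_ofReal,
        ← Complex.ofReal_sub, ← integral_sub
          (hP.mul ((hg.pdir 0).mul (hh.pdir 1))).integrable
          (hP.mul ((hg.pdir 1).mul (hh.pdir 0))).integrable, ← ofReal_norm,
        ← ofReal_norm, Complex.norm_real]
      simp only [mul_sub]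
    rw [e0, ENNReal.tsum_prod', ← ENNReal.tsum_mul_left]
    refine (enorm_tsum_le_tsum_enorm).trans (ENNReal.tsum_le_tsum fun l => ?_)
    rw [← tsum_mul_left, ← tsum_mul_left, ← ((s1 l).mul_left _).tsum_sub ((s2 l).mul_left _),
      ← ENNReal.tsum_mul_left]
    refine (enorm_tsum_le_tsum_enorm).trans (ENNReal.tsum_le_tsum fun m => le_of_eq ?_)
    have : rc (pdir 0 g) l * (rc (pdir 1 h) m * rc P (-(l + m))) -
        rc (pdir 1 g) l * (rc (pdir 0 h) m * rc P (-(l + m))) =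
        ((-(4 * π ^ 2 * (crossFreq l m : ℝ)) : ℝ) : ℂ) * (rc g l * rc h m * rc P (-(l + m))) := by
      simp only [rc_pdir hg, rc_pdir hh, crossFreq]
      push_cast
      linear_combination (4 * (π:ℂ) ^ 2 * (l 0 * m 1 - l 1 * m 0) * rc g l * rc h m *
        rc P (-(l + m))) * Complex.I_sq
    rw [this, enorm_mul, enorm_mul, enorm_mul, ← ofReal_norm, Complex.norm_real, norm_neg,
      norm_mul, ENNReal.ofReal_mul (norm_nonneg _), Real.norm_of_nonneg (by positivity : 0 ≤ 4 * π ^ 2),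
      mul_assoc]
    congr 2
    rw [Real.norm_eq_abs, ← Int.cast_abs, Int.abs_eq_natAbs, Int.cast_natCast, ENNReal.ofReal_natCast]
  have hα := tsum_enorm_rc_le hP
  have hβ := tsum_enorm_rc_le hg
  have hδ := tsum_enorm_rc_le hh
  have fin : ‖∫ x in box 2, P x * (pdir 0 g x * pdir 1 h x - pdir 1 g x * pdir 0 h x)‖ₑ ≤
      ENNReal.ofReal (4 * π ^ 2 * 18 * (√(gradSq P) * √(gradSq g) * √(gradSq h))) := by
    refine key.trans ?_
    have e0 : ENNReal.ofReal (4 * π ^ 2 * 18 * (√(gradSq P) * √(gradSq g) * √(gradSq h))) =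
        ENNReal.ofReal (4 * π ^ 2) * (18 * (ENNReal.ofReal √(gradSq P) *
          ENNReal.ofReal √(gradSq g) * ENNReal.ofReal √(gradSq h))) := by
      rw [← ENNReal.ofReal_mul (by positivity), ← ENNReal.ofReal_mul (by positivity),
        ← ENNReal.ofReal_ofNat, ← ENNReal.ofReal_mul (by norm_num),
        ← ENNReal.ofReal_mul (by positivity), mul_assoc]
    rw [e0]
    gcongr
    refine (cross_tsum_le α β δ).trans ?_
    have t1 := (triSum_mul_le α β δ).trans (mul_le_mul_right (mul_le_mul' (mul_le_mul' hα hβ) hδ) 3)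
    have t2 := (triSum_mul_le β δ α).trans (mul_le_mul_right (mul_le_mul' (mul_le_mul' hβ hδ) hα) 3)
    have t3 := (triSum_mul_le δ α β).trans (mul_le_mul_right (mul_le_mul' (mul_le_mul' hδ hα) hβ) 3)
    refine (add_le_add (add_le_add (mul_le_mul_right t1 2) (mul_le_mul_right t2 2))
      (mul_le_mul_right t3 2)).trans (le_of_eq ?_)
    ring
  rw [← ofReal_norm] at fin
  exact (ENNReal.ofReal_le_ofReal_iff (by positivity)).1 fin

end

lemma morrey_at_zero {f : Vec 2 → ℝ} (hf : SmP f) {n : ℕ} (hn : 2 ≤ n)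
    {h : ℝ} (h0 : 0 < h) (h1 : h ≤ 1) :
    |f 0| ≤ h⁻¹ * √(∫ x in box 2, f x ^ 2) + 2 * h ^ (1 - 1 / n : ℝ) *
      ((∫ x in box 2, pdir 0 f x ^ (2 * n)) ^ (1 / (2 * n) : ℝ) + (∫ x in box 2, pdir 1 f x ^ (2 * n)) ^ (1 / (2 * n) : ℝ)) := by
  set Q := (∫ x in box 2, pdir 0 f x ^ (2 * n)) ^ (1 / (2 * n) : ℝ) + (∫ x in box 2, pdir 1 f x ^ (2 * n)) ^ (1 / (2 * n) : ℝ) with hQ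
  have hn0 : (0:ℝ) < n := by exact_mod_cast (by omega : 0 < n)
  have hn2 : (2:ℝ) ≤ n := by exact_mod_cast hn
  have hQ0 : 0 ≤ Q := add_nonneg (Real.rpow_nonneg (integral_even_pow_nonneg _ _) _)
    (Real.rpow_nonneg (integral_even_pow_nonneg _ _) _)
  have hcd : ContDiff ℝ 1 f := hf.smooth.of_le (by exact_mod_cast le_top)
  have hG : ContDiff ℝ 1 fun q : ℝ × Vec 2 => f ((q.1 ^ 2 * h) • q.2) :=
    hcd.comp (((contDiff_fst.pow 2).mul contDiff_const).smul contDiff_snd)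
  have hd := hasDerivAt_integral_box hG
  have e : ∀ t x, fderiv ℝ (fun q : ℝ × Vec 2 => f ((q.1 ^ 2 * h) • q.2)) (t, x) (1, 0)
      = 2 * t * h * (x 0 * pdir 0 f ((t ^ 2 * h) • x) + x 1 * pdir 1 f ((t ^ 2 * h) • x)) := by
    intro t x
    have e1 : HasDerivAt (fun s : ℝ => (s ^ 2 * h) • x) ((2 * t * h) • x) t := by
      have := (((hasDerivAt_id' t).pow 2).mul_const h).smul_const x
      simpa using this
    have e2 := (hf.diff ((t ^ 2 * h) • x)).hasFDerivAt.comp_hasDerivAt t e1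
    have e3 : HasDerivAt (fun s : ℝ => (s, x)) ((1 : ℝ), (0 : Vec 2)) t :=
      (hasDerivAt_id t).prodMk (hasDerivAt_const t x)
    have e4 := (hG.differentiable one_ne_zero (t, x)).hasFDerivAt.comp_hasDerivAt t e3
    rw [← e4.deriv]
    have e5 : x = x 0 • Pi.single 0 1 + x 1 • Pi.single 1 1 := by
      ext i; fin_cases i <;> simp
    have e6 := e2.deriv
    simp only [Function.comp_def] at e6 ⊢
    rw [e6, map_smul]
    conv_lhs => rw [e5]
    simp only [map_add, map_smul, smul_eq_mul, pdir]
    rw [← e5]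
  have bd : ∀ g : Vec 2 → ℝ, Continuous g → ∀ a, 0 < a → a ≤ 1 →
      ∫ z in box 2, |g (a • z)| ≤ (a ^ (1 / n : ℝ))⁻¹ *
        (∫ z in box 2, g z ^ (2 * n)) ^ (1 / (2 * n) : ℝ) := by
    intro g hg a ha ha1
    have hga : Continuous fun z => |g (a • z)| := by fun_prop
    have s1 := integral_pow_le_even hga n
    have s2 := integral_box_comp_smul_le (φ := fun z => g z ^ (2 * n)) (hg.pow _)
      (fun x => by rw [pow_mul]; positivity) ha ha1
    simp only [pow_mul, sq_abs] at s1 s2 ⊢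
    have s3 := s1.trans s2
    have hI : 0 ≤ ∫ z in box 2, |g (a • z)| := integral_nonneg fun _ => abs_nonneg _
    have hJ : 0 ≤ ∫ z in box 2, (g z ^ 2) ^ n := integral_nonneg fun _ => by positivity
    have s4 := Real.rpow_le_rpow (by positivity) s3 (by positivity : (0:ℝ) ≤ 1 / (2 * n))
    rw [← pow_mul, ← Real.rpow_natCast, ← Real.rpow_mul hI,
      Real.mul_rpow (by positivity) hJ] at s4
    have e1 : (((2 * n : ℕ) : ℝ)) * (1 / (2 * n)) = 1 := by push_cast; field_simp
    have e2 : ((a ^ 2)⁻¹) ^ (1 / (2 * n) : ℝ) = (a ^ (1 / n : ℝ))⁻¹ := by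
      rw [Real.inv_rpow (by positivity), ← Real.rpow_natCast, ← Real.rpow_mul ha.le]
      congr 2; push_cast; field_simp
    rwa [e1, Real.rpow_one, e2] at s4
  have bound : ∀ t ∈ Ico (0:ℝ) 1, ‖∫ x in box 2,
      fderiv ℝ (fun q : ℝ × Vec 2 => f ((q.1 ^ 2 * h) • q.2)) (t, x) (1, 0)‖ ≤ 2 * h ^ (1 - 1 / n : ℝ) * Q := by
    intro t ht
    simp only [e]
    rcases ht.1.eq_or_lt with rfl | ht0
    · simp; positivity
    have ha : 0 < t ^ 2 * h := by positivity
    have ha1 : t ^ 2 * h ≤ 1 := by nlinarith [ht.2]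
    have c0 := (hf.pdir 0).cont
    have c1 := (hf.pdir 1).cont
    have c0' : Continuous fun x : Vec 2 => |pdir 0 f ((t ^ 2 * h) • x)| := by fun_prop
    have c1' : Continuous fun x : Vec 2 => |pdir 1 f ((t ^ 2 * h) • x)| := by fun_prop
    rw [integral_const_mul, norm_mul]
    have : ‖∫ x in box 2, (x 0 * pdir 0 f ((t ^ 2 * h) • x) + x 1 * pdir 1 f ((t ^ 2 * h) • x))‖
        ≤ ((t ^ 2 * h) ^ (1 / n : ℝ))⁻¹ * Q := by
      refine (norm_integral_le_integral_norm _).trans ?_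
      rw [hQ, mul_add]
      refine le_trans ?_ (add_le_add (bd _ c0 _ ha ha1) (bd _ c1 _ ha ha1))
      rw [← integral_add (integrable_box c0') (integrable_box c1')]
      refine setIntegral_mono_on (integrable_box (by fun_prop))
        (integrable_box (c0'.add c1')) measurableSet_box fun x hx => ?_
      have x0 := hx 0 (mem_univ _)
      have x1 := hx 1 (mem_univ _)
      refine (norm_add_le _ _).trans (add_le_add ?_ ?_)
      · rw [norm_mul, Real.norm_of_nonneg x0.1.le]
        exact mul_le_of_le_one_left (norm_nonneg _) x0.2.le
      · rw [norm_mul, Real.norm_of_nonneg x1.1.le]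
        exact mul_le_of_le_one_left (norm_nonneg _) x1.2.le
    refine (mul_le_mul_of_nonneg_left this (norm_nonneg _)).trans ?_
    rw [Real.norm_of_nonneg (by positivity), ← mul_assoc]
    refine mul_le_mul_of_nonneg_right ?_ hQ0
    have e1 : ((t ^ 2 * h) ^ (1 / n : ℝ))⁻¹ = t ^ (-(2 / n) : ℝ) * h ^ (-(1 / n) : ℝ) := by
      rw [← Real.rpow_neg ha.le, Real.mul_rpow (by positivity) h0.le, ← Real.rpow_natCast,
        ← Real.rpow_mul ht0.le]
      congr 2; push_cast; ring
    have e2 : t * t ^ (-(2 / n) : ℝ) ≤ 1 := by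
      nth_rw 1 [← Real.rpow_one t]
      rw [← Real.rpow_add ht0]
      refine Real.rpow_le_one ht0.le ht.2.le ?_
      have : (2:ℝ) / n ≤ 1 := (div_le_one hn0).2 hn2
      linarith
    have e3 : h * h ^ (-(1 / n) : ℝ) = h ^ (1 - 1 / n : ℝ) := by
      rw [sub_eq_add_neg, Real.rpow_add h0, Real.rpow_one]
    rw [e1, ← e3]
    have hh : 0 ≤ h * h ^ (-(1 / n) : ℝ) := by positivity
    nlinarith [mul_le_mul_of_nonneg_right e2 hh]
  have := norm_image_sub_le_of_norm_deriv_le_segment_01' (f := fun s => ∫ x in box 2,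
    f ((s ^ 2 * h) • x)) (fun t _ => (hd t).hasDerivWithinAt) bound
  simp only [one_pow, one_mul, ne_eq, OfNat.ofNat_ne_zero, not_false_eq_true, zero_pow, zero_mul,
    zero_smul, integral_const, MeasurableSet.univ, univ_inter,
    smul_eq_mul, measureReal_def, volume_box, ENNReal.toReal_one, Measure.restrict_apply] at this
  have hA : |∫ x in box 2, f (h • x)| ≤ h⁻¹ * √(∫ x in box 2, f x ^ 2) := by
    have cf := hf.cont
    have hga : Continuous fun z => f (h • z) := by fun_prop
    refine (abs_integral_le_integral_abs).trans ((integral_abs_le_sqrt hga).trans ?_)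
    have s2 := integral_box_comp_smul_le (φ := fun z => f z ^ 2) (hf.cont.pow 2)
      (fun x => by positivity) h0 h1
    refine (Real.sqrt_le_sqrt s2).trans (le_of_eq ?_)
    rw [Real.sqrt_mul (by positivity), Real.sqrt_inv, Real.sqrt_sq h0.le]
  rw [Real.norm_eq_abs, abs_sub_comm] at this
  have t3 := abs_sub_abs_le_abs_sub (f 0) (∫ x in box 2, f (h • x))
  linarith

/-- Morrey's inequality at scale `h` on the torus. -/
lemma morrey {f : Vec 2 → ℝ} (hf : SmP f) {n : ℕ} (hn : 2 ≤ n)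
    {h : ℝ} (h0 : 0 < h) (h1 : h ≤ 1) (x : Vec 2) :
    |f x| ≤ h⁻¹ * √(∫ x in box 2, f x ^ 2) + 2 * h ^ (1 - 1 / n : ℝ) *
      ((∫ x in box 2, pdir 0 f x ^ (2 * n)) ^ (1 / (2 * n) : ℝ) + (∫ x in box 2, pdir 1 f x ^ (2 * n)) ^ (1 / (2 * n) : ℝ)) := by
  have hs : SmP fun y => f (y + x) := ⟨hf.smooth.comp (contDiff_id.add contDiff_const),
    fun y k => by
      have := hf.per (y + x) k
      rwa [add_right_comm] at this⟩
  have hp : ∀ j y, pdir j (fun y => f (y + x)) y = pdir j f (y + x) := fun j y => by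
    simp only [pdir, fderiv_comp_add_right]
  have := morrey_at_zero hs hn h0 h1
  simp only [hp, zero_add] at this
  rwa [integral_box_add_real (f := fun y => f y ^ 2) (hf.pow 2).per,
    integral_box_add_real (f := fun y => pdir 0 f y ^ (2 * n)) ((hf.pdir 0).pow (2 * n)).per,
    integral_box_add_real (f := fun y => pdir 1 f y ^ (2 * n)) ((hf.pdir 1).pow (2 * n)).per] at this

/-- The algebra of smooth space-periodic functions of time and space. -/
def SPS : Subalgebra ℝ (ℝ × Vec 2 → ℝ) where
  carrier := {f | ContDiff ℝ (⊤ : ℕ∞) f ∧ ∀ t, Per fun x => f (t, x)}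
  mul_mem' hf hg := ⟨hf.1.mul hg.1, fun t x k => by
    have := hf.2 t x k; have := hg.2 t x k; simp_all⟩
  add_mem' hf hg := ⟨hf.1.add hg.1, fun t x k => by
    have := hf.2 t x k; have := hg.2 t x k; simp_all⟩
  algebraMap_mem' c := ⟨contDiff_const, fun _ _ _ => rfl⟩

/-- Smooth space-periodic functions of time and space. -/
abbrev SP := ↥SPS

/-- Evaluation at a point of space-time. -/
def ev (t : ℝ) (x : Vec 2) : SP →ₐ[ℝ] ℝ := (Pi.evalAlgHom ℝ _ (t, x)).comp SPS.val


lemma SP.ext_ev {f g : SP} (h : ∀ t x, ev t x f = ev t x g) : f = g :=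
  Subtype.ext (funext fun q => h q.1 q.2)

lemma SP.differentiable (f : SP) : Differentiable ℝ f.1 := f.2.1.differentiable (by simp)

lemma SP.smP (f : SP) (t : ℝ) : SmP fun x => ev t x f :=
  ⟨f.2.1.comp (contDiff_const.prodMk contDiff_id), f.2.2 t⟩

/-- Directional derivative in space-time. -/
def dirD (v : ℝ × Vec 2) (f : SP) : SP :=
  ⟨fun q => fderiv ℝ f.1 q v, (f.2.1.fderiv_right (m := (⊤ : ℕ∞)) (by simp)).clm_apply contDiff_const,
    fun t x k => by
      have h : (fun q => f.1 (q + ((0 : ℝ), fun i => (k i : ℝ)))) = f.1 := funext fun q => by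
        have := f.2.2 q.1 q.2 k
        simpa [Prod.add_def] using this
      have h2 := fderiv_comp_add_right (𝕜 := ℝ) (f := f.1) (x := (t, x)) ((0 : ℝ), fun i => (k i : ℝ))
      rw [h] at h2
      simp only [h2, Prod.mk_add_mk, add_zero]⟩

lemma ev_dirD (v : ℝ × Vec 2) (f : SP) (t : ℝ) (x : Vec 2) :
    ev t x (dirD v f) = fderiv ℝ f.1 (t, x) v := rfl

/-- The directional derivative as a derivation. -/
def dd (v : ℝ × Vec 2) : Derivation ℝ SP SP :=
  Derivation.mk'
    { toFun := dirD v
      map_add' := fun f g => SP.ext_ev fun t x => by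
        rw [map_add, ev_dirD, ev_dirD, ev_dirD, Subalgebra.coe_add,
          fderiv_add (f.differentiable _) (g.differentiable _), add_apply]
      map_smul' := fun c f => SP.ext_ev fun t x => by
        rw [RingHom.id_apply, map_smul, ev_dirD, ev_dirD, Subalgebra.coe_smul,
          fderiv_const_smul (f.differentiable _)]; rfl }
    fun f g => SP.ext_ev fun t x => by
      simp only [LinearMap.coe_mk, AddHom.coe_mk, smul_eq_mul, map_add, map_mul, ev_dirD]
      rw [Subalgebra.coe_mul, fderiv_mul (f.differentiable _) (g.differentiable _)]
      rfl

lemma ev_dd (v : ℝ × Vec 2) (f : SP) (t : ℝ) (x : Vec 2) :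
    ev t x (dd v f) = fderiv ℝ f.1 (t, x) v := rfl

lemma dd_comm (v w : ℝ × Vec 2) (f : SP) : dd v (dd w f) = dd w (dd v f) := by
  refine SP.ext_ev fun t x => ?_
  have hd : Differentiable ℝ (fderiv ℝ f.1) :=
    (f.2.1.fderiv_right (m := (⊤ : ℕ∞)) (by simp)).differentiable (by simp)
  have e : ∀ v w : ℝ × Vec 2, ev t x (dd v (dd w f)) = fderiv ℝ (fderiv ℝ f.1) (t, x) v w := by
    intro v w
    have h := ((hd (t, x)).hasFDerivAt.clm_apply (hasFDerivAt_const w (t, x))).fderiv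
    rw [ev_dd]
    change fderiv ℝ (fun q => fderiv ℝ f.1 q w) (t, x) v = _
    rw [h]; simp
  have hs : IsSymmSndFDerivAt ℝ f.1 (t, x) :=
    f.2.1.contDiffAt.isSymmSndFDerivAt (by
      rw [minSmoothness_of_isRCLikeNormedField]; exact WithTop.coe_le_coe.2 le_top)
  rw [e, e, hs]

/-- Time derivative. -/
abbrev dt : Derivation ℝ SP SP := dd (1, 0)

/-- Space derivative. -/
abbrev dx (j : Fin 2) : Derivation ℝ SP SP := dd (0, Pi.single j 1)

lemma dt_dx (j : Fin 2) (f : SP) : dt (dx j f) = dx j (dt f) := dd_comm _ _ _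

lemma dx_one_zero (f : SP) : dx 1 (dx 0 f) = dx 0 (dx 1 f) := dd_comm _ _ _

lemma dd_mul (v : ℝ × Vec 2) (f g : SP) : dd v (f * g) = f * dd v g + g * dd v f := by
  rw [Derivation.leibniz, smul_eq_mul, smul_eq_mul]

lemma pdir_ev (j : Fin 2) (f : SP) (t : ℝ) : pdir j (fun x => ev t x f) = fun x => ev t x (dx j f) := by
  ext x
  have h := (f.differentiable (t, x)).hasFDerivAt.comp x ((hasFDerivAt_const t x).prodMk
    (hasFDerivAt_id x))
  rw [pdir, ev_dd]
  have h2 := h.fderiv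
  simp only [Function.comp_def] at h2
  change fderiv ℝ (fun x => f.1 (t, x)) x _ = _
  rw [h2]; simp

/-- Spatial integral at time `t`. -/
def I (t : ℝ) : SP →ₗ[ℝ] ℝ where
  toFun f := ∫ x in box 2, ev t x f
  map_add' f g := by
    simp only [map_add]; exact integral_add (f.smP t).integrable (g.smP t).integrable
  map_smul' c f := by
    simp only [map_smul, smul_eq_mul, integral_const_mul, RingHom.id_apply]

lemma I_def (t : ℝ) (f : SP) : I t f = ∫ x in box 2, ev t x f := rfl

lemma I_dx (t : ℝ) (j : Fin 2) (f : SP) : I t (dx j f) = 0 := by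
  rw [I_def, ← pdir_ev]; exact (f.smP t).integral_pdir j

lemma hasDerivAt_I (f : SP) (t : ℝ) : HasDerivAt (fun s => I s f) (I t (dt f)) t :=
  hasDerivAt_integral_box (f.2.1.of_le (by exact_mod_cast le_top)) t

lemma I_mono {t : ℝ} {f g : SP} (h : ∀ x, ev t x f ≤ ev t x g) : I t f ≤ I t g :=
  setIntegral_mono (f.smP t).integrable (g.smP t).integrable h

lemma I_nonneg {t : ℝ} {f : SP} (h : ∀ x, 0 ≤ ev t x f) : 0 ≤ I t f := integral_nonneg h

lemma I_congr {t : ℝ} {f g : SP} (h : ∀ x, ev t x f = ev t x g) : I t f = I t g := by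
  simp only [I_def, h]

lemma I_one (t : ℝ) : I t 1 = 1 := by
  simp [I_def, measureReal_def]

lemma I_eq_of_div {t : ℝ} {f g F G : SP}
    (h : ∀ x, ev t x f = ev t x g + ev t x (dx 0 F) + ev t x (dx 1 G)) : I t f = I t g := by
  have : I t f = I t (g + dx 0 F + dx 1 G) := I_congr fun x => by rw [h, map_add, map_add]
  rw [this, map_add, map_add, I_dx, I_dx]; ring

lemma dd_ev_eq_zero {f : SP} {t : ℝ} (h : ∀ x, ev t x f = 0) (j : Fin 2) (x : Vec 2) :
    ev t x (dx j f) = 0 := by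
  rw [← congrFun (pdir_ev j f t) x]
  have : (fun x => ev t x f) = fun _ => 0 := funext h
  rw [this, pdir]; simp

lemma dt_ev_eq_zero {f : SP} {t : ℝ} {x : Vec 2} (h : ∀ᶠ s in nhds t, ev s x f = 0) :
    ev t x (dt f) = 0 := by
  have h1 : HasDerivAt (fun s : ℝ => ev s x f) (ev t x (dt f)) t :=
    (f.differentiable (t, x)).hasFDerivAt.comp_hasDerivAt t
      ((hasDerivAt_id t).prodMk (hasDerivAt_const t x))
  exact h1.unique ((hasDerivAt_const t (0:ℝ)).congr_of_eventuallyEq h)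

/-- Dirichlet energy at time `t`. -/
def G (t : ℝ) (f : SP) : ℝ := I t (dx 0 f ^ 2) + I t (dx 1 f ^ 2)

lemma gradSq_ev (t : ℝ) (f : SP) : gradSq (fun x => ev t x f) = G t f := by
  simp only [gradSq, pdir_ev, G, I_def, map_pow]

lemma I_pow (t : ℝ) (f : SP) (n : ℕ) : ∫ x in box 2, ev t x f ^ n = I t (f ^ n) := by
  simp only [I_def, map_pow]

lemma G_nonneg (t : ℝ) (f : SP) : 0 ≤ G t f := gradSq_ev t f ▸ gradSq_nonneg _

lemma I_even_nonneg (t : ℝ) (f : SP) (m : ℕ) : 0 ≤ I t (f ^ (2 * m)) :=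
  I_nonneg fun x => by rw [map_pow, pow_mul]; positivity

lemma I_sq_nonneg (t : ℝ) (f : SP) : 0 ≤ I t (f ^ 2) := I_even_nonneg t f 1

lemma lady_I (t : ℝ) (f : SP) : I t (f ^ 4) ≤ I t (f ^ 2) * (2 * I t (f ^ 2) + 4 * G t f) := by
  have h := ladyzhenskaya (f.smP t)
  rwa [I_pow, I_pow, gradSq_ev] at h

lemma sobolev_I (m : ℕ) : ∃ C : ℝ, 0 ≤ C ∧ ∀ t (f : SP),
    I t (f ^ (2 * m)) ≤ C * (I t (f ^ 2) + G t f) ^ m := by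
  obtain ⟨C, hC, h⟩ := sobolev_pow m
  refine ⟨C, hC, fun t f => ?_⟩
  have := h _ (f.smP t)
  rwa [I_pow, I_pow, gradSq_ev] at this

lemma cz_I (n : ℕ) : ∃ C : ℝ, 0 ≤ C ∧ ∀ t (φ F₀ F₁ : SP),
    (∀ x, ev t x (dx 0 (dx 0 φ) + dx 1 (dx 1 φ)) = ev t x (dx 0 F₀ + dx 1 F₁)) →
    ∀ i, I t (dx i φ ^ (2 * n)) ≤ C * (I t (F₀ ^ (2 * n)) + I t (F₁ ^ (2 * n))) := by
  obtain ⟨C, hC, h⟩ := calderon_zygmund n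
  refine ⟨C, hC, fun t φ F₀ F₁ e i => ?_⟩
  have := h _ _ _ (φ.smP t) (F₀.smP t) (F₁.smP t) (fun x => by
    simp only [pdir_ev]; have := e x; simpa only [map_add] using this) i
  simpa only [pdir_ev, I_pow] using this

lemma wente_I : ∃ C : ℝ, 0 ≤ C ∧ ∀ t (P g h : SP),
    |I t (P * (dx 0 g * dx 1 h - dx 1 g * dx 0 h))| ≤ C * (√(G t P) * √(G t g) * √(G t h)) := by
  obtain ⟨C, hC, h⟩ := wente
  refine ⟨C, hC, fun t P g k => ?_⟩
  have := h _ _ _ (P.smP t) (g.smP t) (k.smP t)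
  simpa only [pdir_ev, gradSq_ev, I_def, map_mul, map_sub] using this

lemma poincare_I {t : ℝ} {f : SP} (h : I t f = 0) : I t (f ^ 2) ≤ G t f := by
  have := poincare (f.smP t) h
  rwa [I_pow, gradSq_ev] at this

lemma morrey_I (f : SP) {n : ℕ} (hn : 2 ≤ n) {h : ℝ} (h0 : 0 < h) (h1 : h ≤ 1) (t : ℝ) (x : Vec 2) :
    |ev t x f| ≤ h⁻¹ * √(I t (f ^ 2)) + 2 * h ^ (1 - 1 / n : ℝ) *
      (I t (dx 0 f ^ (2 * n)) ^ (1 / (2 * n) : ℝ) + I t (dx 1 f ^ (2 * n)) ^ (1 / (2 * n) : ℝ)) := by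
  have := morrey (f.smP t) hn h0 h1 x
  simpa only [pdir_ev, I_pow] using this

/-- First-order data of a pair of planar vector fields: the two gradients and the value
of the second field. -/
structure Jet (R : Type*) where
  /-- gradient of the first field -/
  a : Fin 3 → Fin 2 → R
  /-- gradient of the second field -/
  b : Fin 3 → Fin 2 → R
  /-- value of the second field -/
  z : Fin 3 → R

/-- The curl of a planar field as a function of its gradient. -/
def jcurl {R : Type*} [CommRing R] (a : Fin 3 → Fin 2 → R) : Fin 3 → R :=
  ![a 2 1, - a 2 0, a 1 0 - a 0 1]

/-- The viscous bilinear form. -/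
def beta {R : Type*} [CommRing R] (ν γ κ χ : R) (J K : Jet R) : R :=
  ν * ∑ i, ∑ j, J.a i j * K.a i j + γ * ∑ i, ∑ j, J.b i j * K.b i j
    + κ * ((J.b 0 0 + J.b 1 1) * (K.b 0 0 + K.b 1 1)) + 4 * χ * ∑ i, J.z i * K.z i
    - 2 * χ * ∑ i, jcurl J.a i * K.z i - 2 * χ * ∑ i, jcurl K.a i * J.z i

/-- The squared length of a jet. -/
def jsq {R : Type*} [CommRing R] (J : Jet R) : R :=
  ∑ i, ∑ j, J.a i j ^ 2 + ∑ i, ∑ j, J.b i j ^ 2 + ∑ i, J.z i ^ 2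

/-- Composition of a jet with the transposed velocity gradient. -/
def jact {R : Type*} [CommRing R] (J K : Jet R) : Jet R where
  a i k := J.a 0 k * K.a i 0 + J.a 1 k * K.a i 1
  b i k := J.a 0 k * K.b i 0 + J.a 1 k * K.b i 1
  z _ := 0

/-- Componentwise image of a jet. -/
def Jet.map {R S : Type*} (J : Jet R) (f : R → S) : Jet S where
  a i k := f (J.a i k)
  b i k := f (J.b i k)
  z i := f (J.z i)

lemma beta_map {R S : Type*} [CommRing R] [CommRing S] (f : R →+* S) (ν γ κ χ : R) (J K : Jet R) :
    f (beta ν γ κ χ J K) = beta (f ν) (f γ) (f κ) (f χ) (J.map f) (K.map f) := by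
  have h2 : f 2 = 2 := map_ofNat f 2
  have h4 : f 4 = 4 := map_ofNat f 4
  simp [beta, Jet.map, jcurl, Fin.sum_univ_three, h2, h4]

lemma jsq_map {R S : Type*} [CommRing R] [CommRing S] (f : R →+* S) (J : Jet R) :
    f (jsq J) = jsq (J.map f) := by
  simp [jsq, Jet.map]

lemma jact_map {R S : Type*} [CommRing R] [CommRing S] (f : R →+* S) (J K : Jet R) :
    (jact J K).map f = jact (J.map f) (K.map f) := by
  simp [jact, Jet.map]

/-- Constants as elements of the function algebra. -/
abbrev cst (c : ℝ) : SP := algebraMap ℝ SP c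

lemma ev_cst (t : ℝ) (x : Vec 2) (c : ℝ) : ev t x (cst c) = c := (ev t x).commutes c

/-- The material derivative. -/
def mat (u : Fin 3 → SP) : Derivation ℝ SP SP := dt + u 0 • dx 0 + u 1 • dx 1

lemma mat_apply (u : Fin 3 → SP) (f : SP) : mat u f = dt f + u 0 * dx 0 f + u 1 * dx 1 f := rfl

/-- Laplacian. -/
def lapS (f : SP) : SP := dx 0 (dx 0 f) + dx 1 (dx 1 f)

/-- Planar gradient as a three-component vector. -/
def grS (f : SP) : Fin 3 → SP := ![dx 0 f, dx 1 f, 0]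

/-- Divergence of a planar field. -/
def divS (v : Fin 3 → SP) : SP := dx 0 (v 0) + dx 1 (v 1)

/-- Curl of a planar field. -/
def curlS (v : Fin 3 → SP) : Fin 3 → SP := ![dx 1 (v 2), - dx 0 (v 2), dx 0 (v 1) - dx 1 (v 0)]

/-- The jet of a pair of fields. -/
def jet (v z : Fin 3 → SP) : Jet SP := ⟨fun i j => dx j (v i), fun i j => dx j (z i), z⟩

/-- Smooth solutions of the planar system on `[0,T]`, as elements of the function algebra. -/
structure Flow (T ν γ κ χ : ℝ) (ρ P : SP) (u w : Fin 3 → SP) : Prop where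
  hχ : 0 < χ
  hν : χ < ν
  hγ : 0 < γ
  hκ : 0 < κ
  mom : ∀ t ∈ Icc 0 T, ∀ i x, ev t x (ρ * mat u (u i) - cst ν * lapS (u i) + grS P i
    - 2 * cst χ * curlS w i) = 0
  ang : ∀ t ∈ Icc 0 T, ∀ i x, ev t x (ρ * mat u (w i) - cst γ * lapS (w i)
    - cst κ * grS (divS w) i + 4 * cst χ * w i - 2 * cst χ * curlS u i) = 0
  inc : ∀ t ∈ Icc 0 T, ∀ x, ev t x (divS u) = 0
  mass : ∀ t ∈ Icc 0 T, ∀ x, ev t x (mat u ρ) = 0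

/-- The inner product of two three-component fields. -/
def dotS (v z : Fin 3 → SP) : SP := ∑ i, v i * z i

/-- The trace pairing of the planar parts of two gradients. -/
def trS (u v : Fin 3 → SP) : SP :=
  dx 0 (u 0) * dx 0 (v 0) + dx 0 (u 1) * dx 1 (v 0) + dx 1 (u 0) * dx 0 (v 1)
    + dx 1 (u 1) * dx 1 (v 1)

/-- The viscous form with constant coefficients. -/
abbrev bet (ν γ κ χ : ℝ) (J K : Jet SP) : SP := beta (cst ν) (cst γ) (cst κ) (cst χ) J K

lemma beta_symm {R : Type*} [CommRing R] (ν γ κ χ : R) (J K : Jet R) :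
    beta ν γ κ χ J K = beta ν γ κ χ K J := by
  simp only [beta, jcurl, Fin.sum_univ_three, Fin.sum_univ_two]; ring

lemma der_bet (D : Derivation ℝ SP SP) (ν γ κ χ : ℝ) (J K : Jet SP) :
    D (bet ν γ κ χ J K) = bet ν γ κ χ (J.map D) K + bet ν γ κ χ J (K.map D) := by
  have h4 : D 4 = 0 := by exact_mod_cast D.map_natCast 4
  have h2 : D 2 = 0 := by exact_mod_cast D.map_natCast 2
  simp only [beta, jcurl, Jet.map, Fin.sum_univ_three, Fin.sum_univ_two, Derivation.leibniz, map_add,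
    map_sub, map_neg, Derivation.map_algebraMap, smul_eq_mul, h2, h4, Matrix.cons_val]
  ring

lemma mat_dx (u : Fin 3 → SP) (j : Fin 2) (f : SP) :
    mat u (dx j f) = dx j (mat u f) - (dx j (u 0) * dx 0 f + dx j (u 1) * dx 1 f) := by
  simp only [mat_apply, map_add, dd_mul, dt_dx]
  rw [dd_comm (0, Pi.single 0 1) (0, Pi.single j 1) f, dd_comm (0, Pi.single 1 1) (0, Pi.single j 1) f]
  ring

lemma bet_jact_sub (ν γ κ χ : ℝ) (J K L : Jet SP) : bet ν γ κ χ
      ⟨fun i k => J.a i k - K.a i k, fun i k => J.b i k - K.b i k, fun i => J.z i - K.z i⟩ L =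
    bet ν γ κ χ J L - bet ν γ κ χ K L := by
  simp only [beta, jcurl, Fin.sum_univ_three, Fin.sum_univ_two, Matrix.cons_val]; ring

lemma bet_mat_jet (ν γ κ χ : ℝ) (u v z w : Fin 3 → SP) (L : Jet SP) :
    bet ν γ κ χ ((jet v z).map (mat u)) L =
      bet ν γ κ χ (jet (fun i => mat u (v i)) fun i => mat u (z i)) L
        - bet ν γ κ χ (jact (jet u w) (jet v z)) L := by
  rw [← bet_jact_sub]
  congr 1
  simp only [Jet.map, jet, jact, mat_dx, sub_zero]

lemma divS_mat (u v : Fin 3 → SP) :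
    divS (fun i => mat u (v i)) = mat u (divS v) + trS u v := by
  simp only [divS, map_add, mat_dx, trS]; ring

namespace Flow

variable {T ν γ κ χ : ℝ} {ρ P : SP} {u w : Fin 3 → SP}

/-- The weak formulation. -/
lemma weak (F : Flow T ν γ κ χ ρ P u w) {t : ℝ} (ht : t ∈ Icc 0 T) (v z : Fin 3 → SP) :
    I t (ρ * dotS (fun i => mat u (u i)) v + ρ * dotS (fun i => mat u (w i)) z) +
      I t (bet ν γ κ χ (jet u w) (jet v z)) = I t (P * divS v) := by
  rw [← map_add]
  refine I_eq_of_div (F := cst ν * ∑ i, dx 0 (u i) * v i + cst γ * ∑ i, dx 0 (w i) * z i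
      + cst κ * divS w * z 0 - P * v 0 + 2 * cst χ * (w 1 * v 2 - w 2 * v 1))
    (G := cst ν * ∑ i, dx 1 (u i) * v i + cst γ * ∑ i, dx 1 (w i) * z i
      + cst κ * divS w * z 1 - P * v 1 + 2 * cst χ * (w 2 * v 0 - w 0 * v 2)) fun x => ?_
  have m0 := F.mom t ht 0 x
  have m1 := F.mom t ht 1 x
  have m2 := F.mom t ht 2 x
  have a0 := F.ang t ht 0 x
  have a1 := F.ang t ht 1 x
  have a2 := F.ang t ht 2 x
  simp only [lapS, grS, curlS, divS, Fin.isValue, Matrix.cons_val, map_add, map_sub, map_mul, map_neg,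
    ev_cst, map_zero, map_ofNat] at m0 m1 m2 a0 a1 a2
  have h2 : ∀ j, dx j (2:SP) = 0 := fun j => by exact_mod_cast (dx j).map_natCast 2
  simp only [dotS, beta, jcurl, jet, divS, Fin.sum_univ_three, Fin.sum_univ_two, Fin.isValue,
    Matrix.cons_val, map_add, map_sub, map_mul, map_neg, ev_cst, map_zero, map_ofNat,
    dd_mul, Derivation.map_algebraMap, h2]
  linear_combination (ev t x (v 0)) * m0 + (ev t x (v 1)) * m1 + (ev t x (v 2)) * m2
    + (ev t x (z 0)) * a0 + (ev t x (z 1)) * a1 + (ev t x (z 2)) * a2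

lemma transport (F : Flow T ν γ κ χ ρ P u w) {t : ℝ} (ht : t ∈ Icc 0 T) (f : SP) :
    I t (dt f) = I t (mat u f) := by
  refine I_eq_of_div (F := - (u 0 * f)) (G := - (u 1 * f)) fun x => ?_
  have h := F.inc t ht x
  simp only [divS, map_add] at h
  simp only [mat_apply, map_add, map_neg, dd_mul, map_mul]
  linear_combination (ev t x f) * h

lemma transport_rho (F : Flow T ν γ κ χ ρ P u w) {t : ℝ} (ht : t ∈ Icc 0 T) (f : SP) :
    I t (dt (ρ * f)) = I t (ρ * mat u f) := by
  rw [F.transport ht]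
  refine I_congr fun x => ?_
  rw [Derivation.leibniz, smul_eq_mul, smul_eq_mul, map_add, map_mul _ f, F.mass t ht x]
  ring

end Flow

lemma jsq_nonneg (J : Jet ℝ) : 0 ≤ jsq J := by unfold jsq; positivity

lemma Jet.sq_a_le (J : Jet ℝ) (i j) : J.a i j ^ 2 ≤ jsq J := by
  have h1 : J.a i j ^ 2 ≤ ∑ j, J.a i j ^ 2 :=
    Finset.single_le_sum (f := fun j => J.a i j ^ 2) (fun _ _ => sq_nonneg _) (Finset.mem_univ j)
  have h2 : ∑ j, J.a i j ^ 2 ≤ ∑ i, ∑ j, J.a i j ^ 2 :=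
    Finset.single_le_sum (f := fun i => ∑ j, J.a i j ^ 2) (fun _ _ => by positivity) (Finset.mem_univ i)
  have h3 : 0 ≤ ∑ i, ∑ j, J.b i j ^ 2 := by positivity
  have h4 : 0 ≤ ∑ i, J.z i ^ 2 := by positivity
  unfold jsq; linarith

lemma Jet.sq_b_le (J : Jet ℝ) (i j) : J.b i j ^ 2 ≤ jsq J := by
  have h1 : J.b i j ^ 2 ≤ ∑ j, J.b i j ^ 2 :=
    Finset.single_le_sum (f := fun j => J.b i j ^ 2) (fun _ _ => sq_nonneg _) (Finset.mem_univ j)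
  have h2 : ∑ j, J.b i j ^ 2 ≤ ∑ i, ∑ j, J.b i j ^ 2 :=
    Finset.single_le_sum (f := fun i => ∑ j, J.b i j ^ 2) (fun _ _ => by positivity) (Finset.mem_univ i)
  have h3 : 0 ≤ ∑ i, ∑ j, J.a i j ^ 2 := by positivity
  have h4 : 0 ≤ ∑ i, J.z i ^ 2 := by positivity
  unfold jsq; linarith

lemma Jet.sq_z_le (J : Jet ℝ) (i) : J.z i ^ 2 ≤ jsq J := by
  have h1 : J.z i ^ 2 ≤ ∑ i, J.z i ^ 2 :=
    Finset.single_le_sum (f := fun i => J.z i ^ 2) (fun _ _ => sq_nonneg _) (Finset.mem_univ i)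
  have h3 : 0 ≤ ∑ i, ∑ j, J.a i j ^ 2 := by positivity
  have h4 : 0 ≤ ∑ i, ∑ j, J.b i j ^ 2 := by positivity
  unfold jsq; linarith

lemma abs_mul_le_sqrt {a b s r : ℝ} (ha : a ^ 2 ≤ s) (hb : b ^ 2 ≤ r) : |a * b| ≤ √s * √r := by
  rw [abs_mul]
  exact mul_le_mul (abs_le_sqrt ha) (abs_le_sqrt hb) (abs_nonneg _) (sqrt_nonneg _)

/-- The norm of the viscous form. -/
def betaC (ν γ κ χ : ℝ) : ℝ := 6 * ν + 6 * γ + 4 * κ + 28 * χ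

lemma beta_abs_le {ν γ κ χ : ℝ} (hν : 0 ≤ ν) (hγ : 0 ≤ γ) (hκ : 0 ≤ κ) (hχ : 0 ≤ χ) (J K : Jet ℝ) :
    |beta ν γ κ χ J K| ≤ betaC ν γ κ χ * (√(jsq J) * √(jsq K)) := by
  set s := √(jsq J) * √(jsq K)
  have ha : ∀ i j k l, |J.a i j * K.a k l| ≤ s := fun i j k l =>
    abs_mul_le_sqrt (J.sq_a_le i j) (K.sq_a_le k l)
  have hb : ∀ i j k l, |J.b i j * K.b k l| ≤ s := fun i j k l =>
    abs_mul_le_sqrt (J.sq_b_le i j) (K.sq_b_le k l)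
  have hz : ∀ i k, |J.z i * K.z k| ≤ s := fun i k => abs_mul_le_sqrt (J.sq_z_le i) (K.sq_z_le k)
  have haz : ∀ i j k, |J.a i j * K.z k| ≤ s := fun i j k =>
    abs_mul_le_sqrt (J.sq_a_le i j) (K.sq_z_le k)
  have hza : ∀ i j k, |K.a i j * J.z k| ≤ s := fun i j k => by
    rw [mul_comm]; exact abs_mul_le_sqrt (J.sq_z_le k) (K.sq_a_le i j)
  have e1 : |∑ i, ∑ j, J.a i j * K.a i j| ≤ 6 * s := by
    refine (Finset.abs_sum_le_sum_abs _ _).trans ?_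
    refine (Finset.sum_le_card_nsmul _ _ (2 * s) fun i _ => ?_).trans (by simp; linarith)
    refine (Finset.abs_sum_le_sum_abs _ _).trans ?_
    exact (Finset.sum_le_card_nsmul _ _ s fun j _ => ha i j i j).trans (by simp)
  have e2 : |∑ i, ∑ j, J.b i j * K.b i j| ≤ 6 * s := by
    refine (Finset.abs_sum_le_sum_abs _ _).trans ?_
    refine (Finset.sum_le_card_nsmul _ _ (2 * s) fun i _ => ?_).trans (by simp; linarith)
    refine (Finset.abs_sum_le_sum_abs _ _).trans ?_
    exact (Finset.sum_le_card_nsmul _ _ s fun j _ => hb i j i j).trans (by simp)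
  have e3 : |(J.b 0 0 + J.b 1 1) * (K.b 0 0 + K.b 1 1)| ≤ 4 * s := by
    have h1 := abs_le.1 (hb 0 0 0 0)
    have h2 := abs_le.1 (hb 0 0 1 1)
    have h3 := abs_le.1 (hb 1 1 0 0)
    have h4 := abs_le.1 (hb 1 1 1 1)
    rw [abs_le]; constructor <;> linarith
  have e4 : |∑ i, J.z i * K.z i| ≤ 3 * s := by
    refine (Finset.abs_sum_le_sum_abs _ _).trans ?_
    exact (Finset.sum_le_card_nsmul _ _ s fun j _ => hz j j).trans (by simp)
  have e5 : |∑ i, jcurl J.a i * K.z i| ≤ 4 * s := by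
    have h1 := abs_le.1 (haz 2 1 0)
    have h2 := abs_le.1 (haz 2 0 1)
    have h3 := abs_le.1 (haz 1 0 2)
    have h4 := abs_le.1 (haz 0 1 2)
    simp only [jcurl, Fin.sum_univ_three, Matrix.cons_val]
    rw [abs_le]; constructor <;> linarith
  have e6 : |∑ i, jcurl K.a i * J.z i| ≤ 4 * s := by
    have h1 := abs_le.1 (hza 2 1 0)
    have h2 := abs_le.1 (hza 2 0 1)
    have h3 := abs_le.1 (hza 1 0 2)
    have h4 := abs_le.1 (hza 0 1 2)
    simp only [jcurl, Fin.sum_univ_three, Matrix.cons_val]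
    rw [abs_le]; constructor <;> linarith
  unfold beta betaC
  generalize (∑ i, ∑ j, J.a i j * K.a i j) = q1 at *
  generalize (∑ i, ∑ j, J.b i j * K.b i j) = q2 at *
  generalize ((J.b 0 0 + J.b 1 1) * (K.b 0 0 + K.b 1 1)) = q3 at *
  generalize (∑ i, J.z i * K.z i) = q4 at *
  generalize (∑ i, jcurl J.a i * K.z i) = q5 at *
  generalize (∑ i, jcurl K.a i * J.z i) = q6 at *
  have m : ∀ {c q n : ℝ}, 0 ≤ c → |q| ≤ n → -(c * n) ≤ c * q ∧ c * q ≤ c * n := fun hc h => by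
    have := abs_le.1 h
    constructor <;> nlinarith
  have f1 := m hν e1
  have f2 := m hγ e2
  have f3 := m hκ e3
  have f4 := m hχ e4
  have f5 := m hχ e5
  have f6 := m hχ e6
  rw [abs_le]; constructor <;> linarith

lemma jsq_jact_le (J K : Jet ℝ) : jsq (jact J K) ≤ jsq J * jsq K := by
  have key : ∀ a b c d : ℝ, (a * c + b * d) ^ 2 ≤ (a ^ 2 + b ^ 2) * (c ^ 2 + d ^ 2) := fun a b c d => by
    nlinarith [sq_nonneg (a * d - b * c)]
  set n := J.a 0 0 ^ 2 + J.a 1 0 ^ 2 + J.a 0 1 ^ 2 + J.a 1 1 ^ 2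
  set m := ∑ i, ∑ j, K.a i j ^ 2 + ∑ i, ∑ j, K.b i j ^ 2 with hm
  have h1 : jsq (jact J K) ≤ n * m := by
    simp only [jsq, jact, Fin.sum_univ_three, Fin.sum_univ_two, hm]
    have a0 := fun k i => key (J.a 0 k) (J.a 1 k) (K.a i 0) (K.a i 1)
    have b0 := fun k i => key (J.a 0 k) (J.a 1 k) (K.b i 0) (K.b i 1)
    have := a0 0 0; have := a0 0 1; have := a0 0 2; have := a0 1 0; have := a0 1 1; have := a0 1 2
    have := b0 0 0; have := b0 0 1; have := b0 0 2; have := b0 1 0; have := b0 1 1; have := b0 1 2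
    linarith
  have h2 : n ≤ jsq J := by
    have : 0 ≤ ∑ i, ∑ j, J.b i j ^ 2 := by positivity
    have : 0 ≤ ∑ i, J.z i ^ 2 := by positivity
    have e : n + J.a 2 0 ^ 2 + J.a 2 1 ^ 2 = ∑ i, ∑ j, J.a i j ^ 2 := by
      simp only [Fin.sum_univ_three, Fin.sum_univ_two, n]; ring
    unfold jsq
    linarith [sq_nonneg (J.a 2 0), sq_nonneg (J.a 2 1)]
  have h3 : m ≤ jsq K := by
    have : 0 ≤ ∑ i, K.z i ^ 2 := by positivity
    unfold jsq; linarith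
  have h4 : 0 ≤ m := by positivity
  exact h1.trans (mul_le_mul h2 h3 h4 (jsq_nonneg J))

/-- The trace pairing of the planar parts of the first gradients of two jets. -/
def jtr (J K : Jet ℝ) : ℝ :=
  J.a 0 0 * K.a 0 0 + J.a 1 0 * K.a 0 1 + J.a 0 1 * K.a 1 0 + J.a 1 1 * K.a 1 1

lemma jtr_abs_le (J K : Jet ℝ) : |jtr J K| ≤ 4 * (√(jsq J) * √(jsq K)) := by
  have ha : ∀ i j k l, |J.a i j * K.a k l| ≤ √(jsq J) * √(jsq K) := fun i j k l =>
    abs_mul_le_sqrt (J.sq_a_le i j) (K.sq_a_le k l)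
  have h1 := abs_le.1 (ha 0 0 0 0)
  have h2 := abs_le.1 (ha 1 0 0 1)
  have h3 := abs_le.1 (ha 0 1 1 0)
  have h4 := abs_le.1 (ha 1 1 1 1)
  unfold jtr
  rw [abs_le]; constructor <;> linarith

lemma ev_trS (t x) (u v z w : Fin 3 → SP) :
    ev t x (trS u v) = jtr ((jet u z).map (ev t x)) ((jet v w).map (ev t x)) := by
  simp only [trS, map_add, map_mul, jtr, Jet.map, jet]

lemma ev_bet (t x) (ν γ κ χ : ℝ) (J K : Jet SP) :
    ev t x (bet ν γ κ χ J K) = beta ν γ κ χ (J.map (ev t x)) (K.map (ev t x)) := by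
  have := beta_map (ev t x : SP →+* ℝ) (cst ν) (cst γ) (cst κ) (cst χ) J K
  simpa [ev_cst] using this

lemma ev_jsq (t x) (J : Jet SP) : ev t x (jsq J) = jsq (J.map (ev t x)) :=
  jsq_map (ev t x : SP →+* ℝ) J

lemma map_jact (t x) (J K : Jet SP) :
    (jact J K).map (ev t x) = jact (J.map (ev t x)) (K.map (ev t x)) :=
  jact_map (ev t x : SP →+* ℝ) J K

/-- The norm of a jet in the form of the dissipation. -/
def kform {R : Type*} [CommRing R] (μ γ κ χ : R) (J : Jet R) : R :=
  μ * ∑ i, ∑ j, J.a i j ^ 2 + γ * ∑ i, ∑ j, J.b i j ^ 2 + κ * (J.b 0 0 + J.b 1 1) ^ 2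
    + χ * ∑ i, (jcurl J.a i - 2 * J.z i) ^ 2

/-- `β` equals the dissipation form up to a null Lagrangian and the divergence. -/
lemma beta_self {R : Type*} [CommRing R] (μ γ κ χ : R) (J : Jet R) :
    beta (μ + χ) γ κ χ J J = kform μ γ κ χ J + χ * ((J.a 0 0 + J.a 1 1) ^ 2
      - 2 * (J.a 0 0 * J.a 1 1 - J.a 0 1 * J.a 1 0)) := by
  simp only [beta, kform, jcurl, Fin.sum_univ_three, Fin.sum_univ_two, Matrix.cons_val]; ring

lemma I_null (t : ℝ) (f g : SP) : I t (dx 0 f * dx 1 g - dx 1 f * dx 0 g) = 0 := by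
  rw [← map_zero (I t)]
  refine I_eq_of_div (F := f * dx 1 g) (G := - (f * dx 0 g)) fun x => ?_
  simp only [dd_mul, map_neg, map_add, map_sub, map_mul, dx_one_zero, map_zero]; ring

lemma I_bet_self (μ γ κ χ t : ℝ) (v z : Fin 3 → SP) :
    I t (bet (μ + χ) γ κ χ (jet v z) (jet v z)) =
      I t (kform (cst μ) (cst γ) (cst κ) (cst χ) (jet v z)) + χ * I t (divS v ^ 2) := by
  have h := beta_self (cst μ) (cst γ) (cst κ) (cst χ) (jet v z)
  have h2 : cst (μ + χ) = cst μ + cst χ := map_add _ _ _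
  rw [bet, h2, h, map_add]
  congr 1
  have e : cst χ * (((jet v z).a 0 0 + (jet v z).a 1 1) ^ 2 - 2 * ((jet v z).a 0 0 * (jet v z).a 1 1
      - (jet v z).a 0 1 * (jet v z).a 1 0)) = χ • (divS v ^ 2) - (2 * χ) • (dx 0 (v 0) * dx 1 (v 1)
      - dx 1 (v 0) * dx 0 (v 1)) := by
    simp only [jet, divS, Algebra.smul_def, cst, map_mul, map_ofNat]; ring
  rw [e, map_sub, map_smul, map_smul, I_null]; simp

/-- Coercivity constant of the dissipation. -/
def coer (μ γ χ : ℝ) : ℝ := min (min (μ / 4) γ) (min χ (μ / 8))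

lemma coer_pos {μ γ χ : ℝ} (hμ : 0 < μ) (hγ : 0 < γ) (hχ : 0 < χ) : 0 < coer μ γ χ := by
  unfold coer; positivity

lemma kform_ge {μ γ κ χ : ℝ} (hμ : 0 < μ) (hγ : 0 < γ) (hκ : 0 < κ) (hχ : 0 < χ) (J : Jet ℝ) :
    coer μ γ χ * jsq J ≤ kform μ γ κ χ J := by
  set c := coer μ γ χ
  have hc : 0 < c := coer_pos hμ hγ hχ
  have c1 : c ≤ μ / 4 := (min_le_left _ _).trans (min_le_left _ _)
  have c2 : c ≤ γ := (min_le_left _ _).trans (min_le_right _ _)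
  have c3 : c ≤ χ := (min_le_right _ _).trans (min_le_left _ _)
  have c4 : c ≤ μ / 8 := (min_le_right _ _).trans (min_le_right _ _)
  have A : ∑ i, jcurl J.a i ^ 2 ≤ 2 * ∑ i, ∑ j, J.a i j ^ 2 := by
    simp only [jcurl, Fin.sum_univ_three, Fin.sum_univ_two, Matrix.cons_val]
    nlinarith [sq_nonneg (J.a 1 0 + J.a 0 1), sq_nonneg (J.a 0 0), sq_nonneg (J.a 1 1),
      sq_nonneg (J.a 2 0), sq_nonneg (J.a 2 1)]
  have Z : ∑ i, J.z i ^ 2 ≤ ∑ i, (jcurl J.a i - 2 * J.z i) ^ 2 + ∑ i, jcurl J.a i ^ 2 := by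
    rw [← Finset.sum_add_distrib]
    refine Finset.sum_le_sum fun i _ => ?_
    nlinarith [sq_nonneg (jcurl J.a i - J.z i), sq_nonneg (jcurl J.a i - 2 * J.z i), sq_nonneg (J.z i)]
  have p1 : 0 ≤ ∑ i, ∑ j, J.a i j ^ 2 := by positivity
  have p2 : 0 ≤ ∑ i, ∑ j, J.b i j ^ 2 := by positivity
  have p3 : 0 ≤ ∑ i, (jcurl J.a i - 2 * J.z i) ^ 2 := by positivity
  have p4 : 0 ≤ κ * (J.b 0 0 + J.b 1 1) ^ 2 := by positivity
  unfold jsq kform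
  generalize (∑ i, ∑ j, J.a i j ^ 2) = q1 at *
  generalize (∑ i, ∑ j, J.b i j ^ 2) = q2 at *
  generalize (∑ i, jcurl J.a i ^ 2) = q3 at *
  generalize (∑ i, (jcurl J.a i - 2 * J.z i) ^ 2) = q4 at *
  generalize (∑ i, J.z i ^ 2) = q5 at *
  generalize κ * (J.b 0 0 + J.b 1 1) ^ 2 = q6 at *
  have h1 : c * q5 ≤ c * (q4 + 2 * q1) := mul_le_mul_of_nonneg_left (by linarith) hc.le
  have h2 : c * q4 ≤ χ * q4 := mul_le_mul_of_nonneg_right c3 p3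
  have h3 : c * q2 ≤ γ * q2 := mul_le_mul_of_nonneg_right c2 p2
  have h4 : c * q1 ≤ μ / 4 * q1 := mul_le_mul_of_nonneg_right c1 p1
  have h5 : c * q1 ≤ μ / 8 * q1 := mul_le_mul_of_nonneg_right c4 p1
  nlinarith

lemma kform_map {R S : Type*} [CommRing R] [CommRing S] (f : R →+* S) (μ γ κ χ : R) (J : Jet R) :
    f (kform μ γ κ χ J) = kform (f μ) (f γ) (f κ) (f χ) (J.map f) := by
  have h2 : f 2 = 2 := map_ofNat f 2
  simp [kform, Jet.map, jcurl, Fin.sum_univ_three, h2]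

lemma I_smul_eq (t c : ℝ) (f : SP) : I t (cst c * f) = c * I t f := by
  rw [cst, ← Algebra.smul_def, map_smul, smul_eq_mul]

lemma coercive {μ γ κ χ : ℝ} (hμ : 0 < μ) (hγ : 0 < γ) (hκ : 0 < κ) (hχ : 0 < χ) (t : ℝ)
    (v z : Fin 3 → SP) :
    coer μ γ χ * I t (jsq (jet v z)) ≤ I t (bet (μ + χ) γ κ χ (jet v z) (jet v z)) := by
  rw [I_bet_self, ← I_smul_eq]
  have h1 : I t (cst (coer μ γ χ) * jsq (jet v z)) ≤
      I t (kform (cst μ) (cst γ) (cst κ) (cst χ) (jet v z)) := I_mono fun x => by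
    have h := kform_map (ev t x : SP →+* ℝ) (cst μ) (cst γ) (cst κ) (cst χ) (jet v z)
    simp only [RingHom.coe_coe, ev_cst] at h
    rw [h, map_mul, ev_cst, ev_jsq]
    exact kform_ge hμ hγ hκ hχ _
  have := mul_nonneg hχ.le (I_sq_nonneg t (divS v))
  linarith

/-- Componentwise material derivative. -/
def Dm (u v : Fin 3 → SP) : Fin 3 → SP := fun i => mat u (v i)

/-- The jet of the material derivatives. -/
def jD (u w : Fin 3 → SP) : Jet SP := jet (Dm u u) (Dm u w)

/-- The weighted energy density of a pair of fields. -/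
def eden (ρ : SP) (v z : Fin 3 → SP) : SP := ρ * (dotS v v + dotS z z)

lemma mat_dotS (u v : Fin 3 → SP) : mat u (dotS v v) = 2 * dotS (Dm u v) v := by
  simp only [dotS, Dm, map_sum, Derivation.leibniz, smul_eq_mul, Finset.mul_sum]
  exact Finset.sum_congr rfl fun i _ => by ring

lemma I_two (t : ℝ) (f : SP) : I t (2 * f) = 2 * I t f := by
  rw [two_mul, map_add]; ring

lemma bet_symm (ν γ κ χ : ℝ) (J K : Jet SP) : bet ν γ κ χ J K = bet ν γ κ χ K J := beta_symm _ _ _ _ J K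

lemma bet_jet_mat (ν γ κ χ : ℝ) (u v z w : Fin 3 → SP) (L : Jet SP) :
    bet ν γ κ χ L ((jet v z).map (mat u)) =
      bet ν γ κ χ L (jet (Dm u v) (Dm u z)) - bet ν γ κ χ L (jact (jet u w) (jet v z)) := by
  rw [bet_symm, bet_mat_jet ν γ κ χ u v z w, bet_symm, bet_symm ν γ κ χ L (jact _ _)]; rfl

namespace Flow

variable {T ν γ κ χ : ℝ} {ρ P : SP} {u w : Fin 3 → SP}

lemma I_P_divS_u (F : Flow T ν γ κ χ ρ P u w) {t : ℝ} (ht : t ∈ Icc 0 T) : I t (P * divS u) = 0 := by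
  rw [← map_zero (I t)]
  exact I_congr fun x => by rw [map_mul, F.inc t ht x, mul_zero, map_zero]

lemma deriv_eden (F : Flow T ν γ κ χ ρ P u w) {t : ℝ} (ht : t ∈ Icc 0 T) (v z : Fin 3 → SP) :
    HasDerivAt (fun s => I s (eden ρ v z))
      (2 * I t (ρ * dotS (Dm u v) v + ρ * dotS (Dm u z) z)) t := by
  have h := hasDerivAt_I (eden ρ v z) t
  have e : I t (dt (eden ρ v z)) = 2 * I t (ρ * dotS (Dm u v) v + ρ * dotS (Dm u z) z) := by
    rw [eden, F.transport_rho ht, map_add, mat_dotS, mat_dotS, ← I_two]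
    congr 1; ring
  rwa [e] at h

lemma energy_deriv (F : Flow T ν γ κ χ ρ P u w) {t : ℝ} (ht : t ∈ Icc 0 T) :
    HasDerivAt (fun s => I s (eden ρ u w)) (-2 * I t (bet ν γ κ χ (jet u w) (jet u w))) t := by
  have h := F.deriv_eden ht u w
  have h2 := F.weak ht u w
  rw [F.I_P_divS_u ht] at h2
  have : 2 * I t (ρ * dotS (Dm u u) u + ρ * dotS (Dm u w) w) =
      -2 * I t (bet ν γ κ χ (jet u w) (jet u w)) := by
    unfold Dm; linarith
  rwa [this] at h

lemma weak_self (F : Flow T ν γ κ χ ρ P u w) {t : ℝ} (ht : t ∈ Icc 0 T) :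
    I t (eden ρ (Dm u u) (Dm u w)) + I t (bet ν γ κ χ (jet u w) (jD u w)) =
      I t (P * divS (Dm u u)) := by
  rw [← F.weak ht (Dm u u) (Dm u w), eden, mul_add]; rfl

lemma mat_zero_of_Ioo {f : SP} {t : ℝ} (ht : t ∈ Ioo 0 T) (h : ∀ s ∈ Ioo 0 T, ∀ x, ev s x f = 0)
    (x : Vec 2) : ev t x (mat u f) = 0 := by
  have h1 : ev t x (dt f) = 0 := dt_ev_eq_zero <| by
    filter_upwards [isOpen_Ioo.mem_nhds ht] with s hs using h s hs x
  simp only [mat_apply, map_add, map_mul, h1, dd_ev_eq_zero (h t ht)]; ring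

lemma div_Dm (F : Flow T ν γ κ χ ρ P u w) {t : ℝ} (ht : t ∈ Ioo 0 T) (x : Vec 2) :
    ev t x (divS (Dm u u)) = ev t x (trS u u) := by
  unfold Dm
  rw [divS_mat, map_add, mat_zero_of_Ioo ht (fun s hs x => F.inc s (Ioo_subset_Icc_self hs) x), zero_add]

lemma mat_trS (F : Flow T ν γ κ χ ρ P u w) {t : ℝ} (ht : t ∈ Ioo 0 T) (x : Vec 2) :
    ev t x (mat u (trS u u)) = ev t x (2 * trS u (Dm u u)) := by
  have h := F.inc t (Ioo_subset_Icc_self ht) x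
  simp only [divS, map_add] at h
  simp only [trS, map_add, Derivation.leibniz, smul_eq_mul, mat_dx, Dm, map_mul, map_sub, map_ofNat]
  generalize ev t x (dx 0 (u 0)) = a at *
  generalize ev t x (dx 1 (u 1)) = d at *
  generalize ev t x (dx 0 (u 1)) = b at *
  generalize ev t x (dx 1 (u 0)) = c at *
  linear_combination -2 * (a ^ 2 - a * d + d ^ 2 + 3 * b * c) * h

lemma div_Dm_Dm (F : Flow T ν γ κ χ ρ P u w) {t : ℝ} (ht : t ∈ Ioo 0 T) (x : Vec 2) :
    ev t x (divS (Dm u (Dm u u))) = 3 * ev t x (trS u (Dm u u)) := by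
  have h : ev t x (mat u (divS (Dm u u) - trS u u)) = 0 :=
    mat_zero_of_Ioo ht (fun s hs x => by rw [map_sub, F.div_Dm hs, sub_self]) x
  rw [map_sub, map_sub, F.mat_trS ht, map_mul, map_ofNat] at h
  have e : divS (Dm u (Dm u u)) = mat u (divS (Dm u u)) + trS u (Dm u u) := divS_mat u (Dm u u)
  rw [e, map_add]; linarith

lemma I_divS (t : ℝ) (v : Fin 3 → SP) : I t (divS v) = 0 := by
  rw [divS, map_add, I_dx, I_dx, add_zero]

lemma I_trS_Dm (F : Flow T ν γ κ χ ρ P u w) {t : ℝ} (ht : t ∈ Ioo 0 T) :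
    I t (trS u (Dm u u)) = 0 := by
  have h : I t (divS (Dm u (Dm u u))) = I t (cst 3 * trS u (Dm u u)) := I_congr fun x => by
    rw [F.div_Dm_Dm ht, map_mul, ev_cst]
  rw [I_divS, I_smul_eq] at h; linarith

lemma diss_deriv (F : Flow T ν γ κ χ ρ P u w) {t : ℝ} (ht : t ∈ Ioo 0 T) :
    HasDerivAt (fun s => I s (bet ν γ κ χ (jet u w) (jet u w)))
      (-2 * I t (eden ρ (Dm u u) (Dm u w)) + 2 * I t (P * trS u u)
        - 2 * I t (bet ν γ κ χ (jact (jet u w) (jet u w)) (jet u w))) t := by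
  have h := hasDerivAt_I (bet ν γ κ χ (jet u w) (jet u w)) t
  have ht' := Ioo_subset_Icc_self ht
  have e1 : I t (P * divS (Dm u u)) = I t (P * trS u u) := I_congr fun x => by
    rw [map_mul, map_mul, F.div_Dm ht]
  have e2 := F.weak_self ht'
  have e3 : mat u (bet ν γ κ χ (jet u w) (jet u w)) = 2 * (bet ν γ κ χ (jet u w) (jD u w) -
      bet ν γ κ χ (jact (jet u w) (jet u w)) (jet u w)) := by
    rw [der_bet, bet_symm ν γ κ χ ((jet u w).map _), bet_jet_mat ν γ κ χ u u w w,
      bet_symm ν γ κ χ (jact _ _)]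
    unfold jD; ring
  rw [F.transport ht', e3, I_two, map_sub] at h
  convert h using 1
  linarith

/-- The corrected second-order energy. -/
def FF (ν γ κ χ : ℝ) (ρ : SP) (u w : Fin 3 → SP) (t : ℝ) : ℝ :=
  -(1 / 2) * I t (eden ρ (Dm u u) (Dm u w)) - I t (bet ν γ κ χ (jet u w) (jD u w))

lemma FF_eq (F : Flow T ν γ κ χ ρ P u w) {t : ℝ} (ht : t ∈ Ioo 0 T) :
    FF ν γ κ χ ρ u w t = 1 / 2 * I t (eden ρ (Dm u u) (Dm u w)) - I t (P * trS u u) := by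
  have e1 : I t (P * divS (Dm u u)) = I t (P * trS u u) := I_congr fun x => by
    rw [map_mul, map_mul, F.div_Dm ht]
  have e2 := F.weak_self (Ioo_subset_Icc_self ht)
  unfold FF; linarith

lemma FF_deriv (F : Flow T ν γ κ χ ρ P u w) {t : ℝ} (ht : t ∈ Ioo 0 T) (m : ℝ) :
    HasDerivAt (FF ν γ κ χ ρ u w)
      (- I t (bet ν γ κ χ (jD u w) (jD u w))
        + I t (bet ν γ κ χ (jact (jet u w) (jet u w)) (jD u w))
        + I t (bet ν γ κ χ (jet u w) (jact (jet u w) (jD u w)))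
        - 3 * I t ((P - cst m) * trS u (Dm u u))) t := by
  have ht' := Ioo_subset_Icc_self ht
  have h1 := F.deriv_eden ht' (Dm u u) (Dm u w)
  have h2 := hasDerivAt_I (bet ν γ κ χ (jet u w) (jD u w)) t
  have h := (h1.const_mul (-(1/2))).sub h2
  have e0 := F.weak ht' (Dm u (Dm u u)) (Dm u (Dm u w))
  have e1 : I t (P * divS (Dm u (Dm u u))) = 3 * I t ((P - cst m) * trS u (Dm u u)) := by
    rw [sub_mul, map_sub, I_smul_eq, F.I_trS_Dm ht, mul_zero, sub_zero, ← I_smul_eq]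
    exact I_congr fun x => by rw [map_mul, F.div_Dm_Dm ht, map_mul, ev_cst, map_mul]; ring
  have e3 : mat u (bet ν γ κ χ (jet u w) (jD u w)) =
      bet ν γ κ χ (jD u w) (jD u w) - bet ν γ κ χ (jact (jet u w) (jet u w)) (jD u w)
        + (bet ν γ κ χ (jet u w) (jet (Dm u (Dm u u)) (Dm u (Dm u w)))
          - bet ν γ κ χ (jet u w) (jact (jet u w) (jD u w))) := by
    rw [der_bet, bet_mat_jet ν γ κ χ u u w w (jD u w), jD, bet_jet_mat ν γ κ χ u (Dm u u) (Dm u w) w]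
    rfl
  have e4 : I t (ρ * dotS (Dm u (Dm u u)) (Dm u u) + ρ * dotS (Dm u (Dm u w)) (Dm u w)) =
      I t (ρ * dotS (fun i => mat u (u i)) (Dm u (Dm u u))
        + ρ * dotS (fun i => mat u (w i)) (Dm u (Dm u w))) := by
    congr 1
    simp only [dotS, Dm, mul_comm]
  rw [F.transport ht', e3] at h
  simp only [map_add, map_sub] at h
  simp only [map_add] at e4
  simp only [map_add] at e0
  rw [e1] at e0
  rw [e4] at h
  refine h.congr_deriv ?_
  linarith

end Flow

/-- The `2n`-th moment of `f` at time `t` is at most `c * R`. -/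
def NB (t : ℝ) (n : ℕ) (R c : ℝ) (f : SP) : Prop := I t (f ^ (2 * n)) ≤ c * R

namespace NB

variable {t R c c' : ℝ} {n : ℕ} {f g : SP}

lemma mono (h : NB t n R c f) (hR : 0 ≤ R) (hc : c ≤ c') : NB t n R c' f :=
  h.trans (mul_le_mul_of_nonneg_right hc hR)

lemma sub (hf : NB t n R c f) (hg : NB t n R c' g) : NB t n R (2 ^ (2 * n) * (c + c')) (f - g) := by
  have h : I t ((f - g) ^ (2 * n)) ≤ I t (cst (2 ^ (2 * n)) * (f ^ (2 * n) + g ^ (2 * n))) :=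
    I_mono fun x => by
      simp only [map_mul, map_pow, map_sub, map_add, ev_cst]
      simpa using sub_even_pow_le (ev t x f) (ev t x g) n
  rw [I_smul_eq, map_add] at h
  have h2 := mul_le_mul_of_nonneg_left (add_le_add hf hg) (by positivity : (0:ℝ) ≤ 2 ^ (2 * n))
  unfold NB; linarith

lemma neg (hf : NB t n R c f) : NB t n R c (-f) := by
  unfold NB
  rw [I_congr (g := f ^ (2 * n)) fun x => by rw [map_pow, map_pow, map_neg, (even_two_mul n).neg_pow]]
  exact hf

lemma add (hf : NB t n R c f) (hg : NB t n R c' g) : NB t n R (2 ^ (2 * n) * (c + c')) (f + g) := by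
  have h := hf.sub hg.neg
  rwa [sub_neg_eq_add] at h

lemma cmul (a : ℝ) (hf : NB t n R c f) : NB t n R (a ^ (2 * n) * c) (cst a * f) := by
  have h := mul_le_mul_of_nonneg_left hf (by rw [pow_mul]; positivity : (0:ℝ) ≤ a ^ (2 * n))
  unfold NB
  rw [mul_pow, cst, ← map_pow, I_smul_eq, mul_assoc]; exact h

lemma zero (hn : 1 ≤ n) (hR : 0 ≤ R) (hc : 0 ≤ c) : NB t n R c 0 := by
  unfold NB
  rw [zero_pow (by omega), map_zero]; positivity

lemma nonneg (h : NB t n R 1 f) : 0 ≤ R := by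
  have := I_even_nonneg t f n
  unfold NB at h; linarith

end NB

lemma cz_second (n : ℕ) (hn : 1 ≤ n) : ∃ C : ℝ, 0 ≤ C ∧ ∀ t R c (φ h : SP), 0 ≤ R → NB t n R c h →
    (∀ x, ev t x (lapS φ) = ev t x h) → ∀ j k, NB t n R (C * c) (dx j (dx k φ)) := by
  obtain ⟨C, hC, H⟩ := cz_I n
  refine ⟨C, hC, fun t R c φ h hR hb e j k => ?_⟩
  have e2 : ∀ x, ev t x (dx k (lapS φ - h)) = 0 := fun x =>
    dd_ev_eq_zero (fun x => by rw [map_sub, e, sub_self]) k x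
  have z : I t ((0:SP) ^ (2 * n)) = 0 := by rw [zero_pow (by omega), map_zero]
  have key : I t (dx j (dx k φ) ^ (2 * n)) ≤ C * I t (h ^ (2 * n)) := by
    have e3 : ∀ x, ev t x (dx 0 (dx 0 (dx k φ)) + dx 1 (dx 1 (dx k φ))) = ev t x (dx k h) := by
      intro x
      have := e2 x
      rw [map_sub, map_sub, lapS, map_add] at this
      rw [dd_comm (0, Pi.single 0 1) (0, Pi.single k 1) φ, dd_comm (0, Pi.single 1 1) (0, Pi.single k 1) φ,
        dd_comm (0, Pi.single 0 1) (0, Pi.single k 1), dd_comm (0, Pi.single 1 1) (0, Pi.single k 1)]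
      linarith
    fin_cases k
    · have := H t (dx 0 φ) h 0 (fun x => by rw [map_zero, add_zero]; exact e3 x) j
      rwa [z, add_zero] at this
    · have := H t (dx 1 φ) 0 h (fun x => by rw [map_zero, zero_add]; exact e3 x) j
      rwa [z, zero_add] at this
  unfold NB
  rw [mul_assoc]
  exact key.trans (mul_le_mul_of_nonneg_left hb hC)

lemma NB.curlS {t R : ℝ} {n : ℕ} {v : Fin 3 → SP} (h : ∀ i j, NB t n R 1 (dx j (v i))) (i) :
    NB t n R (2 ^ (2 * n) * (1 + 1)) (curlS v i) := by
  have hR := (h 0 0).nonneg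
  have h1 : (1:ℝ) ≤ 2 ^ (2 * n) * (1 + 1) := by
    have : (1:ℝ) ≤ 2 ^ (2 * n) := one_le_pow₀ (by norm_num)
    linarith
  fin_cases i
  · exact (h 2 1).mono hR h1
  · exact (h 2 0).neg.mono hR h1
  · exact (h 1 0).sub (h 0 1)

lemma NB.grS {t R c : ℝ} {n : ℕ} {f : SP} (hn : 1 ≤ n) (hR : 0 ≤ R) (hc : 0 ≤ c)
    (h : ∀ j, NB t n R c (dx j f)) (i) : NB t n R c (grS f i) := by
  fin_cases i
  · exact h 0
  · exact h 1
  · exact .zero hn hR hc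

lemma elliptic (n : ℕ) (hn : 1 ≤ n) {ν γ κ χ : ℝ} : ∃ C : ℝ, ∀ {T t R : ℝ} {ρ P : SP} {u w : Fin 3 → SP},
    Flow T ν γ κ χ ρ P u w → t ∈ Icc 0 T → (∀ i, NB t n R 1 (ρ * Dm u u i)) →
    (∀ i, NB t n R 1 (ρ * Dm u w i)) → (∀ i j, NB t n R 1 (dx j (u i))) →
    (∀ i j, NB t n R 1 (dx j (w i))) → (∀ i, NB t n R 1 (w i)) →
    (∀ j, NB t n R C (dx j P)) ∧ (∀ i j k, NB t n R C (dx j (dx k (u i)))) ∧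
      ∀ i j k, NB t n R C (dx j (dx k (w i))) := by
  obtain ⟨C₁, hC₁, H₁⟩ := cz_I n
  obtain ⟨C₂, hC₂, H₂⟩ := cz_second n hn
  set c₁ := C₂ * (ν⁻¹ ^ (2 * n) * (2 ^ (2 * n) * (2 ^ (2 * n) * (1 + C₁ * 2)
    + (2 * χ) ^ (2 * n) * (2 ^ (2 * n) * (1 + 1))))) with hc₁
  set c₂ := C₁ * (((γ + κ)⁻¹) ^ (2 * n) * (2 ^ (2 * n) * (1 + (4 * χ) ^ (2 * n) * 1)) +
      ((γ + κ)⁻¹) ^ (2 * n) * (2 ^ (2 * n) * (1 + (4 * χ) ^ (2 * n) * 1))) with hc₂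
  set c₃ := C₂ * (γ⁻¹ ^ (2 * n) * (2 ^ (2 * n) * (2 ^ (2 * n) * (2 ^ (2 * n) * (1 + κ ^ (2 * n) * c₂)
    + (4 * χ) ^ (2 * n) * 1) + (2 * χ) ^ (2 * n) * (2 ^ (2 * n) * (1 + 1))))) with hc₃
  have c₂_nonneg : 0 ≤ c₂ := by simp only [hc₂, pow_mul]; positivity
  refine ⟨max (max (C₁ * 2) c₁) c₃, fun {T t R ρ P u w} F ht hf hg hu hw hz => ?_⟩
  have hR := (hz 0).nonneg
  have hP : ∀ j, NB t n R (C₁ * 2) (dx j P) := fun j => by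
    have h := H₁ t P (-(ρ * Dm u u 0)) (-(ρ * Dm u u 1)) (fun x => ?_) j
    · have h2 := mul_le_mul_of_nonneg_left (add_le_add (hf 0).neg (hf 1).neg) hC₁
      unfold NB; linarith
    · have m0 := dd_ev_eq_zero (F.mom t ht 0) 0 x
      have m1 := dd_ev_eq_zero (F.mom t ht 1) 1 x
      have d0 : ∀ x, ev t x (lapS (divS u)) = 0 := fun x => by
        rw [lapS, map_add, dd_ev_eq_zero (dd_ev_eq_zero (F.inc t ht) 0) 0,
          dd_ev_eq_zero (dd_ev_eq_zero (F.inc t ht) 1) 1, add_zero]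
      have e := d0 x
      have h2 : ∀ j, dx j (2:SP) = 0 := fun j => by exact_mod_cast (dx j).map_natCast 2
      simp only [lapS, grS, curlS, divS, Fin.isValue, Matrix.cons_val, map_add, map_sub, map_mul, map_neg,
        dd_mul, ev_cst, Derivation.map_algebraMap, h2, mul_zero, add_zero, Dm, map_ofNat, dx_one_zero] at m0 m1 e ⊢
      linear_combination m0 + m1 + ν * e
  have hlu : ∀ i, NB t n R _ (cst ν⁻¹ * (ρ * Dm u u i + grS P i - cst (2 * χ) * curlS w i)) := fun i =>
    (((hf i).add (NB.grS hn hR (by positivity) hP i)).sub ((NB.curlS hw i).cmul (2 * χ))).cmul ν⁻¹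
  have hU := fun i => H₂ t R _ (u i) _ hR (hlu i) fun x => by
    have hν : ν ≠ 0 := (F.hχ.trans F.hν).ne'
    have m := F.mom t ht i x
    simp only [map_add, map_sub, map_mul, ev_cst, Dm, map_ofNat] at m ⊢
    field_simp
    linarith
  have hG : ∀ i, NB t n R _ (cst (γ + κ)⁻¹ * (ρ * Dm u w i + cst (4 * χ) * w i)) := fun i =>
    ((hg i).add ((hz i).cmul (4 * χ))).cmul (γ + κ)⁻¹
  have hD : ∀ j, NB t n R c₂ (dx j (divS w)) := fun j => by
    have h := H₁ t (divS w) (cst (γ + κ)⁻¹ * (ρ * Dm u w 0 + cst (4 * χ) * w 0))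
      (cst (γ + κ)⁻¹ * (ρ * Dm u w 1 + cst (4 * χ) * w 1)) (fun x => ?_) j
    · have h2 := mul_le_mul_of_nonneg_left (add_le_add (hG 0) (hG 1)) hC₁
      unfold NB; rw [hc₂, mul_assoc, add_mul]; exact h.trans h2
    · have hk : γ + κ ≠ 0 := (add_pos F.hγ F.hκ).ne'
      have m0 := dd_ev_eq_zero (F.ang t ht 0) 0 x
      have m1 := dd_ev_eq_zero (F.ang t ht 1) 1 x
      have h2 : ∀ j, dx j (2:SP) = 0 := fun j => by exact_mod_cast (dx j).map_natCast 2
      have h4 : ∀ j, dx j (4:SP) = 0 := fun j => by exact_mod_cast (dx j).map_natCast 4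
      simp only [lapS, grS, curlS, divS, Fin.isValue, Matrix.cons_val, map_add, map_sub, map_mul, map_neg,
        dd_mul, ev_cst, Derivation.map_algebraMap, h2, h4, mul_zero, add_zero, Dm, map_ofNat, dx_one_zero] at m0 m1 ⊢
      field_simp
      linear_combination -m0 - m1
  have hlw : ∀ i, NB t n R _ (cst γ⁻¹ * (ρ * Dm u w i - cst κ * grS (divS w) i + cst (4 * χ) * w i
      - cst (2 * χ) * curlS u i)) := fun i =>
    (((((hg i).sub ((NB.grS hn hR c₂_nonneg hD i).cmul κ))).add ((hz i).cmul (4 * χ))).sub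
      ((NB.curlS hu i).cmul (2 * χ))).cmul γ⁻¹
  have hW := fun i => H₂ t R _ (w i) _ hR (hlw i) fun x => by
    have hγ : γ ≠ 0 := F.hγ.ne'
    have m := F.ang t ht i x
    simp only [map_add, map_sub, map_mul, ev_cst, Dm, map_ofNat] at m ⊢
    field_simp
    linarith
  exact ⟨fun j => (hP j).mono hR ((le_max_left _ _).trans (le_max_left _ _)),
    fun i j k => (hU i j k).mono hR ((le_max_right _ _).trans (le_max_left _ _)),
    fun i j k => (hW i j k).mono hR (le_max_right _ _)⟩

/-- Solutions without vacuum and with bounded density. -/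
structure BFlow (T μ γ κ χ ρs : ℝ) (ρ P : SP) (u w : Fin 3 → SP) : Prop
    extends Flow T (μ + χ) γ κ χ ρ P u w where
  hμ : 0 < μ
  lower : ∃ c : ℝ, 0 < c ∧ ∀ t ∈ Icc 0 T, ∀ x, c ≤ ev t x ρ
  upper : ∀ t ∈ Icc 0 T, ∀ x, ev t x ρ ≤ ρs

/-- Squared norm of the jet of the solution. -/
def Xn (u w : Fin 3 → SP) (t : ℝ) : ℝ := I t (jsq (jet u w))

/-- Weighted energy of the material derivatives. -/
def Yn (ρ : SP) (u w : Fin 3 → SP) (t : ℝ) : ℝ := I t (eden ρ (Dm u u) (Dm u w))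

/-- Squared norm of the jet of the material derivatives. -/
def Zn (u w : Fin 3 → SP) (t : ℝ) : ℝ := I t (jsq (jD u w))

lemma I_jsq_nonneg (t : ℝ) (J : Jet SP) : 0 ≤ I t (jsq J) :=
  I_nonneg fun x => by rw [ev_jsq]; exact jsq_nonneg _

lemma Xn_nonneg (u w : Fin 3 → SP) (t : ℝ) : 0 ≤ Xn u w t := I_jsq_nonneg _ _

lemma Zn_nonneg (u w : Fin 3 → SP) (t : ℝ) : 0 ≤ Zn u w t := I_jsq_nonneg _ _

lemma I_a_sq_le (t : ℝ) (J : Jet SP) (i j) : I t (J.a i j ^ 2) ≤ I t (jsq J) :=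
  I_mono fun x => by rw [ev_jsq, map_pow]; exact (J.map (ev t x)).sq_a_le i j

lemma I_b_sq_le (t : ℝ) (J : Jet SP) (i j) : I t (J.b i j ^ 2) ≤ I t (jsq J) :=
  I_mono fun x => by rw [ev_jsq, map_pow]; exact (J.map (ev t x)).sq_b_le i j

lemma I_z_sq_le (t : ℝ) (J : Jet SP) (i) : I t (J.z i ^ 2) ≤ I t (jsq J) :=
  I_mono fun x => by rw [ev_jsq, map_pow]; exact (J.map (ev t x)).sq_z_le i

lemma G_fst_le (t : ℝ) (v z : Fin 3 → SP) (i) : G t (v i) ≤ I t (jsq (jet v z)) := by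
  unfold G
  rw [← map_add]
  refine I_mono fun x => ?_
  rw [ev_jsq, map_add, map_pow, map_pow]
  set J := (jet v z).map (ev t x)
  have h2 : ∑ j, J.a i j ^ 2 ≤ ∑ i, ∑ j, J.a i j ^ 2 :=
    Finset.single_le_sum (f := fun i => ∑ j, J.a i j ^ 2) (fun _ _ => by positivity) (Finset.mem_univ i)
  rw [Fin.sum_univ_two] at h2
  have h3 : 0 ≤ ∑ i, ∑ j, J.b i j ^ 2 := by positivity
  have h4 : 0 ≤ ∑ i, J.z i ^ 2 := by positivity
  refine h2.trans ?_
  unfold jsq; linarith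

lemma G_snd_le (t : ℝ) (v z : Fin 3 → SP) (i) : G t (z i) ≤ I t (jsq (jet v z)) := by
  unfold G
  rw [← map_add]
  refine I_mono fun x => ?_
  rw [ev_jsq, map_add, map_pow, map_pow]
  set J := (jet v z).map (ev t x)
  have h2 : ∑ j, J.b i j ^ 2 ≤ ∑ i, ∑ j, J.b i j ^ 2 :=
    Finset.single_le_sum (f := fun i => ∑ j, J.b i j ^ 2) (fun _ _ => by positivity) (Finset.mem_univ i)
  rw [Fin.sum_univ_two] at h2
  have h3 : 0 ≤ ∑ i, ∑ j, J.a i j ^ 2 := by positivity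
  have h4 : 0 ≤ ∑ i, J.z i ^ 2 := by positivity
  refine h2.trans ?_
  unfold jsq; linarith

lemma I_jsq_sq_le {t m : ℝ} {J : Jet SP} (ha : ∀ i j, I t (J.a i j ^ 4) ≤ m)
    (hb : ∀ i j, I t (J.b i j ^ 4) ≤ m) (hz : ∀ i, I t (J.z i ^ 4) ≤ m) :
    I t (jsq J ^ 2) ≤ 243 * m := by
  have h : I t (jsq J ^ 2) ≤ I t (cst 18 * ∑ i, ∑ j, J.a i j ^ 4 + cst 18 * ∑ i, ∑ j, J.b i j ^ 4
      + cst 9 * ∑ i, J.z i ^ 4) := I_mono fun x => by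
    simp only [map_pow, map_add, map_mul, map_sum, ev_cst, jsq]
    have k1 : ∀ f : Fin 3 → Fin 2 → ℝ, (∑ i, ∑ j, f i j ^ 2) ^ 2 ≤ 6 * ∑ i, ∑ j, f i j ^ 4 := fun f => by
      have h1 := sq_sum_le_card_mul_sum_sq (s := Finset.univ) (f := fun q : Fin 3 × Fin 2 => f q.1 q.2 ^ 2)
      simp only [Finset.card_univ, Fintype.card_prod, Fintype.card_fin, Fintype.sum_prod_type] at h1
      have e : ∀ i j, (f i j ^ 2) ^ 2 = f i j ^ 4 := fun i j => by ring
      simp only [e] at h1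
      simpa only [Nat.cast_mul, Nat.cast_ofNat, show (3 : ℝ) * 2 = 6 by norm_num] using h1
    have k2 : ∀ f : Fin 3 → ℝ, (∑ i, f i ^ 2) ^ 2 ≤ 3 * ∑ i, f i ^ 4 := fun f => by
      have h1 := sq_sum_le_card_mul_sum_sq (s := Finset.univ) (f := fun q : Fin 3 => f q ^ 2)
      simp only [Finset.card_univ, Fintype.card_fin] at h1
      have e : ∀ i, (f i ^ 2) ^ 2 = f i ^ 4 := fun i => by ring
      simp only [e] at h1
      norm_num at h1
      exact h1
    have a := k1 fun i j => ev t x (J.a i j)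
    have b := k1 fun i j => ev t x (J.b i j)
    have c := k2 fun i => ev t x (J.z i)
    generalize (∑ i, ∑ j, ev t x (J.a i j) ^ 2) = A at *
    generalize (∑ i, ∑ j, ev t x (J.b i j) ^ 2) = B at *
    generalize (∑ i, ev t x (J.z i) ^ 2) = C at *
    nlinarith [sq_nonneg (A - B), sq_nonneg (B - C), sq_nonneg (A - C)]
  simp only [map_add, I_smul_eq, map_sum] at h
  have a : ∑ i, ∑ j, I t (J.a i j ^ 4) ≤ 6 * m := by
    refine (Finset.sum_le_card_nsmul _ _ (2 * m) fun i _ => ?_).trans (by simp; linarith)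
    exact (Finset.sum_le_card_nsmul _ _ m fun j _ => ha i j).trans (by simp)
  have b : ∑ i, ∑ j, I t (J.b i j ^ 4) ≤ 6 * m := by
    refine (Finset.sum_le_card_nsmul _ _ (2 * m) fun i _ => ?_).trans (by simp; linarith)
    exact (Finset.sum_le_card_nsmul _ _ m fun j _ => hb i j).trans (by simp)
  have c : ∑ i, I t (J.z i ^ 4) ≤ 3 * m :=
    (Finset.sum_le_card_nsmul _ _ m fun j _ => hz j).trans (by simp)
  linarith

lemma young_mul (a b : ℝ) {l : ℝ} (hl : 0 < l) : a * b ≤ l * a ^ 2 + l⁻¹ * b ^ 2 := by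
  have h : l * a ^ 2 + l⁻¹ * b ^ 2 - a * b = l⁻¹ * ((l * a - b / 2) ^ 2 + 3 / 4 * b ^ 2) := by
    field_simp; ring
  have : 0 ≤ l⁻¹ * ((l * a - b / 2) ^ 2 + 3 / 4 * b ^ 2) := by positivity
  linarith

namespace BFlow

variable {T μ γ κ χ ρs : ℝ} {ρ P : SP} {u w : Fin 3 → SP}

lemma rho_pos (F : BFlow T μ γ κ χ ρs ρ P u w) {t : ℝ} (ht : t ∈ Icc 0 T) (x : Vec 2) :
    0 < ev t x ρ := by
  obtain ⟨c, hc, h⟩ := F.lower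
  exact hc.trans_le (h t ht x)

lemma rhos_pos (F : BFlow T μ γ κ χ ρs ρ P u w) {t : ℝ} (ht : t ∈ Icc 0 T) : 0 < ρs :=
  (F.rho_pos ht 0).trans_le (F.upper t ht 0)

lemma eden_nonneg (F : BFlow T μ γ κ χ ρs ρ P u w) {t : ℝ} (ht : t ∈ Icc 0 T) (v z : Fin 3 → SP) :
    0 ≤ I t (eden ρ v z) := I_nonneg fun x => by
  simp only [eden, dotS, map_mul, map_add, map_sum]
  refine mul_nonneg (F.rho_pos ht x).le (add_nonneg ?_ ?_) <;>
    exact Finset.sum_nonneg fun i _ => mul_self_nonneg _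

lemma I_rho_sq_le (F : BFlow T μ γ κ χ ρs ρ P u w) {t : ℝ} (ht : t ∈ Icc 0 T) (v z : Fin 3 → SP) (i) :
    I t ((ρ * v i) ^ 2) ≤ ρs * I t (eden ρ v z) ∧ I t ((ρ * z i) ^ 2) ≤ ρs * I t (eden ρ v z) := by
  rw [← I_smul_eq]
  have key : ∀ x, ev t x (cst ρs * eden ρ v z) =
      ρs * (ev t x ρ * (∑ i, ev t x (v i) ^ 2 + ∑ i, ev t x (z i) ^ 2)) := fun x => by
    simp only [eden, dotS, map_mul, map_add, map_sum, ev_cst, ← sq, map_pow]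
  have k2 : ∀ x (a : ℝ), a ^ 2 ≤ ∑ i, ev t x (v i) ^ 2 + ∑ i, ev t x (z i) ^ 2 →
      (ev t x ρ * a) ^ 2 ≤ ev t x (cst ρs * eden ρ v z) := fun x a ha => by
    rw [key, mul_pow, sq (ev t x ρ), mul_assoc]
    have h0 := (F.rho_pos ht x).le
    exact mul_le_mul (F.upper t ht x) (mul_le_mul_of_nonneg_left ha h0) (by positivity)
      (F.rhos_pos ht).le
  constructor <;> refine I_mono fun x => ?_ <;> rw [map_pow, map_mul] <;> refine k2 x _ ?_
  · have := Finset.single_le_sum (f := fun i => ev t x (v i) ^ 2) (fun _ _ => sq_nonneg _) (Finset.mem_univ i)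
    have : 0 ≤ ∑ i, ev t x (z i) ^ 2 := by positivity
    linarith
  · have := Finset.single_le_sum (f := fun i => ev t x (z i) ^ 2) (fun _ _ => sq_nonneg _) (Finset.mem_univ i)
    have : 0 ≤ ∑ i, ev t x (v i) ^ 2 := by positivity
    linarith

lemma second_order (μ γ κ χ ρs : ℝ) : ∃ C : ℝ, 0 ≤ C ∧ ∀ {T : ℝ} {ρ P : SP} {u w : Fin 3 → SP},
    BFlow T μ γ κ χ ρs ρ P u w → ∀ {t : ℝ}, t ∈ Icc 0 T →
    G t P ≤ C * (Xn u w t + Yn ρ u w t) ∧ (∀ i k, G t (dx k (u i)) ≤ C * (Xn u w t + Yn ρ u w t)) ∧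
      ∀ i k, G t (dx k (w i)) ≤ C * (Xn u w t + Yn ρ u w t) := by
  obtain ⟨C, h⟩ := elliptic 1 le_rfl (ν := μ + χ) (γ := γ) (κ := κ) (χ := χ)
  refine ⟨2 * (|C| * (1 + |ρs|)), by positivity, fun {T ρ P u w} F {t} ht => ?_⟩
  have hX := Xn_nonneg u w t
  have hY := F.eden_nonneg ht (Dm u u) (Dm u w)
  change 0 ≤ Yn ρ u w t at hY
  set R := (1 + |ρs|) * (Xn u w t + Yn ρ u w t)
  have hs := F.rhos_pos ht
  have as : |ρs| = ρs := abs_of_pos hs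
  have hXR : Xn u w t ≤ R := by simp only [R, as]; nlinarith [mul_nonneg hs.le hX, mul_nonneg hs.le hY]
  have hYR : ρs * Yn ρ u w t ≤ R := by
    simp only [R, as]; nlinarith [mul_nonneg hs.le hX, mul_nonneg hs.le hY]
  have hR : 0 ≤ R := hX.trans hXR
  have e : ∀ f : SP, I t (f ^ 2) ≤ R → NB t 1 R 1 f := fun f hf => by
    unfold NB; rw [one_mul, mul_one]; exact hf
  obtain ⟨h1, h2, h3⟩ := h F.toFlow ht
    (fun i => e _ ((F.I_rho_sq_le ht (Dm u u) (Dm u w) i).1.trans hYR))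
    (fun i => e _ ((F.I_rho_sq_le ht (Dm u u) (Dm u w) i).2.trans hYR))
    (fun i j => e _ ((I_a_sq_le t (jet u w) i j).trans hXR))
    (fun i j => e _ ((I_b_sq_le t (jet u w) i j).trans hXR))
    (fun i => e _ ((I_z_sq_le t (jet u w) i).trans hXR))
  have k : ∀ f : SP, NB t 1 R C f → I t (f ^ 2) ≤ |C| * R := fun f hf => hf.mono hR (le_abs_self C)
  have k2 : ∀ f : SP, (∀ j, NB t 1 R C (dx j f)) → G t f ≤
      2 * (|C| * (1 + |ρs|)) * (Xn u w t + Yn ρ u w t) := fun f hf => by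
    have := k _ (hf 0)
    have := k _ (hf 1)
    have e : 2 * (|C| * (1 + |ρs|)) * (Xn u w t + Yn ρ u w t) = |C| * R + |C| * R := by
      simp only [R]; ring
    rw [e]; unfold G; linarith
  exact ⟨k2 _ h1, fun i k => k2 _ fun j => h2 i j k, fun i k => k2 _ fun j => h3 i j k⟩

lemma quartic (μ γ κ χ ρs : ℝ) : ∃ C : ℝ, 0 ≤ C ∧ ∀ {T : ℝ} {ρ P : SP} {u w : Fin 3 → SP},
    BFlow T μ γ κ χ ρs ρ P u w → ∀ {t : ℝ}, t ∈ Icc 0 T →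
    I t (jsq (jet u w) ^ 2) ≤ C * (Xn u w t * (Xn u w t + Yn ρ u w t)) := by
  obtain ⟨C, hC, h⟩ := second_order μ γ κ χ ρs
  refine ⟨243 * (6 + 4 * C), by positivity, fun {T ρ P u w} F {t} ht => ?_⟩
  obtain ⟨-, h2, h3⟩ := h F ht
  have hX := Xn_nonneg u w t
  have hY : 0 ≤ Yn ρ u w t := F.eden_nonneg ht (Dm u u) (Dm u w)
  rw [mul_assoc]
  have key : ∀ f : SP, I t (f ^ 2) ≤ Xn u w t → G t f ≤ Xn u w t + C * (Xn u w t + Yn ρ u w t) →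
      I t (f ^ 4) ≤ (6 + 4 * C) * (Xn u w t * (Xn u w t + Yn ρ u w t)) := fun f h1 h2 => by
    refine (lady_I t f).trans ?_
    have h0 := I_sq_nonneg t f
    have hG := G_nonneg t f
    refine (mul_le_mul h1 (c := 2 * I t (f ^ 2) + 4 * G t f)
      (d := (6 + 4 * C) * (Xn u w t + Yn ρ u w t)) ?_ (by positivity) hX).trans (by linarith)
    nlinarith
  have hc : 0 ≤ C * (Xn u w t + Yn ρ u w t) := by positivity
  refine I_jsq_sq_le (fun i j => key _ (I_a_sq_le t (jet u w) i j) ?_)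
    (fun i j => key _ (I_b_sq_le t (jet u w) i j) ?_) fun i => key _ (I_z_sq_le t (jet u w) i) ?_
  · have := h2 i j
    simp only [jet]; linarith
  · have := h3 i j
    simp only [jet]; linarith
  · have := G_snd_le t u w i
    simp only [jet]; unfold Xn at *; linarith

lemma pressure_term (μ γ κ χ ρs : ℝ) {ε : ℝ} (hε : 0 < ε) : ∃ C : ℝ, 0 ≤ C ∧
    ∀ {T : ℝ} {ρ P : SP} {u w : Fin 3 → SP},
    BFlow T μ γ κ χ ρs ρ P u w → ∀ {t : ℝ}, t ∈ Icc 0 T →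
    |I t (P * trS u u)| ≤ ε * (Xn u w t + Yn ρ u w t) + C * Xn u w t ^ 2 := by
  obtain ⟨C₁, hC₁, h₁⟩ := second_order μ γ κ χ ρs
  obtain ⟨C₂, hC₂, h₂⟩ := wente_I
  set l := ε / (C₁ + 1)
  have hl : 0 < l := by positivity
  refine ⟨l⁻¹ * (2 * C₂) ^ 2, by positivity, fun {T ρ P u w} F {t} ht => ?_⟩
  have hP := (h₁ F ht).1
  have hX := Xn_nonneg u w t
  have hY : 0 ≤ Yn ρ u w t := F.eden_nonneg ht (Dm u u) (Dm u w)
  have e : I t (P * trS u u) = I t (cst (-2) * (P * (dx 0 (u 0) * dx 1 (u 1) - dx 1 (u 0) * dx 0 (u 1)))) :=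
    I_congr fun x => by
      have h := F.inc t ht x
      simp only [divS, map_add] at h
      simp only [trS, map_mul, map_add, map_sub, ev_cst]
      linear_combination (ev t x P) * (ev t x (dx 0 (u 0)) + ev t x (dx 1 (u 1))) * h
  have h := h₂ t P (u 0) (u 1)
  have g0 : √(G t (u 0)) ≤ √(Xn u w t) := sqrt_le_sqrt (G_fst_le t u w 0)
  have g1 : √(G t (u 1)) ≤ √(Xn u w t) := sqrt_le_sqrt (G_fst_le t u w 1)
  have g2 : √(G t (u 0)) * √(G t (u 1)) ≤ Xn u w t :=
    (mul_le_mul g0 g1 (sqrt_nonneg _) (sqrt_nonneg _)).trans (mul_self_sqrt hX).le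
  have y := young_mul √(G t P) (2 * C₂ * Xn u w t) hl
  rw [sq_sqrt (G_nonneg t P)] at y
  have h3 : l * G t P ≤ ε * (Xn u w t + Yn ρ u w t) := by
    have : l * C₁ ≤ ε := by
      simp only [l]; rw [div_mul_eq_mul_div, div_le_iff₀ (by positivity)]; nlinarith
    calc l * G t P ≤ l * (C₁ * (Xn u w t + Yn ρ u w t)) := mul_le_mul_of_nonneg_left hP hl.le
      _ = (l * C₁) * (Xn u w t + Yn ρ u w t) := by ring
      _ ≤ _ := mul_le_mul_of_nonneg_right this (by positivity)
  rw [e, I_smul_eq, abs_mul]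
  norm_num
  have h4 : C₂ * (√(G t P) * √(G t (u 0)) * √(G t (u 1))) ≤ C₂ * (√(G t P) * Xn u w t) := by
    rw [mul_assoc √(G t P)]; gcongr
  linarith

lemma beta_young {ν γ κ χ : ℝ} (hν : 0 ≤ ν) (hγ : 0 ≤ γ) (hκ : 0 ≤ κ) (hχ : 0 ≤ χ) (J K : Jet ℝ)
    {l : ℝ} (hl : 0 < l) :
    |beta ν γ κ χ J K| ≤ betaC ν γ κ χ * (l * jsq J + l⁻¹ * jsq K) := by
  have h := young_mul √(jsq J) √(jsq K) hl
  rw [sq_sqrt (jsq_nonneg J), sq_sqrt (jsq_nonneg K)] at h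
  exact (beta_abs_le hν hγ hκ hχ J K).trans (mul_le_mul_of_nonneg_left h (by unfold betaC; positivity))

lemma stretch_term (μ γ κ χ ρs : ℝ) {ε : ℝ} (hε : 0 < ε) : ∃ C : ℝ, 0 ≤ C ∧
    ∀ {T : ℝ} {ρ P : SP} {u w : Fin 3 → SP},
    BFlow T μ γ κ χ ρs ρ P u w → ∀ {t : ℝ}, t ∈ Icc 0 T →
    -I t (bet (μ + χ) γ κ χ (jact (jet u w) (jet u w)) (jet u w)) ≤
      ε * (Xn u w t + Yn ρ u w t) + C * (1 + Xn u w t) * Xn u w t := by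
  obtain ⟨C, hC, h⟩ := quartic μ γ κ χ ρs
  set B := |betaC (μ + χ) γ κ χ|
  set b := B * C / ε + 1
  have hb : 0 < b := by positivity
  refine ⟨B * b, by positivity, fun {T ρ P u w} F {t} ht => ?_⟩
  have hX := Xn_nonneg u w t
  have hY : 0 ≤ Yn ρ u w t := F.eden_nonneg ht (Dm u u) (Dm u w)
  have hν : 0 ≤ μ + χ := (F.hχ.trans F.hν).le
  have hB : betaC (μ + χ) γ κ χ = B := (abs_of_nonneg (by
    have := F.hγ; have := F.hκ; have := F.hχ
    unfold betaC; positivity)).symm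
  set l := b * (1 + Xn u w t)
  have hl : 0 < l := by positivity
  have h1 : I t (cst (-1) * bet (μ + χ) γ κ χ (jact (jet u w) (jet u w)) (jet u w)) ≤
      I t (cst B * (cst l⁻¹ * jsq (jet u w) ^ 2 + cst l * jsq (jet u w))) := I_mono fun x => by
    simp only [map_mul, map_add, map_pow, ev_cst, ev_bet, map_jact, ev_jsq]
    have y := beta_young hν F.hγ.le F.hκ.le F.hχ.le (jact ((jet u w).map (ev t x)) ((jet u w).map (ev t x)))
      ((jet u w).map (ev t x)) (inv_pos.2 hl)
    rw [hB, inv_inv] at y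
    have y2 := jsq_jact_le ((jet u w).map (ev t x)) ((jet u w).map (ev t x))
    have y3 := neg_le_of_abs_le y
    have y4 := mul_le_mul_of_nonneg_left (mul_le_mul_of_nonneg_left y2 (inv_pos.2 hl).le)
      (abs_nonneg _ : 0 ≤ B)
    rw [← sq] at y4
    linarith
  rw [I_smul_eq, I_smul_eq, map_add, I_smul_eq, I_smul_eq] at h1
  have h2 := h F ht
  have h3 : B * (l⁻¹ * I t (jsq (jet u w) ^ 2)) ≤ ε * (Xn u w t + Yn ρ u w t) := by
    have i1 : l⁻¹ * I t (jsq (jet u w) ^ 2) ≤ b⁻¹ * C * (Xn u w t + Yn ρ u w t) := by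
      rw [inv_mul_le_iff₀ hl]
      refine h2.trans ?_
      have : l * (b⁻¹ * C * (Xn u w t + Yn ρ u w t)) = C * ((1 + Xn u w t) * (Xn u w t + Yn ρ u w t)) := by
        simp only [l]; field_simp
      rw [this]
      gcongr; linarith
    have i2 : B * (b⁻¹ * C) ≤ ε := by
      have : B * (b⁻¹ * C) = (B * C) / b := by field_simp
      rw [this, div_le_iff₀ hb]
      simp only [b]
      rw [mul_add, mul_div_cancel₀ _ hε.ne']; linarith
    calc _ ≤ B * (b⁻¹ * C * (Xn u w t + Yn ρ u w t)) := mul_le_mul_of_nonneg_left i1 (abs_nonneg _)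
      _ = (B * (b⁻¹ * C)) * (Xn u w t + Yn ρ u w t) := by ring
      _ ≤ _ := mul_le_mul_of_nonneg_right i2 (by positivity)
  have h4 : B * (l * I t (jsq (jet u w))) = B * b * (1 + Xn u w t) * Xn u w t := by
    simp only [l, Xn]; ring
  linarith

/-- Differential inequality for the dissipation. -/
lemma diss_ineq (μ γ κ χ ρs : ℝ) : ∃ C : ℝ, 0 ≤ C ∧
    ∀ {T : ℝ} {ρ P : SP} {u w : Fin 3 → SP},
    BFlow T μ γ κ χ ρs ρ P u w → ∀ {t : ℝ}, t ∈ Icc 0 T →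
    -2 * Yn ρ u w t + 2 * I t (P * trS u u)
        - 2 * I t (bet (μ + χ) γ κ χ (jact (jet u w) (jet u w)) (jet u w)) ≤
      - Yn ρ u w t + C * (1 + Xn u w t) * Xn u w t := by
  obtain ⟨C₁, hC₁, h₁⟩ := pressure_term μ γ κ χ ρs (ε := 1 / 4) (by norm_num)
  obtain ⟨C₂, hC₂, h₂⟩ := stretch_term μ γ κ χ ρs (ε := 1 / 4) (by norm_num)
  refine ⟨2 * C₁ + 2 * C₂ + 1, by positivity, fun {T ρ P u w} F {t} ht => ?_⟩
  have hX := Xn_nonneg u w t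
  have a := (le_abs_self _).trans (h₁ F ht)
  have b := h₂ F ht
  nlinarith [mul_nonneg hC₁ hX, sq_nonneg (Xn u w t)]

end BFlow

lemma stretch_pointwise {ν γ κ χ : ℝ} (hν : 0 ≤ ν) (hγ : 0 ≤ γ) (hκ : 0 ≤ κ) (hχ : 0 ≤ χ)
    (J K : Jet ℝ) (q : ℝ) {l : ℝ} (hl : 0 < l) :
    beta ν γ κ χ (jact J J) K + beta ν γ κ χ J (jact J K) - 3 * (q * jtr J K) ≤
      (2 * betaC ν γ κ χ + 12) * l * jsq K + (2 * betaC ν γ κ χ + 12) * l⁻¹ * jsq J ^ 2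
        + 12 * l⁻¹ * q ^ 4 := by
  have hB : 0 ≤ betaC ν γ κ χ := by unfold betaC; positivity
  have b1 := (le_abs_self _).trans (beta_abs_le hν hγ hκ hχ (jact J J) K)
  have b2 := (le_abs_self _).trans (beta_abs_le hν hγ hκ hχ J (jact J K))
  have b3 := jtr_abs_le J K
  generalize betaC ν γ κ χ = B at *
  have e1 := jsq_jact_le J J
  have e2 := jsq_jact_le J K
  have es : jsq J = √(jsq J) ^ 2 := (sq_sqrt (jsq_nonneg J)).symm
  have er : jsq K = √(jsq K) ^ 2 := (sq_sqrt (jsq_nonneg K)).symm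
  have hs : 0 ≤ √(jsq J) := sqrt_nonneg _
  have hr : 0 ≤ √(jsq K) := sqrt_nonneg _
  generalize √(jsq J) = s at *
  generalize √(jsq K) = r at *
  rw [es] at e1 e2
  rw [er] at e2
  rw [es, er]
  have a1 : √(jsq (jact J J)) ≤ s ^ 2 := by
    rw [sqrt_le_left (by positivity)]
    exact e1.trans (by ring : s ^ 2 * s ^ 2 = (s ^ 2) ^ 2).le
  have a2 : √(jsq (jact J K)) ≤ s * r := by
    rw [sqrt_le_left (by positivity)]
    exact e2.trans (by ring : s ^ 2 * r ^ 2 = (s * r) ^ 2).le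
  have y1 := young_mul r (s ^ 2) hl
  have c1 : B * (√(jsq (jact J J)) * r) ≤ B * (l * r ^ 2 + l⁻¹ * (s ^ 2) ^ 2) := by
    refine mul_le_mul_of_nonneg_left (le_trans ?_ y1) hB
    rw [mul_comm r]; exact mul_le_mul_of_nonneg_right a1 hr
  have c2 : B * (s * √(jsq (jact J K))) ≤ B * (l * r ^ 2 + l⁻¹ * (s ^ 2) ^ 2) := by
    refine mul_le_mul_of_nonneg_left (le_trans ?_ y1) hB
    exact (mul_le_mul_of_nonneg_left a2 hs).trans (by ring_nf; rfl)
  have y2 := young_mul r (|q| * s) hl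
  have c3 : -(q * jtr J K) ≤ 4 * (l * r ^ 2 + l⁻¹ * (q ^ 4 + (s ^ 2) ^ 2)) := by
    have d1 : |q * jtr J K| ≤ |q| * (4 * (s * r)) := by
      rw [abs_mul]; exact mul_le_mul_of_nonneg_left b3 (abs_nonneg _)
    have d2 : (|q| * s) ^ 2 ≤ q ^ 4 + (s ^ 2) ^ 2 := by
      rw [mul_pow, sq_abs]
      nlinarith [sq_nonneg (q ^ 2 - s ^ 2), sq_nonneg (s ^ 2), sq_nonneg (q ^ 2)]
    have d3 := mul_le_mul_of_nonneg_left d2 (inv_pos.2 hl).le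
    have d4 := neg_le_of_abs_le d1
    linarith
  linarith

namespace BFlow

variable {T μ γ κ χ ρs : ℝ} {ρ P : SP} {u w : Fin 3 → SP}

lemma pressure_quartic (μ γ κ χ ρs : ℝ) : ∃ C : ℝ, 0 ≤ C ∧
    ∀ {T : ℝ} {ρ P : SP} {u w : Fin 3 → SP},
    BFlow T μ γ κ χ ρs ρ P u w → ∀ {t : ℝ}, t ∈ Icc 0 T →
    I t ((P - cst (I t P)) ^ 4) ≤ C * (Xn u w t + Yn ρ u w t) ^ 2 := by
  obtain ⟨C₁, hC₁, h₁⟩ := second_order μ γ κ χ ρs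
  refine ⟨6 * C₁ ^ 2, by positivity, fun {T ρ P u w} F {t} ht => ?_⟩
  have q0 : I t (P - cst (I t P)) = 0 := by
    have := I_smul_eq t (I t P) 1
    rw [mul_one, I_one, mul_one] at this
    rw [map_sub, this, sub_self]
  have qG : G t (P - cst (I t P)) = G t P := by
    simp only [G, map_sub, cst, Derivation.map_algebraMap, sub_zero]
  have p := poincare_I q0
  rw [qG] at p
  have g := (h₁ F ht).1
  have h0 := I_sq_nonneg t (P - cst (I t P))
  have hG := G_nonneg t P
  have ly := lady_I t (P - cst (I t P))
  rw [qG] at ly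
  calc _ ≤ _ := ly
    _ ≤ G t P * (2 * G t P + 4 * G t P) := by gcongr
    _ = 6 * G t P ^ 2 := by ring
    _ ≤ 6 * (C₁ * (Xn u w t + Yn ρ u w t)) ^ 2 := by gcongr
    _ = _ := by ring

/-- Dissipation inequality for the material derivatives. -/
lemma second_ineq (μ γ κ χ ρs : ℝ) (hμ : 0 < μ) (hγ : 0 < γ) (hκ : 0 < κ) (hχ : 0 < χ) :
    ∃ c C : ℝ, 0 < c ∧ 0 ≤ C ∧
    ∀ {T : ℝ} {ρ P : SP} {u w : Fin 3 → SP},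
    BFlow T μ γ κ χ ρs ρ P u w → ∀ {t : ℝ}, t ∈ Icc 0 T →
    - I t (bet (μ + χ) γ κ χ (jD u w) (jD u w))
        + I t (bet (μ + χ) γ κ χ (jact (jet u w) (jet u w)) (jD u w))
        + I t (bet (μ + χ) γ κ χ (jet u w) (jact (jet u w) (jD u w)))
        - 3 * I t ((P - cst (I t P)) * trS u (Dm u u)) ≤
      - c * Zn u w t + C * (Xn u w t + Yn ρ u w t) ^ 2 := by
  obtain ⟨C₁, hC₁, h₁⟩ := pressure_quartic μ γ κ χ ρs
  obtain ⟨C₂, hC₂, h₂⟩ := quartic μ γ κ χ ρs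
  have hc : 0 < coer μ γ χ := coer_pos hμ hγ hχ
  have hB : 0 ≤ betaC (μ + χ) γ κ χ := by unfold betaC; positivity
  obtain ⟨l, hl, hl2⟩ : ∃ l : ℝ, 0 < l ∧ (2 * betaC (μ + χ) γ κ χ + 12) * l = coer μ γ χ / 2 :=
    ⟨coer μ γ χ / (2 * (2 * betaC (μ + χ) γ κ χ + 12)), by positivity, by field_simp⟩
  refine ⟨coer μ γ χ / 2, (2 * betaC (μ + χ) γ κ χ + 12) * l⁻¹ * C₂ + 12 * l⁻¹ * C₁,
    by positivity, by positivity, fun {T ρ P u w} F {t} ht => ?_⟩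
  have hX := Xn_nonneg u w t
  have hY : 0 ≤ Yn ρ u w t := F.eden_nonneg ht (Dm u u) (Dm u w)
  have hco : coer μ γ χ * Zn u w t ≤ I t (bet (μ + χ) γ κ χ (jD u w) (jD u w)) :=
    coercive hμ hγ hκ hχ t (Dm u u) (Dm u w)
  have hq4 := h₁ F ht
  generalize I t P = m at *
  have hs4 : I t (jsq (jet u w) ^ 2) ≤ C₂ * (Xn u w t + Yn ρ u w t) ^ 2 := by
    refine (h₂ F ht).trans ?_
    rw [sq]; gcongr; linarith
  have h1 : I t (bet (μ + χ) γ κ χ (jact (jet u w) (jet u w)) (jD u w)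
      + bet (μ + χ) γ κ χ (jet u w) (jact (jet u w) (jD u w))
      - cst 3 * ((P - cst m) * trS u (Dm u u))) ≤
      I t (cst ((2 * betaC (μ + χ) γ κ χ + 12) * l) * jsq (jD u w)
        + cst ((2 * betaC (μ + χ) γ κ χ + 12) * l⁻¹) * jsq (jet u w) ^ 2
        + cst (12 * l⁻¹) * (P - cst m) ^ 4) := I_mono fun x => by
    have h := stretch_pointwise (add_pos hμ hχ).le hγ.le hκ.le hχ.le ((jet u w).map (ev t x))
      ((jD u w).map (ev t x)) (ev t x (P - cst m)) hl
    have e1 : ev t x (trS u (Dm u u)) = jtr ((jet u w).map (ev t x)) ((jD u w).map (ev t x)) :=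
      ev_trS t x u (Dm u u) w (Dm u w)
    rw [map_sub (ev t x) (_ + _), map_add (ev t x) (bet _ _ _ _ _ _), ev_bet, ev_bet, map_jact, map_jact,
      map_mul (ev t x) (cst 3), map_mul (ev t x) (_ - _), e1, ev_cst, map_add (ev t x) (_ + _),
      map_add (ev t x) (_ * _), map_mul (ev t x) _ (jsq _), map_mul (ev t x) _ (jsq _ ^ 2),
      map_mul (ev t x) _ (_ ^ 4), map_pow, map_pow, ev_jsq, ev_jsq, ev_cst, ev_cst, ev_cst]
    exact h
  rw [map_sub (I t) (_ + _), map_add (I t) (bet _ _ _ _ _ _), I_smul_eq, map_add (I t) (_ + _),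
    map_add (I t) (_ * _), I_smul_eq, I_smul_eq, I_smul_eq, hl2] at h1
  have h3 := mul_le_mul_of_nonneg_left hs4
    (by positivity : 0 ≤ (2 * betaC (μ + χ) γ κ χ + 12) * l⁻¹)
  have h4 := mul_le_mul_of_nonneg_left hq4 (by positivity : 0 ≤ 12 * l⁻¹)
  have e1 : I t (jsq (jD u w)) = Zn u w t := rfl
  rw [e1] at h1
  linarith

end BFlow

lemma continuous_I (f : SP) : Continuous fun t => I t f :=
  continuous_iff_continuousAt.2 fun t => (hasDerivAt_I f t).continuousAt

/-- Gronwall's inequality with a dissipation term. -/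
lemma gronwall_diss {T k M : ℝ} {Φ Φ' A D : ℝ → ℝ} (hT : 0 < T) (hΦ : Continuous Φ)
    (hA : Continuous A) (hD : Continuous D) (hA0 : ∀ t ∈ Icc 0 T, 0 ≤ A t)
    (hD0 : ∀ t ∈ Icc 0 T, 0 ≤ D t) (hM : ∫ t in 0..T, A t ≤ M)
    (hd : ∀ t ∈ Ioo 0 T, HasDerivAt Φ (Φ' t) t)
    (hle : ∀ t ∈ Ioo 0 T, Φ' t ≤ -D t + A t * (k + Φ t)) (h0 : ∀ t ∈ Ioo 0 T, 0 ≤ k + Φ t) :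
    (∀ t ∈ Icc 0 T, k + Φ t ≤ exp M * (k + Φ 0)) ∧ ∫ t in 0..T, D t ≤ exp M * (k + Φ 0) := by
  have hp : ∀ t ∈ Icc 0 T, 0 ≤ k + Φ t := by
    have : Icc 0 T ⊆ {t | 0 ≤ k + Φ t} := by
      rw [← closure_Ioo hT.ne]
      exact closure_minimal h0 (isClosed_le continuous_const (continuous_const.add hΦ))
    exact fun t ht => this ht
  have hAi : ∀ t, HasDerivAt (fun t => ∫ s in 0..t, A s) (A t) t := fun t =>
    (hA.integral_hasStrictDerivAt 0 t).hasDerivAt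
  have hDi : ∀ t, HasDerivAt (fun t => ∫ s in 0..t, D s) (D t) t := fun t =>
    (hD.integral_hasStrictDerivAt 0 t).hasDerivAt
  have hAM : ∀ t ∈ Icc 0 T, ∫ s in 0..t, A s ≤ M := fun t ht => by
    have h1 := intervalIntegral.integral_add_adjacent_intervals
      (hA.intervalIntegrable 0 t) (hA.intervalIntegrable t T) (μ := volume)
    have h2 : 0 ≤ ∫ s in t..T, A s := intervalIntegral.integral_nonneg ht.2 fun s hs =>
      hA0 s ⟨ht.1.trans hs.1, hs.2⟩
    linarith
  set Ψ : ℝ → ℝ := fun t => (k + Φ t) * exp (-∫ s in 0..t, A s) + exp (-M) * ∫ s in 0..t, D s with hΨ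
  have hc : Continuous Ψ := by
    have c1 : Continuous fun t => ∫ s in 0..t, A s :=
      continuous_iff_continuousAt.2 fun t => (hAi t).continuousAt
    have c2 : Continuous fun t => ∫ s in 0..t, D s :=
      continuous_iff_continuousAt.2 fun t => (hDi t).continuousAt
    fun_prop
  have hder : ∀ t ∈ Ioo 0 T, HasDerivAt Ψ (Φ' t * exp (-∫ s in 0..t, A s)
      + (k + Φ t) * (exp (-∫ s in 0..t, A s) * -A t) + exp (-M) * D t) t := fun t ht =>
    (((hd t ht).const_add k).mul (hAi t).neg.exp).add ((hDi t).const_mul _)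
  have anti : AntitoneOn Ψ (Icc 0 T) := by
    refine antitoneOn_of_deriv_nonpos (convex_Icc 0 T) hc.continuousOn ?_ ?_ <;> rw [interior_Icc]
    · exact fun t ht => (hder t ht).differentiableAt.differentiableWithinAt
    · intro t ht
      rw [(hder t ht).deriv]
      have ht' := Ioo_subset_Icc_self ht
      have h1 := mul_le_mul_of_nonneg_right (hle t ht) (exp_pos (-∫ s in 0..t, A s)).le
      have h2 := mul_le_mul_of_nonneg_right (exp_le_exp.2 (neg_le_neg (hAM t ht'))) (hD0 t ht')
      nlinarith
  have hΨ0 : Ψ 0 = k + Φ 0 := by simp [hΨ]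
  have hDn : ∀ t ∈ Icc 0 T, 0 ≤ ∫ s in 0..t, D s := fun t ht =>
    intervalIntegral.integral_nonneg ht.1 fun s hs => hD0 s ⟨hs.1, hs.2.trans ht.2⟩
  have main : ∀ t ∈ Icc 0 T, Ψ t ≤ k + Φ 0 := fun t ht => by
    rw [← hΨ0]; exact anti ⟨le_rfl, hT.le⟩ ht ht.1
  refine ⟨fun t ht => ?_, ?_⟩
  · have h1 := main t ht
    have h2 := mul_le_mul_of_nonneg_left (exp_le_exp.2 (neg_le_neg (hAM t ht))) (hp t ht)
    have h3 := mul_nonneg (exp_pos (-M)).le (hDn t ht)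
    have h4 : (k + Φ t) * exp (-M) ≤ k + Φ 0 := by simp only [hΨ] at h1; linarith
    rw [exp_neg, ← div_eq_mul_inv, div_le_iff₀ (exp_pos M)] at h4
    linarith
  · have h1 := main T ⟨hT.le, le_rfl⟩
    have h3 := mul_nonneg (hp T ⟨hT.le, le_rfl⟩) (exp_pos (-∫ s in 0..T, A s)).le
    have h4 : (∫ s in 0..T, D s) * exp (-M) ≤ k + Φ 0 := by simp only [hΨ] at h1; linarith
    rw [exp_neg, ← div_eq_mul_inv, div_le_iff₀ (exp_pos M)] at h4
    linarith

namespace BFlow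

variable {T μ γ κ χ ρs : ℝ} {ρ P : SP} {u w : Fin 3 → SP}

lemma continuous_Xn (u w : Fin 3 → SP) : Continuous (Xn u w) := continuous_I _

lemma continuous_Yn (ρ : SP) (u w : Fin 3 → SP) : Continuous (Yn ρ u w) := continuous_I _

lemma continuous_Zn (u w : Fin 3 → SP) : Continuous (Zn u w) := continuous_I _

/-- The energy estimate. -/
lemma energy_bound (hT : 0 < T) (F : BFlow T μ γ κ χ ρs ρ P u w) :
    ∫ t in 0..T, 2 * I t (bet (μ + χ) γ κ χ (jet u w) (jet u w)) ≤ I 0 (eden ρ u w) := by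
  have hc := coer_pos F.hμ F.hγ F.hχ
  have h := (gronwall_diss (k := 0) (M := 0) (A := fun _ => 0) hT (continuous_I (eden ρ u w))
    continuous_const (D := fun t => 2 * I t (bet (μ + χ) γ κ χ (jet u w) (jet u w)))
    (continuous_const.mul (continuous_I _)) (fun _ _ => le_rfl)
    (fun t _ => by
      have := coercive F.hμ F.hγ F.hκ F.hχ t u w
      have := mul_nonneg hc.le (I_jsq_nonneg t (jet u w))
      linarith)
    (by simp) (fun t ht => F.energy_deriv (Ioo_subset_Icc_self ht)) (fun t _ => by linarith)
    (fun t ht => by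
      have := F.eden_nonneg (Ioo_subset_Icc_self ht) u w
      linarith)).2
  simpa using h

/-- First-order estimates. -/
lemma first_bound (μ γ κ χ ρs T E K : ℝ) (hT : 0 < T) : ∃ C : ℝ, 0 ≤ C ∧
    ∀ {ρ P : SP} {u w : Fin 3 → SP}, BFlow T μ γ κ χ ρs ρ P u w → I 0 (eden ρ u w) ≤ E →
    I 0 (bet (μ + χ) γ κ χ (jet u w) (jet u w)) ≤ K →
    (∀ t ∈ Icc 0 T, Xn u w t ≤ C) ∧ ∫ t in 0..T, Yn ρ u w t ≤ C := by
  obtain ⟨C, hC, hd⟩ := diss_ineq μ γ κ χ ρs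
  set c := coer μ γ χ
  set M := C / c * (T + c⁻¹ * (E / 2))
  refine ⟨max (c⁻¹ * (exp M * K)) (exp M * K) ⊔ 0, le_sup_right, fun {ρ P u w} F hE hK => ?_⟩
  have hc : 0 < c := coer_pos F.hμ F.hγ F.hχ
  set k : ℝ → ℝ := fun t => I t (bet (μ + χ) γ κ χ (jet u w) (jet u w)) with hk
  have ck : Continuous k := continuous_I _
  have hco : ∀ t, c * Xn u w t ≤ k t := fun t => coercive F.hμ F.hγ F.hκ F.hχ t u w
  have hX := Xn_nonneg u w
  have hk0 : ∀ t, 0 ≤ k t := fun t => (mul_nonneg hc.le (hX t)).trans (hco t)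
  have hXk : ∀ t, Xn u w t ≤ c⁻¹ * k t := fun t => by
    rw [le_inv_mul_iff₀ hc]; exact hco t
  have he := F.energy_bound hT
  rw [intervalIntegral.integral_const_mul] at he
  have h := gronwall_diss (k := 0) (M := M) (A := fun t => C / c * (1 + c⁻¹ * k t)) hT ck
    (by fun_prop) (continuous_Yn ρ u w)
    (fun t _ => by have := hk0 t; positivity)
    (fun t ht => F.eden_nonneg ht _ _) (by
      rw [intervalIntegral.integral_const_mul, intervalIntegral.integral_add (by simp)
        ((by fun_prop : Continuous fun t => c⁻¹ * k t).intervalIntegrable 0 T), intervalIntegral.integral_const_mul]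
      simp only [intervalIntegral.integral_const, sub_zero, smul_eq_mul, mul_one]
      have : ∫ t in 0..T, k t ≤ E / 2 := by simp only [hk]; linarith
      simp only [M]; gcongr)
    (fun t ht => F.diss_deriv ht)
    (fun t ht => by
      refine (hd F (Ioo_subset_Icc_self ht)).trans ?_
      have h1 := hXk t
      have h2 : C * (1 + Xn u w t) * Xn u w t ≤ C * (1 + c⁻¹ * k t) * (c⁻¹ * k t) := by
        have := hX t
        have := hk0 t
        gcongr
      have h3 : C * (1 + c⁻¹ * k t) * (c⁻¹ * k t) = C / c * (1 + c⁻¹ * k t) * (0 + k t) := by ring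
      linarith)
    (fun t _ => by have := hk0 t; linarith)
  have h2 : exp M * (0 + k 0) ≤ exp M * K := by rw [zero_add]; gcongr
  refine ⟨fun t ht => ?_, h.2.trans (h2.trans ((le_max_right _ _).trans le_sup_left))⟩
  have h3 := (h.1 t ht).trans h2
  rw [zero_add] at h3
  refine (hXk t).trans (le_trans ?_ ((le_max_left _ _).trans le_sup_left))
  gcongr

/-- Time-weighted estimates for the material derivatives. -/
lemma weighted_bound (μ γ κ χ ρs T E K : ℝ) (hT : 0 < T) : ∃ C : ℝ, 0 ≤ C ∧
    ∀ {ρ P : SP} {u w : Fin 3 → SP}, BFlow T μ γ κ χ ρs ρ P u w → I 0 (eden ρ u w) ≤ E →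
    I 0 (bet (μ + χ) γ κ χ (jet u w) (jet u w)) ≤ K →
    (∀ t ∈ Icc 0 T, Xn u w t ≤ C) ∧ ∫ t in 0..T, Yn ρ u w t ≤ C ∧
      (∀ t ∈ Ioo 0 T, t * Yn ρ u w t ≤ C) ∧ ∫ t in 0..T, t * Zn u w t ≤ C := by
  by_cases hpos : 0 < μ ∧ 0 < γ ∧ 0 < κ ∧ 0 < χ
  swap
  · exact ⟨0, le_rfl, fun F => absurd ⟨F.hμ, F.hγ, F.hκ, F.hχ⟩ hpos⟩
  obtain ⟨hμ, hγ, hκ, hχ⟩ := hpos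
  obtain ⟨B, hB, hf⟩ := first_bound μ γ κ χ ρs T E K hT
  obtain ⟨C₁, hC₁, hp⟩ := pressure_term μ γ κ χ ρs (ε := 1 / 4) (by norm_num)
  obtain ⟨c, C₂, hc, hC₂, hs⟩ := second_ineq μ γ κ χ ρs hμ hγ hκ hχ
  set D := B + C₁ * B ^ 2
  have hD : 0 ≤ D := by positivity
  set k := 1 + T * D + T * B
  have hk : 0 ≤ k := by positivity
  set M := (1 + 4 * C₂) * B + (D + 4 * C₂ * B) * T
  refine ⟨B + 4 * (exp M * k) + c⁻¹ * (exp M * k), by positivity, fun {ρ P u w} F hE hK => ?_⟩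
  obtain ⟨hXB, hYB⟩ := hf F hE hK
  have hX := Xn_nonneg u w
  have hY : ∀ t ∈ Icc 0 T, 0 ≤ Yn ρ u w t := fun t ht => F.eden_nonneg ht _ _
  have bound : ∀ t ∈ Ioo 0 T, 1 / 4 * Yn ρ u w t - D ≤ Flow.FF (μ + χ) γ κ χ ρ u w t ∧
      Flow.FF (μ + χ) γ κ χ ρ u w t ≤ 3 / 4 * Yn ρ u w t + D := fun t ht => by
    have ht' := Ioo_subset_Icc_self ht
    have h1 := abs_le.1 (hp F ht')
    have h2 : C₁ * Xn u w t ^ 2 ≤ C₁ * B ^ 2 := by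
      have := hXB t ht'
      have := hX t
      gcongr
    have h3 := hXB t ht'
    have h4 : Flow.FF (μ + χ) γ κ χ ρ u w t = 1 / 2 * Yn ρ u w t - I t (P * trS u u) := F.FF_eq ht
    simp only [D]
    constructor <;> linarith
  have cF : Continuous (Flow.FF (μ + χ) γ κ χ ρ u w) := by
    have c1 := continuous_I (eden ρ (Dm u u) (Dm u w))
    have c2 := continuous_I (bet (μ + χ) γ κ χ (jet u w) (jD u w))
    unfold Flow.FF; fun_prop
  have tl : ∀ t ∈ Ioo 0 T, t * (Xn u w t + Yn ρ u w t) ≤ 4 * (k + t * Flow.FF (μ + χ) γ κ χ ρ u w t) - 4 :=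
    fun t ht => by
    have h1 := mul_le_mul_of_nonneg_left (bound t ht).1 ht.1.le
    have h2 := hXB t (Ioo_subset_Icc_self ht)
    have h3 : t * Xn u w t ≤ T * B := by have := ht.1; have := ht.2; have := hX t; gcongr
    have h4 : t * D ≤ T * D := by have := ht.2; gcongr
    have h5 : 0 ≤ T * B := by positivity
    simp only [k]; linarith
  have kn : ∀ t ∈ Ioo 0 T, 1 ≤ k + t * Flow.FF (μ + χ) γ κ χ ρ u w t := fun t ht => by
    have := tl t ht
    have := mul_nonneg ht.1.le (add_nonneg (hX t) (hY t (Ioo_subset_Icc_self ht)))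
    linarith
  have h := gronwall_diss (k := k) (M := M) (Φ := fun t => t * Flow.FF (μ + χ) γ κ χ ρ u w t)
    (A := fun t => (1 + 4 * C₂) * Yn ρ u w t + (D + 4 * C₂ * B))
    (D := fun t => c * (t * Zn u w t)) hT (by fun_prop)
    (by have := continuous_Yn ρ u w; fun_prop) (by have := continuous_Zn u w; fun_prop)
    (fun t ht => by have := hY t ht; positivity)
    (fun t ht => by have := Zn_nonneg u w t; have := ht.1; positivity)
    (by
      rw [intervalIntegral.integral_add
        ((by have := continuous_Yn ρ u w; fun_prop :
          Continuous fun t => (1 + 4 * C₂) * Yn ρ u w t).intervalIntegrable 0 T) (by simp),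
        intervalIntegral.integral_const_mul]
      simp only [intervalIntegral.integral_const, sub_zero, smul_eq_mul]
      simp only [M]
      have := mul_le_mul_of_nonneg_left hYB (by positivity : 0 ≤ 1 + 4 * C₂)
      linarith)
    (fun t ht => (hasDerivAt_id t).mul (F.FF_deriv ht (I t P)))
    (fun t ht => by
      have ht' := Ioo_subset_Icc_self ht
      have h1 := mul_le_mul_of_nonneg_left (hs F ht') ht.1.le
      have h2 := (bound t ht).2
      have h3 := tl t ht
      have h4 := kn t ht
      have h5 := hXB t ht'
      have x0 := hX t
      have y0 := hY t ht'
      simp only [id]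
      generalize k + t * Flow.FF (μ + χ) γ κ χ ρ u w t = S at *
      generalize Xn u w t = X at *
      generalize Yn ρ u w t = Y at *
      generalize Zn u w t = Z at *
      have h6 : C₂ * ((X + Y) * (t * (X + Y))) ≤ C₂ * ((B + Y) * (4 * S)) :=
        mul_le_mul_of_nonneg_left (mul_le_mul (by linarith) (by linarith)
          (mul_nonneg ht.1.le (by positivity)) (by positivity)) hC₂
      have h7 : (3 / 4 * Y + D) * 1 ≤ (Y + D) * S :=
        mul_le_mul (by linarith) h4 zero_le_one (by positivity)
      rw [one_mul]
      linarith)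
    (fun t ht => zero_le_one.trans (kn t ht))
  rw [zero_mul, add_zero, intervalIntegral.integral_const_mul] at h
  have e0 : 0 ≤ exp M * k := by positivity
  have e1 : 0 ≤ c⁻¹ * (exp M * k) := by positivity
  refine ⟨fun t ht => (hXB t ht).trans (by linarith), hYB.trans (by linarith), fun t ht => ?_, ?_⟩
  · have h1 := h.1 t (Ioo_subset_Icc_self ht)
    have h2 := tl t ht
    have h3 := mul_nonneg ht.1.le (hX t)
    linarith
  · have h1 := h.2
    rw [mul_comm, ← le_div_iff₀ hc, div_eq_inv_mul] at h1
    linarith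

end BFlow

lemma pow_tangent {x y : ℝ} (hx : 0 ≤ x) (hy : 0 ≤ y) (n : ℕ) :
    y ^ (n + 1) + (n + 1) * y ^ n * (x - y) ≤ x ^ (n + 1) := by
  induction n with
  | zero => simp
  | succ n ih =>
    have h1 := mul_le_mul_of_nonneg_left ih hx
    have h2 : 0 ≤ (n + 1 : ℝ) * y ^ n * (x - y) ^ 2 := by positivity
    push_cast
    calc _ = x * (y ^ (n + 1) + (n + 1) * y ^ n * (x - y)) - (n + 1 : ℝ) * y ^ n * (x - y) ^ 2 := by ring
      _ ≤ x * x ^ (n + 1) := by linarith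
      _ = _ := by ring

lemma even_pow_tangent (m f : ℝ) (n : ℕ) :
    m ^ (2 * (n + 1)) - 2 * (n + 1) * m ^ (2 * n + 1) * f ≤ (f - m) ^ (2 * (n + 1)) := by
  have h := pow_tangent (sq_nonneg (f - m)) (sq_nonneg m) n
  rw [← pow_mul, ← pow_mul, ← pow_mul] at h
  have h2 : 0 ≤ (n + 1 : ℝ) * m ^ (2 * n) * f ^ 2 := by rw [pow_mul]; positivity
  refine le_trans ?_ h
  have e : m ^ (2 * (n + 1)) + (n + 1) * m ^ (2 * n) * ((f - m) ^ 2 - m ^ 2) -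
      (m ^ (2 * (n + 1)) - 2 * (n + 1) * m ^ (2 * n + 1) * f) = (n + 1 : ℝ) * m ^ (2 * n) * f ^ 2 := by ring
  linarith

/-- Moments of a density-weighted field with vanishing momentum. -/
lemma weighted_moment (n : ℕ) (hn : 1 ≤ n) : ∃ C : ℝ, 0 ≤ C ∧ ∀ {t R : ℝ} {ρ f : SP},
    (∀ x, 0 ≤ ev t x ρ) → (∀ x, ev t x ρ ≤ R) → I t (ρ * f) = 0 →
    I t ((ρ * f) ^ (2 * n)) ≤ C * R ^ (2 * n) * G t f ^ n := by
  obtain ⟨n, rfl⟩ : ∃ m, n = m + 1 := ⟨n - 1, by omega⟩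
  obtain ⟨C, hC, h⟩ := sobolev_I (n + 1)
  refine ⟨2 ^ (2 * (n + 1)) * 2 * (C * 2 ^ (n + 1)), by positivity, fun {t R ρ f} h0 h1 hz => ?_⟩
  have hR : 0 ≤ R := (h0 0).trans (h1 0)
  set m := I t f with hm
  set v := f - cst m with hv
  have iv : I t v = 0 := by
    have := I_smul_eq t m 1
    rw [mul_one, I_one, mul_one] at this
    rw [hv, map_sub, this, hm, sub_self]
  have gv : G t v = G t f := by
    simp only [G, hv, map_sub, cst, Derivation.map_algebraMap, sub_zero]
  have hV : I t (v ^ (2 * (n + 1))) ≤ C * 2 ^ (n + 1) * G t f ^ (n + 1) := by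
    refine (h t v).trans ?_
    rw [mul_assoc, ← mul_pow]
    have := I_sq_nonneg t v
    have := G_nonneg t f
    have p := poincare_I iv
    rw [gv] at p ⊢
    gcongr; linarith
  have hV0 := I_even_nonneg t v (n + 1)
  have hM : I t (ρ * cst (m ^ (2 * (n + 1)))) ≤ R * I t (v ^ (2 * (n + 1))) := by
    have k : I t (ρ * cst (m ^ (2 * (n + 1))) - cst (2 * (n + 1) * m ^ (2 * n + 1)) * (ρ * f)) ≤
        I t (cst R * v ^ (2 * (n + 1))) := I_mono fun x => by
      simp only [hv, map_sub, map_mul, map_pow, ev_cst]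
      have a := mul_le_mul_of_nonneg_left (even_pow_tangent m (ev t x f) n) (h0 x)
      have b := mul_le_mul_of_nonneg_right (h1 x)
        (by rw [pow_mul]; positivity : 0 ≤ (ev t x f - m) ^ (2 * (n + 1)))
      linarith
    rw [map_sub, I_smul_eq, hz, mul_zero, sub_zero, I_smul_eq] at k
    exact k
  have key : I t ((ρ * f) ^ (2 * (n + 1))) ≤ I t (cst (R ^ (2 * n + 1)) * (cst (2 ^ (2 * (n + 1))) *
      (cst R * v ^ (2 * (n + 1)) + ρ * cst (m ^ (2 * (n + 1)))))) := I_mono fun x => by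
    simp only [hv, map_sub, map_add, map_mul, map_pow, ev_cst]
    set r := ev t x ρ with hr
    set F := ev t x f
    have r0 : 0 ≤ r := h0 x
    have r1 : r ≤ R := h1 x
    have a : F ^ (2 * (n + 1)) ≤ 2 ^ (2 * (n + 1)) * ((F - m) ^ (2 * (n + 1)) + m ^ (2 * (n + 1))) := by
      have := sub_even_pow_le (F - m) (-m) (n + 1)
      rwa [(even_two_mul (n + 1)).neg_pow, sub_neg_eq_add, sub_add_cancel] at this
    have e0 : 0 ≤ F ^ (2 * (n + 1)) := by rw [pow_mul]; positivity
    have e1 : 0 ≤ (F - m) ^ (2 * (n + 1)) := by rw [pow_mul]; positivity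
    have e2 : 0 ≤ m ^ (2 * (n + 1)) := by rw [pow_mul]; positivity
    calc (r * F) ^ (2 * (n + 1)) = r ^ (2 * n + 1) * (r * F ^ (2 * (n + 1))) := by ring
      _ ≤ R ^ (2 * n + 1) * (r * (2 ^ (2 * (n + 1)) * ((F - m) ^ (2 * (n + 1)) + m ^ (2 * (n + 1))))) := by
          gcongr
      _ = R ^ (2 * n + 1) * (2 ^ (2 * (n + 1)) * (r * (F - m) ^ (2 * (n + 1)) + r * m ^ (2 * (n + 1)))) := by
          ring
      _ ≤ _ := by gcongr
  rw [I_smul_eq, I_smul_eq, map_add, I_smul_eq] at key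
  calc _ ≤ _ := key
    _ ≤ R ^ (2 * n + 1) * (2 ^ (2 * (n + 1)) * (R * I t (v ^ (2 * (n + 1)))
        + R * I t (v ^ (2 * (n + 1))))) := by gcongr
    _ ≤ R ^ (2 * n + 1) * (2 ^ (2 * (n + 1)) * (R * (C * 2 ^ (n + 1) * G t f ^ (n + 1))
        + R * (C * 2 ^ (n + 1) * G t f ^ (n + 1)))) := by gcongr
    _ = _ := by ring

namespace BFlow

variable {T μ γ κ χ ρs : ℝ} {ρ P : SP} {u w : Fin 3 → SP}

lemma momentum_zero (F : BFlow T μ γ κ χ ρs ρ P u w) {t : ℝ} (ht : t ∈ Icc 0 T) (i : Fin 3) :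
    I t (ρ * Dm u u i) = 0 := by
  have h := F.weak ht (Pi.single i 1) 0
  have d1 : ∀ j k, dx j ((Pi.single i 1 : Fin 3 → SP) k) = 0 := fun j k => by
    by_cases hk : k = i
    · subst hk; rw [Pi.single_eq_same, Derivation.map_one_eq_zero]
    · rw [Pi.single_eq_of_ne hk, map_zero]
  have e1 : bet (μ + χ) γ κ χ (jet u w) (jet (Pi.single i 1) 0) = 0 := by
    have hj : ∀ k, jcurl (fun (_ : Fin 3) (_ : Fin 2) => (0 : SP)) k = 0 := fun k => by
      fin_cases k <;> simp [jcurl]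
    simp [beta, jet, d1, hj]
  have e2 : divS (Pi.single i 1 : Fin 3 → SP) = 0 := by
    rw [divS, d1, d1, add_zero]
  rw [e1, e2, mul_zero, map_zero, add_zero] at h
  have e3 : ρ * dotS (fun i => mat u (u i)) (Pi.single i 1) + ρ * dotS (fun i => mat u (w i)) 0 =
      ρ * Dm u u i := by
    simp [dotS, Dm, Pi.single_apply]
  rwa [e3] at h

/-- Higher integrability at a fixed time. -/
lemma moments (μ γ κ χ ρs : ℝ) (n : ℕ) (hn : 1 ≤ n) : ∃ C : ℝ, 0 ≤ C ∧
    ∀ {T : ℝ} {ρ P : SP} {u w : Fin 3 → SP},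
    BFlow T μ γ κ χ ρs ρ P u w → ∀ {t : ℝ}, t ∈ Icc 0 T →
    (∀ j, I t (dx j P ^ (2 * n)) ≤ C * (Xn u w t + Yn ρ u w t + Zn u w t) ^ n) ∧
    (∀ i j k, I t (dx j (dx k (u i)) ^ (2 * n)) ≤ C * (Xn u w t + Yn ρ u w t + Zn u w t) ^ n) ∧
    (∀ i j k, I t (dx j (dx k (w i)) ^ (2 * n)) ≤ C * (Xn u w t + Yn ρ u w t + Zn u w t) ^ n) ∧
    ∀ i, I t (w i ^ (2 * n)) ≤ C * (Xn u w t + Yn ρ u w t + Zn u w t) ^ n := by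
  obtain ⟨C₁, hC₁, h₁⟩ := second_order μ γ κ χ ρs
  obtain ⟨C₂, h₂⟩ := elliptic n hn (ν := μ + χ) (γ := γ) (κ := κ) (χ := χ)
  obtain ⟨C₃, hC₃, h₃⟩ := sobolev_I n
  obtain ⟨C₄, hC₄, h₄⟩ := weighted_moment n hn
  set K := C₃ * (2 + C₁) ^ n + C₄ * |ρs| ^ (2 * n) + |ρs| ^ (2 * n) * (C₃ * 2 ^ n)
  have hK : 0 ≤ K := by positivity
  refine ⟨|C₂| * K + K, by positivity, fun {T ρ P u w} F {t} ht => ?_⟩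
  have hX := Xn_nonneg u w t
  have hY : 0 ≤ Yn ρ u w t := F.eden_nonneg ht (Dm u u) (Dm u w)
  have hZ := Zn_nonneg u w t
  have ρn : ∀ x, 0 ≤ ev t x ρ := fun x => (F.rho_pos ht x).le
  have ρb : ∀ x, ev t x ρ ≤ |ρs| := fun x => (F.upper t ht x).trans (le_abs_self _)
  obtain ⟨-, g1, g2⟩ := h₁ F ht
  set ζ := Xn u w t + Yn ρ u w t + Zn u w t with hζ
  have hζ0 : 0 ≤ ζ := by positivity
  have hR : 0 ≤ K * ζ ^ n := by positivity
  have fb : ∀ f : SP, I t (f ^ 2) ≤ Xn u w t → G t f ≤ ζ + C₁ * ζ → I t (f ^ (2 * n)) ≤ K * ζ ^ n :=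
    fun f k1 k2 => by
      have a : I t (f ^ (2 * n)) ≤ C₃ * ((2 + C₁) * ζ) ^ n := by
        refine (h₃ t f).trans ?_
        have := I_sq_nonneg t f
        have := G_nonneg t f
        gcongr
        linarith
      rw [mul_pow] at a
      have b : 0 ≤ C₄ * |ρs| ^ (2 * n) * ζ ^ n := by positivity
      have c : 0 ≤ |ρs| ^ (2 * n) * (C₃ * 2 ^ n) * ζ ^ n := by positivity
      simp only [K]; linarith
  have xz : C₁ * (Xn u w t + Yn ρ u w t) ≤ C₁ * ζ := by gcongr; linarith
  have cz : 0 ≤ C₁ * ζ := by positivity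
  have fa := fun i j => fb (dx j (u i)) (I_a_sq_le t (jet u w) i j) ((g1 i j).trans (by linarith))
  have fbb := fun i j => fb (dx j (w i)) (I_b_sq_le t (jet u w) i j) ((g2 i j).trans (by linarith))
  have fz := fun i => fb (w i) (I_z_sq_le t (jet u w) i) ((G_snd_le t u w i).trans (by
    change Xn u w t ≤ _; linarith))
  have fu : ∀ i, I t ((ρ * Dm u u i) ^ (2 * n)) ≤ K * ζ ^ n := fun i => by
    have a := h₄ ρn ρb (F.momentum_zero ht i)
    have b : G t (Dm u u i) ^ n ≤ ζ ^ n := by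
      have := G_nonneg t (Dm u u i)
      have : G t (Dm u u i) ≤ Zn u w t := G_fst_le t (Dm u u) (Dm u w) i
      gcongr; linarith
    have c := mul_le_mul_of_nonneg_left b (by positivity : 0 ≤ C₄ * |ρs| ^ (2 * n))
    have d : 0 ≤ C₃ * (2 + C₁) ^ n * ζ ^ n := by positivity
    have e : 0 ≤ |ρs| ^ (2 * n) * (C₃ * 2 ^ n) * ζ ^ n := by positivity
    simp only [K]; linarith
  have fw : ∀ i, I t ((ρ * Dm u w i) ^ (2 * n)) ≤ K * ζ ^ n := fun i => by
    have a : I t ((ρ * Dm u w i) ^ (2 * n)) ≤ I t (cst (|ρs| ^ (2 * n)) * Dm u w i ^ (2 * n)) :=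
      I_mono fun x => by
        simp only [map_mul, map_pow, ev_cst, mul_pow]
        have := ρn x
        have := ρb x
        have : 0 ≤ (ev t x (Dm u w i)) ^ (2 * n) := by rw [pow_mul]; positivity
        gcongr
    rw [I_smul_eq] at a
    have b : I t (Dm u w i ^ (2 * n)) ≤ C₃ * (2 * ζ) ^ n := by
      refine (h₃ t _).trans ?_
      have := I_sq_nonneg t (Dm u w i)
      have := G_nonneg t (Dm u w i)
      have : I t (Dm u w i ^ 2) ≤ Zn u w t := I_z_sq_le t (jD u w) i
      have : G t (Dm u w i) ≤ Zn u w t := G_snd_le t (Dm u u) (Dm u w) i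
      gcongr; linarith
    rw [mul_pow] at b
    have c := mul_le_mul_of_nonneg_left b (by positivity : 0 ≤ |ρs| ^ (2 * n))
    have d : 0 ≤ C₃ * (2 + C₁) ^ n * ζ ^ n := by positivity
    have e : 0 ≤ C₄ * |ρs| ^ (2 * n) * ζ ^ n := by positivity
    simp only [K]; linarith
  have nb : ∀ f : SP, I t (f ^ (2 * n)) ≤ K * ζ ^ n → NB t n (K * ζ ^ n) 1 f := fun f hf => by
    unfold NB; rwa [one_mul]
  obtain ⟨k1, k2, k3⟩ := h₂ F.toFlow ht (fun i => nb _ (fu i)) (fun i => nb _ (fw i))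
    (fun i j => nb _ (fa i j)) (fun i j => nb _ (fbb i j)) (fun i => nb _ (fz i))
  have fin : ∀ f : SP, NB t n (K * ζ ^ n) C₂ f → I t (f ^ (2 * n)) ≤ (|C₂| * K + K) * ζ ^ n :=
    fun f hf => by
      have := hf.mono hR (le_abs_self C₂)
      unfold NB at this; linarith
  refine ⟨fun j => fin _ (k1 j), fun i j k => fin _ (k2 i j k), fun i j k => fin _ (k3 i j k),
    fun i => (fz i).trans ?_⟩
  have : 0 ≤ |C₂| * K * ζ ^ n := by positivity
  linarith

end BFlow

/-- Interpolation between the first and the `n`-th moment. -/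
lemma interp_moment {t q A B : ℝ} {Q : SP} {n : ℕ} (hQ : ∀ x, 0 ≤ ev t x Q) (hq : 1 ≤ q) (hn : 2 ≤ n)
    (hqn : q ≤ n) (hA : 0 < A) (hB : 0 < B) (h1 : I t Q ≤ A) (hn' : I t (Q ^ n) ≤ B) :
    ∫ x in box 2, ev t x Q ^ q ≤ A ^ (1 - (q - 1) / (n - 1)) * B ^ ((q - 1) / (n - 1)) := by
  have n2 : (2 : ℝ) ≤ n := by exact_mod_cast hn
  have n1 : (0 : ℝ) < n - 1 := by linarith
  obtain ⟨l, hl⟩ : ∃ l, l = (q - 1) / (n - 1) := ⟨_, rfl⟩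
  have l0 : 0 ≤ l := by rw [hl]; exact div_nonneg (by linarith) n1.le
  have l1 : 0 ≤ 1 - l := by rw [hl, sub_nonneg, div_le_one n1]; linarith
  have le : (1 - l) + n * l = q := by rw [hl]; field_simp; ring
  rw [← hl]
  have hz : ∀ x, ev t x Q ^ q ≤ A ^ (1 - l) * B ^ l *
      ((1 - l) * A⁻¹ * ev t x Q + l * B⁻¹ * ev t x Q ^ n) := fun x => by
    have z0 := hQ x
    generalize ev t x Q = z at z0 ⊢
    have y := geom_mean_le_arith_mean2_weighted l1 l0 (by positivity : 0 ≤ z / A)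
      (by positivity : 0 ≤ z ^ n / B) (by ring)
    have e : A ^ (1 - l) * B ^ l * ((z / A) ^ (1 - l) * (z ^ n / B) ^ l) = z ^ q := by
      rw [div_rpow z0 hA.le, div_rpow (by positivity) hB.le, ← rpow_natCast z n, ← rpow_mul z0,
        ← le, rpow_add_of_nonneg z0 l1 (by positivity)]
      have := rpow_pos_of_pos hA (1 - l)
      have := rpow_pos_of_pos hB l
      field_simp
    rw [← e]
    refine mul_le_mul_of_nonneg_left (y.trans (le_of_eq ?_)) (by positivity)
    ring
  have i1 : Integrable (fun x => ev t x Q) (volume.restrict (box 2)) := (Q.smP t).integrable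
  have i2 : Integrable (fun x => ev t x Q ^ n) (volume.restrict (box 2)) := by
    have := ((Q ^ n).smP t).integrable
    simp only [map_pow] at this; exact this
  calc _ ≤ ∫ x in box 2, A ^ (1 - l) * B ^ l *
        ((1 - l) * A⁻¹ * ev t x Q + l * B⁻¹ * ev t x Q ^ n) :=
        integral_mono_of_nonneg (Eventually.of_forall fun x => rpow_nonneg (hQ x) _)
          (((i1.const_mul _).add (i2.const_mul _)).const_mul _) (Eventually.of_forall hz)
    _ = A ^ (1 - l) * B ^ l * ((1 - l) * (A⁻¹ * I t Q) + l * (B⁻¹ * I t (Q ^ n))) := by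
        rw [integral_const_mul, integral_add (i1.const_mul _) (i2.const_mul _), integral_const_mul,
          integral_const_mul, I_pow, ← I_def]
        ring
    _ ≤ A ^ (1 - l) * B ^ l * ((1 - l) * 1 + l * 1) := by
        have a : A⁻¹ * I t Q ≤ 1 := by rw [inv_mul_le_iff₀ hA]; linarith
        have b : B⁻¹ * I t (Q ^ n) ≤ 1 := by rw [inv_mul_le_iff₀ hB]; linarith
        gcongr
    _ = _ := by ring

/-- Time-weighted bound for a spatial Lebesgue norm. -/
lemma weighted_iLp {p r C D : ℝ} {n : ℕ} (hp : 0 ≤ p) (hr : 2 ≤ r) (hn : 2 ≤ n) (hrn : r / 2 ≤ n)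
    (hpr : n * ((r - 2) * p / (2 * r)) ≤ n - 1) (hC : 1 ≤ C) (hD : 1 ≤ D)
    {t z : ℝ} {g : Vec 2 → ℝ} {Q : SP} (ht : 0 < t) (hz : 0 ≤ z)
    (hQ : ∀ x, 0 ≤ ev t x Q) (hg : ∀ x, g x = √(ev t x Q)) (h1 : t * I t Q ≤ C)
    (h2 : I t (Q ^ n) ≤ D * z ^ n) :
    |√t * iLp r g| ^ p ≤ ((C * D) ^ (1 / r)) ^ p * (1 + t * z) := by
  have n2 : (2 : ℝ) ≤ n := by exact_mod_cast hn
  have n1 : (0 : ℝ) < n - 1 := by linarith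
  have hS : 1 ≤ 1 + t * z := by have := mul_nonneg ht.le hz; linarith
  obtain ⟨S, hS'⟩ : ∃ S, S = 1 + t * z := ⟨_, rfl⟩
  rw [← hS'] at hS ⊢
  have S0 : 0 < S := by linarith
  have h := interp_moment (A := C * t⁻¹) (B := D * (S * t⁻¹) ^ n) hQ (by linarith : 1 ≤ r / 2) hn hrn
    (by positivity) (by positivity) (by rw [← div_eq_mul_inv, le_div_iff₀ ht]; linarith)
    (h2.trans (by
      have : z ≤ S * t⁻¹ := by rw [← div_eq_mul_inv, le_div_iff₀ ht]; linarith
      gcongr))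
  obtain ⟨l, hl⟩ : ∃ l, l = (r / 2 - 1) / ((n : ℝ) - 1) := ⟨_, rfl⟩
  rw [← hl] at h
  have l0 : 0 ≤ l := by rw [hl]; exact div_nonneg (by linarith) n1.le
  have l1 : l ≤ 1 := by rw [hl, div_le_one n1]; linarith
  have le : (1 - l) + n * l = r / 2 := by rw [hl]; field_simp; ring
  have e1 : ∀ x, |g x| ^ r = ev t x Q ^ (r / 2) := fun x => by
    rw [hg, abs_of_nonneg (sqrt_nonneg _), sqrt_eq_rpow, ← rpow_mul (hQ x)]; congr 1; ring
  have J : ∫ x in box 2, |g x| ^ r ≤ C * D * (t⁻¹ ^ (r / 2) * S ^ (n * l)) := by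
    simp only [e1]
    refine h.trans ?_
    have ti : 0 < t⁻¹ := by positivity
    rw [mul_rpow (by positivity) ti.le, mul_rpow (by positivity) (by positivity),
      ← rpow_natCast (S * t⁻¹) n, ← rpow_mul (by positivity), mul_rpow S0.le ti.le, ← le,
      rpow_add ti]
    have a : C ^ (1 - l) ≤ C := by
      conv_rhs => rw [← rpow_one C]
      exact rpow_le_rpow_of_exponent_le hC (by linarith)
    have b : D ^ l ≤ D := by
      conv_rhs => rw [← rpow_one D]
      exact rpow_le_rpow_of_exponent_le hD l1
    calc _ = C ^ (1 - l) * D ^ l * (t⁻¹ ^ (1 - l) * t⁻¹ ^ (n * l) * S ^ (n * l)) := by ring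
      _ ≤ _ := by gcongr
  have J0 : 0 ≤ ∫ x in box 2, |g x| ^ r :=
    integral_nonneg fun x => rpow_nonneg (abs_nonneg _) _
  have r0 : 0 < r := by linarith
  have k : √t * iLp r g ≤ (C * D) ^ (1 / r) * S ^ (n * l / r) := by
    have a : iLp r g ≤ (C * D * (t⁻¹ ^ (r / 2) * S ^ (n * l))) ^ (1 / r) :=
      rpow_le_rpow J0 J (by positivity)
    rw [mul_rpow (x := C * D) (by positivity) (by positivity),
      mul_rpow (x := t⁻¹ ^ (r / 2)) (by positivity) (by positivity),
      ← rpow_mul (by positivity), ← rpow_mul S0.le,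
      show r / 2 * (1 / r) = 1 / 2 by field_simp, ← sqrt_eq_rpow, sqrt_inv, mul_one_div] at a
    have b : 0 < √t := sqrt_pos.2 ht
    calc _ ≤ √t * ((C * D) ^ (1 / r) * ((√t)⁻¹ * S ^ (n * l / r))) := by gcongr
      _ = _ := by field_simp
  have k0 : 0 ≤ √t * iLp r g := mul_nonneg (sqrt_nonneg _) (rpow_nonneg J0 _)
  rw [abs_of_nonneg k0]
  calc _ ≤ ((C * D) ^ (1 / r) * S ^ (n * l / r)) ^ p := rpow_le_rpow k0 k hp
    _ = ((C * D) ^ (1 / r)) ^ p * S ^ (n * l / r * p) := by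
        rw [mul_rpow (by positivity) (by positivity), ← rpow_mul S0.le]
    _ ≤ ((C * D) ^ (1 / r)) ^ p * S ^ (1 : ℝ) := by
        refine mul_le_mul_of_nonneg_left (rpow_le_rpow_of_exponent_le hS ?_) (by positivity)
        have : n * l / r * p = n * ((r - 2) * p / (2 * r)) / (n - 1) := by
          rw [hl]; field_simp
        rw [this, div_le_one n1]; exact hpr
    _ = _ := by rw [rpow_one]

/-- Bound for a time-weighted space-time norm in the open range of exponents. -/
lemma weighted_tLpE (T C : ℝ) (Cn : ℕ → ℝ) (p : ENNReal) (r : ℝ) : ∃ B : ℝ, 0 < T → 2 ≤ p → 2 ≤ r →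
    ENNReal.ofReal r < pstar p → ∀ (g : ℝ → Vec 2 → ℝ) (Q : SP) (ζ : ℝ → ℝ), Continuous ζ →
    (∀ t ∈ Ioo 0 T, 0 ≤ ζ t) → (∀ t ∈ Ioo 0 T, ∀ x, 0 ≤ ev t x Q) →
    (∀ t ∈ Ioo 0 T, ∀ x, g t x = √(ev t x Q)) → (∀ t ∈ Ioo 0 T, t * I t Q ≤ C) →
    (∀ n, 1 ≤ n → ∀ t ∈ Ioo 0 T, I t (Q ^ n) ≤ Cn n * ζ t ^ n) → ∫ t in 0..T, t * ζ t ≤ C →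
    tLpE T p (fun t => √t * iLp r (g t)) ≤ B := by
  by_cases hc : 0 < T ∧ 2 ≤ p ∧ 2 ≤ r ∧ ENNReal.ofReal r < pstar p
  swap
  · exact ⟨0, fun a b c d => absurd ⟨a, b, c, d⟩ hc⟩
  obtain ⟨hT, hp, hr, hpr⟩ := hc
  have ptop : p ≠ ⊤ := fun h => by
    rw [h, pstar, if_pos rfl, ← not_le] at hpr
    refine hpr ?_
    rw [← ENNReal.ofReal_ofNat 2]; exact ENNReal.ofReal_le_ofReal hr
  obtain ⟨P, hP⟩ : ∃ P, P = p.toReal := ⟨_, rfl⟩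
  have pP : p = ENNReal.ofReal P := by rw [hP, ENNReal.ofReal_toReal ptop]
  have P2 : 2 ≤ P := by
    rw [hP]
    have := ENNReal.toReal_mono ptop hp
    simpa using this
  have cond : (r - 2) * P < 2 * r := by
    rcases P2.eq_or_lt with h | h
    · rw [← h]; linarith
    · rw [pstar, if_neg ptop, pP, ← ENNReal.ofReal_ofNat 2, ← ENNReal.ofReal_mul (by norm_num),
        ← ENNReal.ofReal_sub _ (by norm_num), ← ENNReal.ofReal_div_of_pos (by linarith)] at hpr
      have := (ENNReal.ofReal_lt_ofReal_iff_of_nonneg (by linarith)).1 hpr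
      rw [lt_div_iff₀ (by linarith)] at this
      linarith
  obtain ⟨a, ha⟩ : ∃ a, a = (r - 2) * P / (2 * r) := ⟨_, rfl⟩
  have a1 : a < 1 := by rw [ha, div_lt_one (by linarith)]; exact cond
  obtain ⟨n, hn⟩ := exists_nat_ge (max (2 : ℝ) (max (r / 2) (1 / (1 - a))))
  have n2 : 2 ≤ n := by exact_mod_cast (le_max_left _ _).trans hn
  have nr : r / 2 ≤ n := ((le_max_left _ _).trans (le_max_right _ _)).trans hn
  have na : n * a ≤ n - 1 := by
    have := ((le_max_right _ _).trans (le_max_right _ _)).trans hn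
    rw [div_le_iff₀ (by linarith)] at this
    linarith
  obtain ⟨E, hE⟩ : ∃ E, E = ((max C 1 * max (Cn n) 1) ^ (1 / r)) ^ P := ⟨_, rfl⟩
  have E0 : 0 ≤ E := by rw [hE]; positivity
  refine ⟨(E * (T + C)) ^ (1 / P), fun _ _ _ _ g Q ζ cζ hζ hQ hg h1 h2 h3 => ?_⟩
  rw [tLpE, if_neg ptop, ← hP]
  have ci : Continuous fun t => E * (1 + t * ζ t) := by fun_prop
  have key : ∫ t in Ioo 0 T, |√t * iLp r (g t)| ^ P ≤ E * (T + C) := by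
    calc _ ≤ ∫ t in Ioo 0 T, E * (1 + t * ζ t) := by
          refine integral_mono_of_nonneg (Eventually.of_forall fun t => rpow_nonneg (abs_nonneg _) _)
            (ci.integrableOn_Icc.mono_set Ioo_subset_Icc_self) ?_
          refine (ae_restrict_iff' measurableSet_Ioo).2 (Eventually.of_forall fun t ht => ?_)
          rw [hE]
          refine weighted_iLp (by linarith) hr n2 nr (by rw [← ha]; exact na) (le_max_right _ _)
            (le_max_right _ _) ht.1 (hζ t ht) (hQ t ht) (hg t ht) ((h1 t ht).trans (le_max_left _ _))
            ((h2 n (by omega) t ht).trans ?_)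
          exact mul_le_mul_of_nonneg_right (le_max_left _ _) (pow_nonneg (hζ t ht) _)
      _ = ∫ t in 0..T, E * (1 + t * ζ t) := by
          rw [intervalIntegral.integral_of_le hT.le, integral_Ioc_eq_integral_Ioo]
      _ = E * (T + ∫ t in 0..T, t * ζ t) := by
          rw [intervalIntegral.integral_const_mul, intervalIntegral.integral_add (by simp)
            ((by fun_prop : Continuous fun t => t * ζ t).intervalIntegrable 0 T)]
          simp
      _ ≤ _ := by gcongr
  exact rpow_le_rpow (integral_nonneg fun t => rpow_nonneg (abs_nonneg _) _) key (by positivity)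

lemma rpow_add_le (x y : ℝ) {s : ℝ} (hx : 0 ≤ x) (hy : 0 ≤ y) (hs : 1 ≤ s) :
    (x + y) ^ s ≤ 2 ^ (s - 1) * (x ^ s + y ^ s) := by
  lift x to NNReal using hx
  lift y to NNReal using hy
  exact_mod_cast NNReal.rpow_add_le_mul_rpow_add_rpow x y hs

/-- Bound for the supremum of a field through Morrey's inequality. -/
lemma iLinf_rpow_le (T C : ℝ) (Cn : ℕ → ℝ) (s : ℝ) (hs : 1 ≤ s) (hs2 : s < 2) (hT : 0 < T) :
    ∃ K : ℝ, 0 ≤ K ∧ ∀ (g : Vec 2 → ℝ) (f : Fin 3 → Fin 2 → SP) (t z : ℝ), t ∈ Ioo 0 T → 0 ≤ z →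
    (∀ x, g x = √(∑ i, ∑ j, ev t x (f i j) ^ 2)) → (∀ i j, I t (f i j ^ 2) ≤ C) →
    (∀ n, 1 ≤ n → ∀ k i j, I t (dx k (f i j) ^ (2 * n)) ≤ Cn n * z ^ n) →
    iLinf g ^ s ≤ K * (t ^ (-(s / 2)) + (1 + t * z)) := by
  obtain ⟨n, hn⟩ := exists_nat_ge (max (2 : ℝ) (2 * s / (2 - s)))
  have n2' : (2 : ℝ) ≤ n := (le_max_left _ _).trans hn
  have n2 : 2 ≤ n := by exact_mod_cast n2'
  obtain ⟨e, he⟩ : ∃ e, e = s / (n * (2 - s)) := ⟨_, rfl⟩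
  have s2 : 0 < 2 - s := by linarith
  have e1 : e ≤ s / 2 := by
    have := (le_max_right _ _).trans hn
    rw [div_le_iff₀ s2] at this
    rw [he, div_le_iff₀ (by positivity)]
    nlinarith
  have e0 : 0 ≤ e := by rw [he]; positivity
  set D := max (Cn n) 1 with hD
  have D1 : 1 ≤ D := le_max_right _ _
  set b := 4 * √(D / T) with hb
  have b0 : 0 ≤ b := by positivity
  set m := 6 ^ s * (2 ^ (s - 1) * (√C ^ s + b ^ s)) with hm
  have m0 : 0 ≤ m := by positivity
  refine ⟨m * (T ^ (s / 2) + 1), by positivity, fun g f t z ht hz hg h1 h2 => ?_⟩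
  have t0 := ht.1
  obtain ⟨S, hS'⟩ : ∃ S, S = 1 + t * z := ⟨_, rfl⟩
  rw [← hS']
  have S1 : 1 ≤ S := by have := mul_nonneg t0.le hz; linarith
  have S0 : 0 < S := by linarith
  obtain ⟨τ, hτ⟩ : ∃ τ, τ = t / T := ⟨_, rfl⟩
  have τ0 : 0 < τ := by rw [hτ]; positivity
  have τ1 : τ ≤ 1 := by rw [hτ, div_le_one hT]; exact ht.2.le
  set A := τ ^ (-(1 / 2) : ℝ) * √C + b * (τ ^ (-(1 / (2 * n)) : ℝ) * √S) with hA
  have A0 : 0 ≤ A := by positivity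
  have pt : ∀ x i j, |ev t x (f i j)| ≤ A := fun x i j => by
    have hh : √τ ≤ 1 := sqrt_le_one.2 τ1
    have mo := morrey_I (f i j) n2 (sqrt_pos.2 τ0) hh t x
    have q : ∀ k, I t (dx k (f i j) ^ (2 * n)) ^ (1 / (2 * n) : ℝ) ≤ √(D * (S / t)) := fun k => by
      have c0 := I_even_nonneg t (dx k (f i j)) n
      have c1 : I t (dx k (f i j) ^ (2 * n)) ≤ (D * (S / t)) ^ n := by
        have zz : z ≤ S / t := by rw [le_div_iff₀ t0]; linarith
        calc _ ≤ Cn n * z ^ n := h2 n (by omega) k i j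
          _ ≤ D * (S / t) ^ n := by gcongr; exact le_max_left _ _
          _ ≤ D ^ n * (S / t) ^ n := by
              gcongr; exact le_self_pow₀ D1 (by omega)
          _ = _ := (mul_pow _ _ _).symm
      calc _ ≤ ((D * (S / t)) ^ n) ^ (1 / (2 * n) : ℝ) := rpow_le_rpow c0 c1 (by positivity)
        _ = _ := by
          rw [← rpow_natCast, ← rpow_mul (by positivity), sqrt_eq_rpow]; congr 1; field_simp
    have u1 : (√τ)⁻¹ = τ ^ (-(1 / 2) : ℝ) := by rw [sqrt_eq_rpow, rpow_neg τ0.le]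
    have u2 : √τ ^ (1 - 1 / n : ℝ) * √(D * (S / t)) = √(D / T) * (τ ^ (-(1 / (2 * n)) : ℝ) * √S) := by
      have : D * (S / t) = D / T * (S * τ⁻¹) := by rw [hτ]; field_simp
      rw [this, sqrt_mul (by positivity), sqrt_mul S0.le, sqrt_inv, u1, sqrt_eq_rpow τ,
        ← rpow_mul τ0.le]
      have : τ ^ (1 / 2 * (1 - 1 / n) : ℝ) * τ ^ (-(1 / 2) : ℝ) = τ ^ (-(1 / (2 * n)) : ℝ) := by
        rw [← rpow_add τ0]; congr 1; field_simp; ring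
      rw [← this]; ring
    refine mo.trans ?_
    calc _ ≤ (√τ)⁻¹ * √C + 2 * √τ ^ (1 - 1 / n : ℝ) * (√(D * (S / t)) + √(D * (S / t))) := by
          gcongr
          exacts [h1 i j, q 0, q 1]
      _ = (√τ)⁻¹ * √C + 4 * (√τ ^ (1 - 1 / n : ℝ) * √(D * (S / t))) := by ring
      _ = A := by rw [u2, u1, hA, hb]; ring
  have sup : iLinf g ≤ 6 * A := by
    refine ciSup_le fun x => ?_
    rw [hg, abs_of_nonneg (sqrt_nonneg _), sqrt_le_left (by positivity)]
    have : ∀ i j, ev t x (f i j) ^ 2 ≤ A ^ 2 := fun i j => by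
      rw [← sq_abs]; exact pow_le_pow_left₀ (abs_nonneg _) (pt x i j) 2
    calc _ ≤ ∑ i : Fin 3, ∑ j : Fin 2, A ^ 2 :=
          Finset.sum_le_sum fun i _ => Finset.sum_le_sum fun j _ => this i j
      _ ≤ _ := by simp; nlinarith [sq_nonneg A]
  have sup0 : 0 ≤ iLinf g := iSup_nonneg fun x => abs_nonneg _
  have yo : (τ ^ (-(1 / (2 * n)) : ℝ) * √S) ^ s ≤ S + τ ^ (-(s / 2)) := by
    have y := geom_mean_le_arith_mean2_weighted (by linarith : 0 ≤ s / 2) (by linarith : 0 ≤ 1 - s / 2)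
      S0.le (by positivity : 0 ≤ τ ^ (-e)) (by ring)
    have l : (τ ^ (-(1 / (2 * n)) : ℝ) * √S) ^ s = S ^ (s / 2) * (τ ^ (-e)) ^ (1 - s / 2) := by
      rw [mul_rpow (by positivity) (by positivity), ← rpow_mul τ0.le, ← rpow_mul τ0.le, sqrt_eq_rpow,
        ← rpow_mul S0.le, mul_comm]
      congr 2
      · ring
      · rw [he]; field_simp
    rw [l]
    refine y.trans (add_le_add ?_ ?_)
    · exact mul_le_of_le_one_left S0.le (by linarith)
    · refine (mul_le_of_le_one_left (by positivity) (by linarith)).trans ?_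
      exact rpow_le_rpow_of_exponent_ge τ0 τ1 (by linarith)
  have AS : A ^ s ≤ 2 ^ (s - 1) * ((√C ^ s + b ^ s) * (τ ^ (-(s / 2)) + S)) := by
    have k := rpow_add_le (τ ^ (-(1 / 2) : ℝ) * √C)
      (b * (τ ^ (-(1 / (2 * n)) : ℝ) * √S)) (by positivity) (by positivity) hs
    refine k.trans (mul_le_mul_of_nonneg_left ?_ (by positivity))
    rw [mul_rpow (by positivity) (by positivity), mul_rpow b0 (by positivity), ← rpow_mul τ0.le,
      show (-(1 / 2) * s : ℝ) = -(s / 2) by ring]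
    have k1 := mul_le_mul_of_nonneg_left yo (by positivity : 0 ≤ b ^ s)
    have k2 : 0 ≤ √C ^ s * S := by positivity
    linarith
  have τe : τ ^ (-(s / 2)) = T ^ (s / 2) * t ^ (-(s / 2)) := by
    rw [hτ, div_rpow t0.le hT.le, rpow_neg hT.le, div_inv_eq_mul, mul_comm]
  calc iLinf g ^ s ≤ (6 * A) ^ s := rpow_le_rpow sup0 sup (by linarith)
    _ = 6 ^ s * A ^ s := mul_rpow (by norm_num) A0
    _ ≤ 6 ^ s * (2 ^ (s - 1) * ((√C ^ s + b ^ s) * (τ ^ (-(s / 2)) + S))) := by gcongr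
    _ = m * (T ^ (s / 2) * t ^ (-(s / 2)) + S) := by rw [hm, τe]; ring
    _ ≤ m * ((T ^ (s / 2) + 1) * (t ^ (-(s / 2)) + S)) := by
        have a1 : 0 ≤ T ^ (s / 2) * S := by positivity
        have a2 : 0 ≤ t ^ (-(s / 2)) := by positivity
        refine mul_le_mul_of_nonneg_left ?_ m0
        linarith
    _ = _ := by ring

lemma hasDerivAt_ev (f : SP) (t : ℝ) (x : Vec 2) :
    HasDerivAt (fun s : ℝ => ev s x f) (ev t x (dt f)) t :=
  (f.differentiable (t, x)).hasFDerivAt.comp_hasDerivAt t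
    ((hasDerivAt_id t).prodMk (hasDerivAt_const t x))

lemma tderiv_ev (f : SP) (t : ℝ) (x : Vec 2) :
    tderiv (fun t x => ev t x f) t x = ev t x (dt f) := (hasDerivAt_ev f t x).deriv

lemma tderiv_ev_vec (v : Fin 3 → SP) (t : ℝ) (x : Vec 2) (i : Fin 3) :
    tderiv (fun t x i => ev t x (v i)) t x i = ev t x (dt (v i)) := by
  have := hasDerivAt_pi.2 fun i => hasDerivAt_ev (v i) t x
  exact congrFun this.deriv i

lemma pd3_ev (i : Fin 3) (f : SP) (t : ℝ) (x : Vec 2) :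
    pd3 i (fun x => ev t x f) x = ev t x (grS f i) := by
  fin_cases i
  · exact congrFun (pdir_ev 0 f t) x
  · exact congrFun (pdir_ev 1 f t) x
  · simp [pd3, grS]

lemma adv3_ev (u : Fin 3 → SP) (f : SP) (t : ℝ) (x : Vec 2) :
    ev t x (dt f) + adv3 (fun x i => ev t x (u i)) (fun x => ev t x f) x = ev t x (mat u f) := by
  simp only [adv3, pd3_ev, Fin.sum_univ_three, mat_apply, map_add, map_mul]
  simp [grS]; ring

lemma lap_ev (f : SP) (t : ℝ) (x : Vec 2) : lap (fun x => ev t x f) x = ev t x (lapS f) := by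
  simp only [lap, Fin.sum_univ_two, pdir_ev, lapS, map_add]

lemma div3_ev (v : Fin 3 → SP) (t : ℝ) (x : Vec 2) :
    div3 (fun x i => ev t x (v i)) x = ev t x (divS v) := by
  simp only [div3, pd3_ev, Fin.sum_univ_three, divS, map_add]
  simp [grS]

lemma curl3_ev (v : Fin 3 → SP) (t : ℝ) (x : Vec 2) (i : Fin 3) :
    curl3 (fun x i => ev t x (v i)) x i = ev t x (curlS v i) := by
  fin_cases i <;> simp [curl3, pd3_ev, curlS, grS]

/-- A solution of the system is given by elements of the function algebra. -/
lemma exists_BFlow {T μ γ κ χ ρs : ℝ} {ρ P : ℝ → Vec 2 → ℝ} {u ω : ℝ → Vec 2 → V3}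
    (h : Sol 2 (Icc 0 T) μ γ κ χ ρ u ω P)
    (hl : ∃ c : ℝ, 0 < c ∧ ∀ t ∈ Icc (0:ℝ) T, ∀ x, c ≤ ρ t x)
    (hu : ∀ t ∈ Icc (0:ℝ) T, ∀ x, ρ t x ≤ ρs) :
    ∃ (ρ' P' : SP) (u' w' : Fin 3 → SP), BFlow T μ γ κ χ ρs ρ' P' u' w' ∧
      ρ = (fun t x => ev t x ρ') ∧ P = (fun t x => ev t x P') ∧
      u = (fun t x i => ev t x (u' i)) ∧ ω = fun t x i => ev t x (w' i) := by
  obtain ⟨ρ', rfl⟩ : ∃ ρ' : SP, ρ = fun t x => ev t x ρ' := ⟨⟨_, h.smooth_ρ, h.per_ρ⟩, rfl⟩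
  obtain ⟨P', rfl⟩ : ∃ P' : SP, P = fun t x => ev t x P' := ⟨⟨_, h.smooth_P, h.per_P⟩, rfl⟩
  obtain ⟨u', rfl⟩ : ∃ u' : Fin 3 → SP, u = fun t x i => ev t x (u' i) :=
    ⟨fun i => ⟨fun q => u q.1 q.2 i, contDiff_pi.1 h.smooth_u i,
      fun t x k => congrFun (h.per_u t x k) i⟩, rfl⟩
  obtain ⟨w', rfl⟩ : ∃ w' : Fin 3 → SP, ω = fun t x i => ev t x (w' i) :=
    ⟨fun i => ⟨fun q => ω q.1 q.2 i, contDiff_pi.1 h.smooth_w i,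
      fun t x k => congrFun (h.per_w t x k) i⟩, rfl⟩
  have e2 : ∀ t x, ev t x 2 = 2 := fun t x => map_ofNat (ev t x) 2
  have e4 : ∀ t x, ev t x 4 = 4 := fun t x => map_ofNat (ev t x) 4
  refine ⟨ρ', P', u', w', ⟨⟨h.hχ, by linarith [h.hμ], h.hγ, h.hκ, fun t ht i x => ?_,
    fun t ht i x => ?_, fun t ht x => ?_, fun t ht x => ?_⟩, h.hμ, hl, hu⟩, rfl, rfl, rfl, rfl⟩
  · have := h.mom t ht x i
    rw [tderiv_ev_vec, adv3_ev, lap_ev, pd3_ev, curl3_ev] at this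
    simp only [map_add, map_sub, map_mul, ev_cst, e2]
    linarith
  · have := h.angmom t ht x i
    have d : div3 (fun x i => ev t x (w' i)) = fun x => ev t x (divS w') :=
      funext fun x => div3_ev w' t x
    rw [tderiv_ev_vec, adv3_ev, lap_ev, d, pd3_ev, curl3_ev] at this
    simp only [map_add, map_sub, map_mul, ev_cst, e2, e4]
    linarith
  · rw [← div3_ev]; exact h.incomp t ht x
  · have := h.mass t ht x
    rwa [tderiv_ev, adv3_ev] at this

lemma vmag_sq {n : ℕ} (v : Fin n → ℝ) : vmag v ^ 2 = ∑ i, v i ^ 2 :=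
  sq_sqrt (Finset.sum_nonneg fun _ _ => sq_nonneg _)

lemma integral_vmag_sq (t : ℝ) (ρ : SP) (v : Fin 3 → SP) :
    ∫ x in box 2, ev t x ρ * vmag (fun i => ev t x (v i)) ^ 2 = I t (ρ * dotS v v) := by
  simp only [I_def, vmag_sq, dotS, map_mul, map_sum]
  simp only [sq]

lemma iL2sq_magGradV (t : ℝ) (v : Fin 3 → SP) :
    iL2sq (magGradV fun x i => ev t x (v i)) = I t (∑ i, ∑ j, dx j (v i) ^ 2) := by
  rw [iL2sq, I_def]
  congr 1; ext x
  rw [magGradV, sq_sqrt (Finset.sum_nonneg fun _ _ => Finset.sum_nonneg fun _ _ => sq_nonneg _)]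
  simp only [pdir_ev, map_sum, map_pow]

lemma K0q_eq {T μ γ κ χ ρs : ℝ} {ρ P : SP} {u w : Fin 3 → SP} (F : BFlow T μ γ κ χ ρs ρ P u w)
    (hT : 0 < T) :
    K0q μ γ κ χ (fun x i => ev 0 x (u i)) (fun x i => ev 0 x (w i)) =
      I 0 (bet (μ + χ) γ κ χ (jet u w) (jet u w)) := by
  have d0 : I 0 (divS u ^ 2) = 0 := by
    rw [I_def]; simp [F.inc 0 ⟨le_rfl, hT.le⟩]
  have d : iL2sq (div3 fun x i => ev 0 x (w i)) = I 0 (divS w ^ 2) := by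
    simp only [iL2sq, div3_ev, I_def, map_pow]
  have c : ∫ x in box 2, vmag (curl3 (fun x i => ev 0 x (u i)) x - 2 • fun i => ev 0 x (w i)) ^ 2 =
      I 0 (∑ i, (curlS u i - 2 * w i) ^ 2) := by
    have e2 : ∀ t x, ev t x 2 = 2 := fun t x => map_ofNat (ev t x) 2
    rw [I_def]
    congr 1; ext x
    rw [vmag_sq, map_sum]
    refine Finset.sum_congr rfl fun i _ => ?_
    rw [Pi.sub_apply, Pi.smul_apply, curl3_ev, map_pow, map_sub, map_mul, e2, nsmul_eq_mul,
      Nat.cast_ofNat]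
  rw [I_bet_self, d0, mul_zero, add_zero, K0q, iL2sq_magGradV, iL2sq_magGradV, d, c,
    ← I_smul_eq, ← I_smul_eq, ← I_smul_eq, ← I_smul_eq, ← map_add, ← map_add, ← map_add]
  rfl

lemma sum_ev_sq_nonneg {ι : Type} [Fintype ι] (f : ι → SP) (t : ℝ) (x : Vec 2) :
    0 ≤ ev t x (∑ i, f i ^ 2) := by
  simp only [map_sum, map_pow]; positivity

lemma I_sum_sq_pow_le {ι : Type} [Fintype ι] {N : ℝ} (hN : 1 ≤ N) (hι : (Fintype.card ι : ℝ) ≤ N)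
    {f : ι → SP} {n : ℕ} {t M : ℝ} (hn : 1 ≤ n) (hM : 0 ≤ M) (h : ∀ i, I t (f i ^ (2 * n)) ≤ M) :
    I t ((∑ i, f i ^ 2) ^ n) ≤ N ^ n * M := by
  obtain ⟨m, rfl⟩ : ∃ m, n = m + 1 := ⟨n - 1, by omega⟩
  have N0 : 0 ≤ N := by linarith
  calc I t ((∑ i, f i ^ 2) ^ (m + 1)) ≤ I t (cst (N ^ m) * ∑ i, f i ^ (2 * (m + 1))) :=
        I_mono fun x => by
          simp only [map_mul, ev_cst, map_sum, map_pow, pow_mul]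
          have k := pow_sum_div_card_le_sum_pow (s := Finset.univ) (f := fun i => ev t x (f i) ^ 2)
            (fun i _ => sq_nonneg _) m
          have s0 : 0 ≤ ∑ i, (ev t x (f i) ^ 2) ^ (m + 1) := by positivity
          rcases (Fintype.card ι).eq_zero_or_pos with c | c
          · have := Fintype.card_eq_zero_iff.1 c
            simp
          · rw [Finset.card_univ, div_le_iff₀ (by positivity)] at k
            refine k.trans ?_
            rw [mul_comm]
            gcongr
    _ = N ^ m * ∑ i, I t (f i ^ (2 * (m + 1))) := by rw [I_smul_eq, map_sum]
    _ ≤ N ^ m * (N * M) := by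
        gcongr
        refine (Finset.sum_le_card_nsmul _ _ M fun i _ => h i).trans ?_
        rw [Finset.card_univ, nsmul_eq_mul]
        gcongr
    _ = _ := by ring

/-- Space-time bound for the magnitude of a finite family of fields. -/
lemma tLpE_family (T A : ℝ) (hA : 0 ≤ A) (Cn : ℕ → ℝ) (hCn : ∀ n, 0 ≤ Cn n) (p : ENNReal) (r : ℝ) :
    ∃ B : ℝ, 0 < T → 2 ≤ p → 2 ≤ r → ENNReal.ofReal r < pstar p → ∀ {ι : Type} [Fintype ι]
    (_ : (Fintype.card ι : ℝ) ≤ 12) (f : ι → SP) (g : ℝ → Vec 2 → ℝ) (ζ : ℝ → ℝ), Continuous ζ →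
    (∀ t ∈ Ioo 0 T, 0 ≤ ζ t) → (∀ t ∈ Ioo 0 T, ∀ x, g t x = √(∑ i, ev t x (f i) ^ 2)) →
    (∀ t ∈ Ioo 0 T, ∀ i, t * I t (f i ^ 2) ≤ A) →
    (∀ n, 1 ≤ n → ∀ t ∈ Ioo 0 T, ∀ i, I t (f i ^ (2 * n)) ≤ Cn n * ζ t ^ n) →
    ∫ t in 0..T, t * ζ t ≤ A → tLpE T p (fun t => √t * iLp r (g t)) ≤ B := by
  obtain ⟨B, h⟩ := weighted_tLpE T (12 * A) (fun n => 12 ^ n * Cn n) p r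
  refine ⟨B, fun hT hp hr hpr {ι} _ hι f g ζ cζ hζ hg h1 h2 h3 => ?_⟩
  refine h hT hp hr hpr g (∑ i, f i ^ 2) ζ cζ hζ (fun t _ x => sum_ev_sq_nonneg f t x)
    (fun t ht x => ?_) (fun t ht => ?_) (fun n hn t ht => ?_) (by linarith)
  · rw [hg t ht]; simp only [map_sum, map_pow]
  · have t0 := ht.1
    have := I_sum_sq_pow_le (N := 12) (by norm_num) hι (f := f) (n := 1) (t := t) (M := A / t) le_rfl
      (by positivity) fun i => by rw [mul_one, le_div_iff₀ t0]; linarith [h1 t ht i]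
    rw [pow_one, pow_one] at this
    calc _ ≤ t * (12 * (A / t)) := by gcongr
      _ = _ := by field_simp
  · rw [mul_assoc]
    exact I_sum_sq_pow_le (by norm_num) hι hn (mul_nonneg (hCn n) (pow_nonneg (hζ t ht) n)) (h2 n hn t ht)

namespace BFlow

/-- The Lebesgue exponents of all orders of the solution, with explicit constants. -/
lemma all_moments (μ γ κ χ ρs : ℝ) : ∃ Cn : ℕ → ℝ, (∀ n, 0 ≤ Cn n) ∧ ∀ n, 1 ≤ n →
    ∀ {T : ℝ} {ρ P : SP} {u w : Fin 3 → SP},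
    BFlow T μ γ κ χ ρs ρ P u w → ∀ {t : ℝ}, t ∈ Icc 0 T →
    (∀ j, I t (dx j P ^ (2 * n)) ≤ Cn n * (Xn u w t + Yn ρ u w t + Zn u w t) ^ n) ∧
    (∀ i j k, I t (dx j (dx k (u i)) ^ (2 * n)) ≤ Cn n * (Xn u w t + Yn ρ u w t + Zn u w t) ^ n) ∧
    (∀ i j k, I t (dx j (dx k (w i)) ^ (2 * n)) ≤ Cn n * (Xn u w t + Yn ρ u w t + Zn u w t) ^ n) ∧
    ∀ i, I t (w i ^ (2 * n)) ≤ Cn n * (Xn u w t + Yn ρ u w t + Zn u w t) ^ n := by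
  choose Cn h0 h using moments μ γ κ χ ρs
  refine ⟨fun n => if hn : 1 ≤ n then Cn n hn else 0, fun n => ?_, fun n hn => ?_⟩
  · dsimp only; split_ifs with hn
    exacts [h0 n hn, le_rfl]
  · simp only [dif_pos hn]; exact h n hn

variable {T μ γ κ χ ρs : ℝ} {ρ P : SP} {u w : Fin 3 → SP}

lemma zeta_nonneg (F : BFlow T μ γ κ χ ρs ρ P u w) {t : ℝ} (ht : t ∈ Icc 0 T) :
    0 ≤ Xn u w t + Yn ρ u w t + Zn u w t := by
  have := F.eden_nonneg ht (Dm u u) (Dm u w)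
  have : 0 ≤ Yn ρ u w t := this
  have := Xn_nonneg u w t
  have := Zn_nonneg u w t
  linarith

lemma continuous_zeta (ρ : SP) (u w : Fin 3 → SP) :
    Continuous fun t => Xn u w t + Yn ρ u w t + Zn u w t :=
  ((continuous_Xn u w).add (continuous_Yn ρ u w)).add (continuous_Zn u w)

lemma integral_zeta_le {C : ℝ} (hT : 0 < T) (hX : ∀ t ∈ Icc 0 T, Xn u w t ≤ C)
    (hY : ∀ t ∈ Ioo 0 T, t * Yn ρ u w t ≤ C) (hZ : ∫ t in 0..T, t * Zn u w t ≤ C) :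
    ∫ t in 0..T, t * (Xn u w t + Yn ρ u w t + Zn u w t) ≤ T * ((T + 1) * C) + C := by
  have cX := continuous_Xn u w
  have cY := continuous_Yn ρ u w
  have cZ := continuous_Zn u w
  have c1 : Continuous fun t => t * (Xn u w t + Yn ρ u w t) := by fun_prop
  have c2 : Continuous fun t => t * Zn u w t := by fun_prop
  have e : ∀ t, t * (Xn u w t + Yn ρ u w t + Zn u w t) =
      t * (Xn u w t + Yn ρ u w t) + t * Zn u w t := fun t => by ring
  simp only [e]
  rw [intervalIntegral.integral_add (c1.intervalIntegrable _ _) (c2.intervalIntegrable _ _)]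
  refine add_le_add ?_ hZ
  calc _ ≤ ∫ t in 0..T, (T + 1) * C :=
        intervalIntegral.integral_mono_on_of_le_Ioo hT.le (c1.intervalIntegrable _ _) (by simp)
          fun t ht => by
            have a := hX t (Ioo_subset_Icc_self ht)
            have b := hY t ht
            have := Xn_nonneg u w t
            have : t * Xn u w t ≤ T * C := mul_le_mul ht.2.le a this hT.le
            linarith
    _ = _ := by simp; ring

/-- Shift of integrability for the second derivatives and the pressure. -/
lemma second_derivative_norms (μ γ κ χ ρs T E K : ℝ) (p : ENNReal) (r : ℝ) :
    ∃ B : ℝ, 0 < T → 2 ≤ p → 2 ≤ r → ENNReal.ofReal r < pstar p → ∀ {ρ P : SP} {u w : Fin 3 → SP},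
    BFlow T μ γ κ χ ρs ρ P u w → I 0 (eden ρ u w) ≤ E →
    I 0 (bet (μ + χ) γ κ χ (jet u w) (jet u w)) ≤ K →
    tLpE T p (fun t => √t * iLp r (magGrad2V fun x i => ev t x (u i)))
      + tLpE T p (fun t => √t * iLp r (magGrad2V fun x i => ev t x (w i)))
      + tLpE T p (fun t => √t * iLp r (fun x => vmag fun i => ev t x (w i)))
      + tLpE T p (fun t => √t * iLp r (magGradS fun x => ev t x P)) ≤ B := by
  by_cases hT : 0 < T
  swap
  · exact ⟨0, fun h => absurd h hT⟩
  obtain ⟨C, hC, hW⟩ := weighted_bound μ γ κ χ ρs T E K hT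
  obtain ⟨S, hS, hSO⟩ := second_order μ γ κ χ ρs
  obtain ⟨Cn, hCn, hM⟩ := all_moments μ γ κ χ ρs
  obtain ⟨B, hB⟩ := tLpE_family T ((S + 1) * ((T + 1) * C) + (T * ((T + 1) * C) + C)) (by positivity)
    Cn hCn p r
  refine ⟨B + B + B + B, fun _ hp hr hpr {ρ P u w} F hE hK => ?_⟩
  obtain ⟨hX, -, hY, hZ⟩ := hW F hE hK
  have iz := integral_zeta_le hT hX hY hZ
  have a0 : 0 ≤ T * ((T + 1) * C) + C := by positivity
  have a1 : 0 ≤ (S + 1) * ((T + 1) * C) := by positivity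
  have hζ : ∀ t ∈ Ioo 0 T, 0 ≤ Xn u w t + Yn ρ u w t + Zn u w t := fun t ht =>
    F.zeta_nonneg (Ioo_subset_Icc_self ht)
  have xy : ∀ t ∈ Ioo 0 T, ∀ a, a ≤ (S + 1) * (Xn u w t + Yn ρ u w t) →
      t * a ≤ (S + 1) * ((T + 1) * C) + (T * ((T + 1) * C) + C) := fun t ht a h => by
    have b := hY t ht
    have : t * Xn u w t ≤ T * C :=
      mul_le_mul ht.2.le (hX t (Ioo_subset_Icc_self ht)) (Xn_nonneg u w t) hT.le
    have t0 := ht.1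
    calc t * a ≤ t * ((S + 1) * (Xn u w t + Yn ρ u w t)) := by gcongr
      _ = (S + 1) * (t * Xn u w t + t * Yn ρ u w t) := by ring
      _ ≤ (S + 1) * (T * C + C) := by gcongr
      _ ≤ _ := by linarith
  have xy0 : ∀ t ∈ Ioo 0 T, 0 ≤ Yn ρ u w t := fun t ht =>
    F.eden_nonneg (Ioo_subset_Icc_self ht) (Dm u u) (Dm u w)
  have Gl : ∀ t ∈ Ioo 0 T, ∀ f : SP, G t f ≤ S * (Xn u w t + Yn ρ u w t) → ∀ j,
      t * I t (dx j f ^ 2) ≤ (S + 1) * ((T + 1) * C) + (T * ((T + 1) * C) + C) := fun t ht f h j => by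
    refine xy t ht _ ?_
    have h0 := xy0 t ht
    have h1 := Xn_nonneg u w t
    have n0 : 0 ≤ I t (dx 0 f ^ 2) := I_nonneg fun x => by rw [map_pow]; positivity
    have n1 : 0 ≤ I t (dx 1 f ^ 2) := I_nonneg fun x => by rw [map_pow]; positivity
    unfold G at h
    fin_cases j
    · simp only [Fin.zero_eta]; linarith
    · simp only [Fin.mk_one]; linarith
  have cz := continuous_zeta ρ u w
  have second : ∀ v : Fin 3 → SP,
      (∀ t ∈ Icc 0 T, ∀ i k, G t (dx k (v i)) ≤ S * (Xn u w t + Yn ρ u w t)) →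
      (∀ n, 1 ≤ n → ∀ t ∈ Icc 0 T, ∀ i j k, I t (dx j (dx k (v i)) ^ (2 * n)) ≤
        Cn n * (Xn u w t + Yn ρ u w t + Zn u w t) ^ n) →
      tLpE T p (fun t => √t * iLp r (magGrad2V fun x i => ev t x (v i))) ≤ B := fun v h1 h2 =>
    hB hT hp hr hpr (ι := Fin 3 × Fin 2 × Fin 2) (by simp)
      (fun a => dx a.2.2 (dx a.2.1 (v a.1))) (fun t => magGrad2V fun x i => ev t x (v i)) _ cz hζ
      (fun t _ x => by simp only [magGrad2V, pdir_ev, Fintype.sum_prod_type])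
      (fun t ht a => Gl t ht _ (h1 t (Ioo_subset_Icc_self ht) _ _) _)
      (fun n hn t ht a => h2 n hn t (Ioo_subset_Icc_self ht) _ _ _) (by linarith)
  refine add_le_add (add_le_add (add_le_add ?_ ?_) ?_) ?_
  · exact second u (fun t ht => (hSO F ht).2.1) fun n hn t ht => (hM n hn F ht).2.1
  · exact second w (fun t ht => (hSO F ht).2.2) fun n hn t ht => (hM n hn F ht).2.2.1
  · refine hB hT hp hr hpr (by simp; norm_num) w (fun t x => vmag fun i => ev t x (w i)) _ cz hζ
      (fun t _ x => rfl) (fun t ht i => xy t ht _ ?_)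
      (fun n hn t ht i => (hM n hn F (Ioo_subset_Icc_self ht)).2.2.2 i) (by linarith)
    have h := I_z_sq_le t (jet u w) i
    have h0 := xy0 t ht
    have h1 := Xn_nonneg u w t
    have h2 : 0 ≤ S * (Xn u w t + Yn ρ u w t) := by positivity
    have h3 : I t (w i ^ 2) ≤ Xn u w t := h
    linarith
  · exact hB hT hp hr hpr (by simp; norm_num) (fun j => dx j P) (fun t => magGradS fun x => ev t x P) _ cz hζ
      (fun t _ x => by simp only [magGradS, pdir_ev])
      (fun t ht j => Gl t ht P (hSO F (Ioo_subset_Icc_self ht)).1 j)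
      (fun n hn t ht j => (hM n hn F (Ioo_subset_Icc_self ht)).1 j) (by linarith)

/-- Time integrability of the Lipschitz norms. -/
lemma lipschitz_norms (μ γ κ χ ρs T E K s : ℝ) : ∃ B : ℝ, 0 < T → s ∈ Ico (1 : ℝ) 2 →
    ∀ {ρ P : SP} {u w : Fin 3 → SP},
    BFlow T μ γ κ χ ρs ρ P u w → I 0 (eden ρ u w) ≤ E →
    I 0 (bet (μ + χ) γ κ χ (jet u w) (jet u w)) ≤ K →
    ∫ t in Ioo 0 T, (iLinf (magGradV fun x i => ev t x (u i)) ^ s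
      + iLinf (magGradV fun x i => ev t x (w i)) ^ s) ≤ B := by
  by_cases hc : 0 < T ∧ s ∈ Ico (1 : ℝ) 2
  swap
  · exact ⟨0, fun a b => absurd ⟨a, b⟩ hc⟩
  obtain ⟨hT, hs⟩ := hc
  obtain ⟨C, hC, hW⟩ := weighted_bound μ γ κ χ ρs T E K hT
  obtain ⟨Cn, hCn, hM⟩ := all_moments μ γ κ χ ρs
  obtain ⟨L, hL, hI⟩ := iLinf_rpow_le T C Cn s hs.1 hs.2 hT
  refine ⟨2 * L * ((∫ t in 0..T, t ^ (-(s / 2))) + (T + (T * ((T + 1) * C) + C))),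
    fun _ _ {ρ P u w} F hE hK => ?_⟩
  obtain ⟨hX, -, hY, hZ⟩ := hW F hE hK
  have iz := integral_zeta_le hT hX hY hZ
  obtain ⟨ζ, hζ⟩ : ∃ ζ : ℝ → ℝ, ζ = fun t => Xn u w t + Yn ρ u w t + Zn u w t := ⟨_, rfl⟩
  have cz : Continuous ζ := by rw [hζ]; exact continuous_zeta ρ u w
  have key : ∀ t ∈ Ioo 0 T, iLinf (magGradV fun x i => ev t x (u i)) ^ s
      + iLinf (magGradV fun x i => ev t x (w i)) ^ s ≤
      2 * L * (t ^ (-(s / 2)) + (1 + t * ζ t)) := fun t ht => by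
    have ht' := Ioo_subset_Icc_self ht
    have hz := F.zeta_nonneg ht'
    have a := hI (magGradV fun x i => ev t x (u i)) (fun i j => dx j (u i)) t _ ht hz
      (fun x => by simp only [magGradV, pdir_ev])
      (fun i j => (I_a_sq_le t (jet u w) i j).trans (hX t ht'))
      fun n hn k i j => (hM n hn F ht').2.1 i k j
    have b := hI (magGradV fun x i => ev t x (w i)) (fun i j => dx j (w i)) t _ ht hz
      (fun x => by simp only [magGradV, pdir_ev])
      (fun i j => (I_b_sq_le t (jet u w) i j).trans (hX t ht'))
      fun n hn k i j => (hM n hn F ht').2.2.1 i k j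
    rw [hζ]; linarith
  have i1 : IntervalIntegrable (fun t : ℝ => t ^ (-(s / 2))) volume 0 T :=
    intervalIntegral.intervalIntegrable_rpow' (by linarith [hs.2])
  have c2 : Continuous fun t => t * ζ t := by fun_prop
  have i2 : IntervalIntegrable (fun t => 1 + t * ζ t) volume 0 T :=
    (by fun_prop : Continuous fun t => 1 + t * ζ t).intervalIntegrable 0 T
  have i3 := (i1.add i2).const_mul (2 * L)
  have nn : ∀ g : Vec 2 → ℝ, 0 ≤ iLinf g ^ s := fun g =>
    rpow_nonneg (iSup_nonneg fun x => abs_nonneg _) _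
  calc _ ≤ ∫ t in Ioo 0 T, 2 * L * (t ^ (-(s / 2)) + (1 + t * ζ t)) :=
        integral_mono_of_nonneg (Eventually.of_forall fun t => add_nonneg (nn _) (nn _))
          (((intervalIntegrable_iff_integrableOn_Ioo_of_le hT.le).1 i3))
          ((ae_restrict_iff' measurableSet_Ioo).2 (Eventually.of_forall key))
    _ = ∫ t in 0..T, 2 * L * (t ^ (-(s / 2)) + (1 + t * ζ t)) := by
        rw [intervalIntegral.integral_of_le hT.le, integral_Ioc_eq_integral_Ioo]
    _ = 2 * L * ((∫ t in 0..T, t ^ (-(s / 2))) + (T + ∫ t in 0..T, t * ζ t)) := by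
        rw [intervalIntegral.integral_const_mul, intervalIntegral.integral_add i1 i2,
          intervalIntegral.integral_add (by simp) (c2.intervalIntegrable 0 T)]
        simp
    _ ≤ _ := by
        have : ∫ t in 0..T, t * ζ t ≤ T * ((T + 1) * C) + C := by rw [hζ]; exact iz
        gcongr

end BFlow

lemma initial_energy {T μ γ κ χ ρs : ℝ} {ρ P : SP} {u w : Fin 3 → SP} (hT : 0 < T)
    (F : BFlow T μ γ κ χ ρs ρ P u w) : I 0 (eden ρ u w) =
      √(∫ x in box 2, ev 0 x ρ * vmag (fun i => ev 0 x (u i)) ^ 2) ^ 2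
        + √(∫ x in box 2, ev 0 x ρ * vmag (fun i => ev 0 x (w i)) ^ 2) ^ 2 := by
  obtain ⟨c, c0, hc⟩ := F.lower
  have h : ∀ v : Vec 2 → Fin 3 → ℝ, 0 ≤ ∫ x in box 2, ev 0 x ρ * vmag (v x) ^ 2 := fun v =>
    integral_nonneg fun x => mul_nonneg (c0.le.trans (hc 0 ⟨le_rfl, hT.le⟩ x)) (sq_nonneg _)
  rw [sq_sqrt (h _), sq_sqrt (h _), integral_vmag_sq, integral_vmag_sq, ← map_add, eden, mul_add]

end AsymFluid

/-- **Lemma 4.1: shift of integrability in 2-D.**  For smooth solutions without vacuum on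
`[0,T] × 𝕋²` with `0 ≤ ρ ≤ ρ*`: for all `p ∈ [2,∞]` and `2 ≤ r < p* = 2p/(p−2)`,
`‖∇²(√t u), ∇²(√t ω), √t ω‖_{L^p(0,T;L^r)} + ‖∇(√t P)‖_{L^p(0,T;L^r)} ≤ C_{0,T}`,
with `C_{0,T}` depending only on `T, ρ*, ‖√ρ₀u₀‖₂, ‖√ρ₀ω₀‖₂, K₀, p, r`; moreover for
every `s ∈ [1,2)` there is `θ > 0` with
`∫₀ᵀ (‖∇u‖_∞^s + ‖∇ω‖_∞^s) ≤ C_{0,T} T^θ`. -/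
theorem shift_integrability_2d (μ γ κ χ : ℝ)
    (hμ : 0 < μ) (hγ : 0 < γ) (hκ : 0 < κ) (hχ : 0 < χ) :
    ∃ C : ℝ → ℝ → ℝ → ℝ → ℝ → ENNReal → ℝ → ℝ,
    ∃ C2 : ℝ → ℝ → ℝ → ℝ → ℝ → ℝ → ℝ, ∃ θ : ℝ → ℝ,
      (∀ s ∈ Set.Ico (1:ℝ) 2, 0 < θ s) ∧
      ∀ (T ρstar : ℝ), 0 < T →
      ∀ (ρ : ℝ → Vec 2 → ℝ) (u ω : ℝ → Vec 2 → V3) (P : ℝ → Vec 2 → ℝ),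
        Sol 2 (Set.Icc 0 T) μ γ κ χ ρ u ω P →
        (∃ c : ℝ, 0 < c ∧ ∀ t ∈ Set.Icc (0:ℝ) T, ∀ x, c ≤ ρ t x) →
        (∀ t ∈ Set.Icc (0:ℝ) T, ∀ x, ρ t x ≤ ρstar) →
        ((∀ (p : ENNReal), 2 ≤ p → ∀ r : ℝ, 2 ≤ r → ENNReal.ofReal r < pstar p →
          tLpE T p (fun t => Real.sqrt t * iLp r (magGrad2V (u t)))
            + tLpE T p (fun t => Real.sqrt t * iLp r (magGrad2V (ω t)))
            + tLpE T p (fun t => Real.sqrt t * iLp r (fun x => vmag (ω t x)))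
            + tLpE T p (fun t => Real.sqrt t * iLp r (magGradS (P t)))
          ≤ C T ρstar (Real.sqrt (∫ x in box 2, ρ 0 x * vmag (u 0 x) ^ 2))
              (Real.sqrt (∫ x in box 2, ρ 0 x * vmag (ω 0 x) ^ 2))
              (K0q μ γ κ χ (u 0) (ω 0)) p r) ∧
         (∀ s ∈ Set.Ico (1:ℝ) 2,
          (∫ t in Set.Ioo (0:ℝ) T,
              (iLinf (magGradV (u t)) ^ s + iLinf (magGradV (ω t)) ^ s))
            ≤ C2 T ρstar (Real.sqrt (∫ x in box 2, ρ 0 x * vmag (u 0 x) ^ 2))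
                (Real.sqrt (∫ x in box 2, ρ 0 x * vmag (ω 0 x) ^ 2))
                (K0q μ γ κ χ (u 0) (ω 0)) s * T ^ θ s)) := by
  choose C hC using fun T ρs a b K p r =>
    AsymFluid.BFlow.second_derivative_norms μ γ κ χ ρs T (a ^ 2 + b ^ 2) K p r
  choose C2 hC2 using fun T ρs a b K s => AsymFluid.BFlow.lipschitz_norms μ γ κ χ ρs T (a ^ 2 + b ^ 2) K s
  refine ⟨C, fun T ρs a b K s => C2 T ρs a b K s / T, fun _ => 1, fun _ _ => one_pos,
    fun T ρs hT ρ u ω P h hl hu => ?_⟩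
  obtain ⟨ρ, P, u, w, F, rfl, rfl, rfl, rfl⟩ := AsymFluid.exists_BFlow h hl hu
  have hE := (AsymFluid.initial_energy hT F).le
  have hK := (AsymFluid.K0q_eq F hT).ge
  refine ⟨fun p hp r hr hpr => hC _ _ _ _ _ _ _ hT hp hr hpr F hE hK, fun s hs => ?_⟩
  rw [rpow_one, div_mul_cancel₀ _ hT.ne']
  exact hC2 _ _ _ _ _ _ hT hs F hE hK
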